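/- Let n ≥ 1 and let f : ℝⁿ → ℝ be real analytic on a neighborhood U of 0 with f(0) = 0 and ∇f(0) = 0. Assume there exist g > 0 with g < 1/(n+1), an integer 0 ≤ k ≤ n−1, and r₀ > 0 such that for every 0 < r < r₀ there is c_r > 0 with m({x : |x| < r, |f(x)| < ε}) = c_r ε^g (log(1/ε))^k + o(ε^g (log(1/ε))^k) as ε → 0⁺. Then there is a neighborhood N ⊆ U of 0 such that for every smooth compactly supported φ : ℝⁿ → ℝ with support in N there is a constant C > 0 such that for all ξ = (ξ₁,…,ξ_{n+1}) ∈ ℝ^{n+1} with |ξ| > 2 one has |∫_{ℝⁿ} φ(x) e^{−i(ξ_{n+1} f(x) + ξ₁x₁ + ⋯ + ξₙxₙ)} dx| ≤ C |ξ|^{−g} (log|ξ|)^k. -/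

import Mathlib

open MeasureTheory Filter Topology Asymptotics Complex

section Germs

variable {E : Type*} [NormedAddCommGroup E] [NormedSpace ℝ E]

theorem germ_eq_zero_or_eq_zero_of_mul {F G : E → ℝ} {a : E} (hF : AnalyticAt ℝ F a)
    (hG : AnalyticAt ℝ G a) (h : ∀ᶠ x in 𝓝 a, F x * G x = 0) :
    F =ᶠ[𝓝 a] 0 ∨ G =ᶠ[𝓝 a] 0 := by
  by_contra! hne
  obtain ⟨hF0, hG0⟩ := hne
  obtain ⟨r, hr, hball⟩ := Metric.eventually_nhds_iff_ball.1
    ((hF.eventually_analyticAt.and hG.eventually_analyticAt).and h)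
  have hex : ∃ y ∈ Metric.ball a r, F y ≠ 0 := by
    by_contra! hc
    exact hF0 (Filter.eventually_of_mem (Metric.ball_mem_nhds a hr) hc)
  obtain ⟨y, hy, hFy⟩ := hex
  have hGy : G =ᶠ[𝓝 y] 0 := by
    filter_upwards [(hball y hy).1.1.continuousAt.eventually_ne hFy,
      Metric.isOpen_ball.mem_nhds hy] with z hz hzb
    exact (mul_eq_zero.1 (hball z hzb).2).resolve_left hz
  have hGan : AnalyticOnNhd ℝ G (Metric.ball a r) := fun z hz => (hball z hz).1.2
  have := hGan.eqOn_zero_of_preconnected_of_eventuallyEq_zero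
    (convex_ball a r).isPreconnected hy hGy
  exact hG0 (Filter.eventually_of_mem (Metric.ball_mem_nhds a hr) this)

theorem germ_mul_left_cancel {F G H : E → ℝ} {a : E} (hF : AnalyticAt ℝ F a)
    (hG : AnalyticAt ℝ G a) (hH : AnalyticAt ℝ H a) (hF0 : ¬ F =ᶠ[𝓝 a] 0)
    (h : ∀ᶠ x in 𝓝 a, F x * G x = F x * H x) : G =ᶠ[𝓝 a] H := by
  rcases germ_eq_zero_or_eq_zero_of_mul hF (hG.sub hH)
    (h.mono fun x hx => by simp only [Pi.sub_apply]; linear_combination hx) with h1 | h1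
  · exact absurd h1 hF0
  · filter_upwards [h1] with x hx
    simpa [sub_eq_zero] using hx

/-- Replace the first `l` of `m` slots equal to `x` by `y`. -/
theorem multilinear_telescope {m : ℕ} (p : ContinuousMultilinearMap ℝ (fun _ : Fin m => E) ℝ)
    (x y : E) :
    p (fun _ => x) - p (fun _ => y) =
      ∑ l : Fin m, p (Function.update (fun j => if j < l then y else x) l (x - y)) := by
  have key : ∀ l : Fin m, p (Function.update (fun j => if j < l then y else x) l (x - y)) =
      p (fun j => if (j : ℕ) < l then y else x) - p (fun j => if (j : ℕ) < (l : ℕ) + 1 then y else x) := by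
    intro l
    rw [p.map_update_sub]
    congr 2
    · ext j
      rcases eq_or_ne j l with rfl | h
      · simp
      · simp [h]
    · ext j
      rcases eq_or_ne j l with rfl | h
      · simp
      · have : (j : ℕ) ≠ l := fun h' => h (Fin.ext h')
        rw [Function.update_of_ne h]
        exact if_congr (show (j : ℕ) < l ↔ (j : ℕ) < (l : ℕ) + 1 by omega) rfl rfl
  simp_rw [key]
  rw [Fin.sum_univ_eq_sum_range (fun l => p (fun j => if (j : ℕ) < l then y else x) -
    p (fun j => if (j : ℕ) < l + 1 then y else x)), Finset.sum_range_sub']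
  simp

end Germs

section Division

variable {n : ℕ}

/-- The power series of the divided difference. -/
noncomputable def divSeries (p : FormalMultilinearSeries ℝ (Fin n → ℝ) ℝ) (i : Fin n) :
    FormalMultilinearSeries ℝ (Fin n → ℝ) ℝ := fun k =>
  ∑ l : Fin (k + 1), ((p (k + 1)).curryMid l (Pi.single i 1)).compContinuousLinearMap
    (fun j => if l.succAbove j < l then
      ContinuousLinearMap.pi (fun i' => if i' = i then 0 else ContinuousLinearMap.proj i')
      else ContinuousLinearMap.id ℝ _)

theorem divSeries_apply (p : FormalMultilinearSeries ℝ (Fin n → ℝ) ℝ) (i : Fin n) (k : ℕ)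
    (x : Fin n → ℝ) :
    x i * divSeries p i k (fun _ => x) =
      p (k + 1) (fun _ => x) - p (k + 1) (fun _ => Function.update x i 0) := by
  rw [multilinear_telescope, divSeries, sum_apply, Finset.mul_sum]
  refine Finset.sum_congr rfl fun l _ => ?_
  have hP : (ContinuousLinearMap.pi (fun i' => if i' = i then 0 else
      ContinuousLinearMap.proj (R := ℝ) (φ := fun _ : Fin n => ℝ) i')) x = Function.update x i 0 := by
    ext j
    rcases eq_or_ne j i with rfl | h
    · simp
    · simp [h]
  have hd : x - Function.update x i 0 = x i • Pi.single i (1 : ℝ) := by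
    ext j
    rcases eq_or_ne j i with rfl | h
    · simp
    · simp [h]
  rw [hd, (p (k + 1)).map_update_smul, smul_eq_mul]
  congr 1
  rw [ContinuousMultilinearMap.compContinuousLinearMap_apply,
    ContinuousMultilinearMap.curryMid_apply]
  congr 1
  ext1 j
  rcases Fin.eq_self_or_eq_succAbove l j with rfl | ⟨j, rfl⟩
  · simp
  · simp only [Fin.insertNth_apply_succAbove, Function.update_of_ne (Fin.succAbove_ne l j)]
    split_ifs
    · exact hP
    · rfl

theorem norm_divSeries_le (p : FormalMultilinearSeries ℝ (Fin n → ℝ) ℝ) (i : Fin n) (k : ℕ) :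
    ‖divSeries p i k‖ ≤ (k + 1) * ‖p (k + 1)‖ := by
  rw [divSeries]
  refine (norm_sum_le _ _).trans ?_
  have : ∀ l ∈ (Finset.univ : Finset (Fin (k + 1))),
      ‖((p (k + 1)).curryMid l (Pi.single i 1)).compContinuousLinearMap
    (fun j => if l.succAbove j < l then
      ContinuousLinearMap.pi (fun i' => if i' = i then 0 else ContinuousLinearMap.proj i')
      else ContinuousLinearMap.id ℝ _)‖ ≤ ‖p (k + 1)‖ := by
    intro l _
    refine (ContinuousMultilinearMap.norm_compContinuousLinearMap_le _ _).trans ?_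
    have h1 : ‖(p (k + 1)).curryMid l (Pi.single i 1)‖ ≤ ‖p (k + 1)‖ := by
      refine (ContinuousLinearMap.le_opNorm _ _).trans ?_
      rw [ContinuousMultilinearMap.norm_curryMid]
      have : ‖(Pi.single i 1 : Fin n → ℝ)‖ ≤ 1 := by
        rw [pi_norm_le_iff_of_nonneg zero_le_one]
        intro j
        rcases eq_or_ne j i with rfl | h
        · simp
        · simp [h]
      simpa using mul_le_mul_of_nonneg_left this (norm_nonneg _)
    have h2 : ∏ j : Fin k, ‖(if l.succAbove j < l then
      ContinuousLinearMap.pi (fun i' => if i' = i then 0 else ContinuousLinearMap.proj i')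
      else ContinuousLinearMap.id ℝ (Fin n → ℝ))‖ ≤ 1 := by
      refine Finset.prod_le_one (fun _ _ => norm_nonneg _) fun j _ => ?_
      split_ifs
      · refine ContinuousLinearMap.opNorm_le_bound _ zero_le_one fun x => ?_
        rw [one_mul, pi_norm_le_iff_of_nonneg (norm_nonneg _)]
        intro j'
        by_cases h : j' = i
        · simp [h]
        · simpa [h] using norm_le_pi_norm x j'
      · exact ContinuousLinearMap.norm_id_le
    calc _ ≤ ‖p (k + 1)‖ * 1 := mul_le_mul h1 h2 (Finset.prod_nonneg fun _ _ => norm_nonneg _)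
            (norm_nonneg _)
      _ = _ := mul_one _
  refine (Finset.sum_le_sum this).trans ?_
  simp

theorem exists_divided_difference {F : (Fin n → ℝ) → ℝ} (hF : AnalyticAt ℝ F 0) (i : Fin n) :
    ∃ D : (Fin n → ℝ) → ℝ, AnalyticAt ℝ D 0 ∧
      ∀ᶠ x in 𝓝 0, F x = F (Function.update x i 0) + x i * D x := by
  obtain ⟨p, r, hp⟩ := hF
  obtain ⟨a, ha0, ha⟩ := ENNReal.lt_iff_exists_nnreal_btwn.1 hp.r_pos
  have ha0' : 0 < a := by exact_mod_cast ha0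
  obtain ⟨C, hC, hb⟩ := p.norm_mul_pow_le_of_lt_radius (ha.trans_le hp.r_le)
  have hrad : 0 < (divSeries p i).radius := by
    refine lt_of_lt_of_le (b := ((a / 2 : NNReal) : ENNReal)) (by positivity) ?_
    refine (divSeries p i).le_radius_of_bound (2 * C / a) fun k => ?_
    have h1 := norm_divSeries_le p i k
    have h2 := hb (k + 1)
    have h3 : ((k : ℝ) + 1) ≤ 2 * 2 ^ k := by
      have : k + 1 ≤ 2 * 2 ^ k := by
        rw [← pow_succ']; exact Nat.lt_two_pow_self.le
      exact_mod_cast this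
    have ha1 : (0 : ℝ) < a := ha0'
    calc ‖divSeries p i k‖ * ((a / 2 : NNReal) : ℝ) ^ k
        ≤ ((k + 1) * ‖p (k + 1)‖) * ((a : ℝ) / 2) ^ k := by
          push_cast; gcongr
      _ ≤ (2 * 2 ^ k * ‖p (k + 1)‖) * ((a : ℝ) / 2) ^ k := by gcongr
      _ = 2 * (‖p (k + 1)‖ * (a : ℝ) ^ (k + 1)) / a := by
          rw [div_pow, pow_succ]; field_simp
      _ ≤ 2 * C / a := by gcongr
  have hq := (divSeries p i).hasFPowerSeriesOnBall hrad
  refine ⟨_, hq.analyticAt, ?_⟩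
  have hmem : Metric.eball (0 : Fin n → ℝ) (min r (divSeries p i).radius) ∈ 𝓝 0 :=
    Metric.eball_mem_nhds _ (lt_min hp.r_pos hrad)
  filter_upwards [hmem] with x hx
  have hxr : x ∈ Metric.eball (0 : Fin n → ℝ) r := Metric.eball_subset_eball (min_le_left _ _) hx
  have hxq : x ∈ Metric.eball (0 : Fin n → ℝ) (divSeries p i).radius :=
    Metric.eball_subset_eball (min_le_right _ _) hx
  have hPx : Function.update x i 0 ∈ Metric.eball (0 : Fin n → ℝ) r := by
    rw [Metric.mem_eball, edist_zero_right] at hxr ⊢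
    refine lt_of_le_of_lt ?_ hxr
    rw [enorm_le_iff_norm_le, pi_norm_le_iff_of_nonneg (norm_nonneg _)]
    intro j
    rcases eq_or_ne j i with rfl | h
    · simp
    · simpa [h] using norm_le_pi_norm x j
  have s1 := hp.hasSum hxr
  have s2 := hp.hasSum hPx
  have s3 := (hq.hasSum hxq).mul_left (x i)
  simp only [zero_add] at s1 s2 s3
  have s4 := s1.sub s2
  rw [← hasSum_nat_add_iff' 1] at s4
  simp only [Finset.range_one, Finset.sum_singleton] at s4
  have e0 : p 0 (fun _ => x) = p 0 (fun _ => Function.update x i 0) :=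
    congrArg _ (Subsingleton.elim _ _)
  rw [e0, sub_self, sub_zero] at s4
  have := s3.unique (s4.congr_fun fun k => divSeries_apply p i k x)
  linarith

end Division

section Monomials

variable {n : ℕ}

/-- The monomial `x ^ α`. -/
def monom (α : Fin n → ℕ) (x : Fin n → ℝ) : ℝ := ∏ i, x i ^ α i

/-- The germ of `F` at `0` is a monomial times a unit. -/
def Mono (F : (Fin n → ℝ) → ℝ) : Prop :=
  ∃ (α : Fin n → ℕ) (U : (Fin n → ℝ) → ℝ), AnalyticAt ℝ U 0 ∧ U 0 ≠ 0 ∧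
    F =ᶠ[𝓝 0] fun x => monom α x * U x

theorem analyticAt_coord (i : Fin n) (a : Fin n → ℝ) :
    AnalyticAt ℝ (fun x : Fin n → ℝ => x i) a :=
  (ContinuousLinearMap.proj (R := ℝ) (φ := fun _ : Fin n => ℝ) i).analyticAt a

theorem analyticAt_monom (α : Fin n → ℕ) (a : Fin n → ℝ) : AnalyticAt ℝ (monom α) a :=
  Finset.univ.analyticAt_fun_prod fun i _ => (analyticAt_coord i a).pow _

theorem monom_add (α β : Fin n → ℕ) (x : Fin n → ℝ) :
    monom (α + β) x = monom α x * monom β x := by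
  simp [monom, pow_add, Finset.prod_mul_distrib]

@[simp] theorem monom_zero (x : Fin n → ℝ) : monom 0 x = 1 := by simp [monom]

@[simp] theorem monom_single (i : Fin n) (k : ℕ) (x : Fin n → ℝ) :
    monom (Pi.single i k) x = x i ^ k := by
  rw [monom, Finset.prod_eq_single i] <;> simp +contextual

theorem monom_nsmul (k : ℕ) (α : Fin n → ℕ) (x : Fin n → ℝ) :
    monom (k • α) x = monom α x ^ k := by
  simp [monom, ← Finset.prod_pow, ← pow_mul, mul_comm]

theorem monom_ne_zero {α : Fin n → ℕ} {x : Fin n → ℝ} (h : ∀ i, α i ≠ 0 → x i ≠ 0) :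
    monom α x ≠ 0 := by
  refine Finset.prod_ne_zero_iff.2 fun i _ => ?_
  by_cases hi : α i = 0
  · simp [hi]
  · exact pow_ne_zero _ (h i hi)

theorem monom_eq_zero {α : Fin n → ℕ} {x : Fin n → ℝ} {i : Fin n} (h : α i ≠ 0) (hx : x i = 0) :
    monom α x = 0 :=
  Finset.prod_eq_zero (Finset.mem_univ i) (by simp [hx, h])

theorem monom_zero_apply {α : Fin n → ℕ} (h : α ≠ 0) : monom α (0 : Fin n → ℝ) = 0 := by
  obtain ⟨i, hi⟩ := Function.ne_iff.1 h
  exact monom_eq_zero hi rfl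

/-- Points with prescribed vanishing coordinates exist in every neighbourhood of `0`. -/
theorem exists_test_point {P : (Fin n → ℝ) → Prop} (h : ∀ᶠ x in 𝓝 0, P x) (S : Set (Fin n)) :
    ∃ x, P x ∧ (∀ i ∈ S, x i = 0) ∧ ∀ i ∉ S, x i ≠ 0 := by
  classical
  have hc : Tendsto (fun t : ℝ => fun i : Fin n => if i ∈ S then (0 : ℝ) else t) (𝓝[≠] 0)
      (𝓝 0) := by
    refine Tendsto.mono_left ?_ nhdsWithin_le_nhds
    have : Continuous (fun t : ℝ => fun i : Fin n => if i ∈ S then (0 : ℝ) else t) := by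
      refine continuous_pi fun i => ?_
      split_ifs <;> fun_prop
    convert! this.tendsto 0 using 2
    ext i; simp
  obtain ⟨t, ht, ht0⟩ := ((hc.eventually h).and self_mem_nhdsWithin).exists
  exact ⟨_, ht, fun i hi => by simp [hi], fun i hi => by simpa [hi] using ht0⟩

theorem monom_germ_ne_zero (α : Fin n → ℕ) : ¬ monom α =ᶠ[𝓝 (0 : Fin n → ℝ)] 0 := by
  intro h
  obtain ⟨x, hx, -, hx0⟩ := exists_test_point h ∅
  exact monom_ne_zero (fun i _ => hx0 i (Set.notMem_empty i)) hx

theorem Mono.congr {F G : (Fin n → ℝ) → ℝ} (hF : Mono F) (h : G =ᶠ[𝓝 0] F) : Mono G := by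
  obtain ⟨α, U, hU, hU0, hFU⟩ := hF
  exact ⟨α, U, hU, hU0, h.trans hFU⟩

theorem mono_of_ne_zero {F : (Fin n → ℝ) → ℝ} (hF : AnalyticAt ℝ F 0) (h : F 0 ≠ 0) : Mono F :=
  ⟨0, F, hF, h, by simp [EventuallyEq.refl]⟩

theorem mono_monom (α : Fin n → ℕ) : Mono (monom α) :=
  ⟨α, fun _ => 1, analyticAt_const, one_ne_zero, by simp⟩

theorem Mono.mul {F G : (Fin n → ℝ) → ℝ} (hF : Mono F) (hG : Mono G) :
    Mono (fun x => F x * G x) := by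
  obtain ⟨α, U, hU, hU0, hFU⟩ := hF
  obtain ⟨β, V, hV, hV0, hGV⟩ := hG
  refine ⟨α + β, fun x => U x * V x, hU.mul hV, mul_ne_zero hU0 hV0, ?_⟩
  filter_upwards [hFU, hGV] with x h1 h2
  rw [h1, h2, monom_add]; ring

theorem Mono.germ_ne_zero {F : (Fin n → ℝ) → ℝ} (hF : Mono F) : ¬ F =ᶠ[𝓝 0] 0 := by
  obtain ⟨α, U, hU, hU0, hFU⟩ := hF
  intro h
  rcases germ_eq_zero_or_eq_zero_of_mul (analyticAt_monom α 0) hU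
    (by filter_upwards [h, hFU] with x h1 h2; rw [← h2, h1]; rfl) with h1 | h1
  · exact monom_germ_ne_zero α h1
  · exact hU0 h1.self_of_nhds

theorem tendsto_update_zero (i : Fin n) :
    Tendsto (fun x : Fin n → ℝ => Function.update x i 0) (𝓝 0) (𝓝 0) := by
  have : Continuous (fun x : Fin n → ℝ => Function.update x i 0) := by fun_prop
  convert! this.tendsto 0 using 2
  ext j; by_cases h : j = i <;> simp [h]

theorem analyticAt_update_zero (i : Fin n) (a : Fin n → ℝ) :
    AnalyticAt ℝ (fun x : Fin n → ℝ => Function.update x i 0) a := by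
  rw [analyticAt_pi_iff]
  intro j
  by_cases h : j = i
  · simpa [Function.update_apply, h] using analyticAt_const
  · simpa [Function.update_apply, h] using analyticAt_coord j a

theorem AnalyticAt.comp_zero {m : ℕ} {F : (Fin n → ℝ) → ℝ} (hF : AnalyticAt ℝ F 0)
    {τ : (Fin m → ℝ) → (Fin n → ℝ)} (hτ : AnalyticAt ℝ τ 0) (h0 : τ 0 = 0) :
    AnalyticAt ℝ (fun x => F (τ x)) 0 :=
  AnalyticAt.fun_comp (by rwa [h0]) hτ

theorem tendsto_of_analyticAt {m : ℕ} {τ : (Fin m → ℝ) → (Fin n → ℝ)} (hτ : AnalyticAt ℝ τ 0)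
    (h0 : τ 0 = 0) : Tendsto τ (𝓝 0) (𝓝 0) := by
  simpa [h0] using hτ.continuousAt.tendsto

theorem update_zero_zero (i : Fin n) : Function.update (0 : Fin n → ℝ) i 0 = 0 := by
  ext j; by_cases h : j = i <;> simp [h]

theorem mono_of_mul_aux (N : ℕ) : ∀ (α : Fin n → ℕ) (F G U : (Fin n → ℝ) → ℝ), ∑ i, α i = N →
    AnalyticAt ℝ F 0 → AnalyticAt ℝ G 0 → AnalyticAt ℝ U 0 → U 0 ≠ 0 →
    (∀ᶠ x in 𝓝 0, F x * G x = monom α x * U x) → Mono F := by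
  induction N with
  | zero =>
    intro α F G U hα hF hG hU hU0 h
    have hα : α = 0 := by
      ext i; simpa using Finset.sum_eq_zero_iff.1 hα i (Finset.mem_univ i)
    subst hα
    have := h.self_of_nhds
    simp only [monom_zero, one_mul] at this
    exact mono_of_ne_zero hF fun h0 => hU0 (by rw [← this, h0, zero_mul])
  | succ N ih =>
    intro α F G U hα hF hG hU hU0 h
    obtain ⟨i, hi⟩ : ∃ i, α i ≠ 0 := by
      by_contra! hc
      simp [hc] at hα
    obtain ⟨β, rfl⟩ : ∃ β : Fin n → ℕ, α = Pi.single i 1 + β := by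
      refine ⟨α - Pi.single i 1, ?_⟩
      ext j
      by_cases hj : j = i
      · subst hj
        rw [Pi.add_apply, Pi.sub_apply, Pi.single_eq_same]
        omega
      · rw [Pi.add_apply, Pi.sub_apply, Pi.single_eq_of_ne hj]
        omega
    have hβ : ∑ j, β j = N := by
      have : ∑ j, (Pi.single i 1 : Fin n → ℕ) j = 1 := by simp
      simp only [Pi.add_apply, Finset.sum_add_distrib] at hα
      omega
    have hx0 : ¬ (fun x : Fin n → ℝ => x i) =ᶠ[𝓝 0] 0 := by
      have := monom_germ_ne_zero (Pi.single i 1)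
      have he : monom (Pi.single i 1) = fun x : Fin n → ℝ => x i := by ext x; simp
      rwa [he] at this
    obtain ⟨DF, hDF, hDFe⟩ := exists_divided_difference hF i
    obtain ⟨DG, hDG, hDGe⟩ := exists_divided_difference hG i
    rcases germ_eq_zero_or_eq_zero_of_mul
      (hF.comp_zero (analyticAt_update_zero i 0) (update_zero_zero i))
      (hG.comp_zero (analyticAt_update_zero i 0) (update_zero_zero i)) (by
        filter_upwards [(tendsto_update_zero i).eventually h] with x hx
        rw [hx, monom_eq_zero (i := i) hi (by simp), zero_mul]) with h1 | h1
    · have hFe : F =ᶠ[𝓝 0] fun x => monom (Pi.single i 1) x * DF x := by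
        filter_upwards [hDFe, h1] with x h2 h3
        simp only [Pi.zero_apply] at h3
        rw [h2, h3]; simp
      refine Mono.congr ((mono_monom _).mul (ih β DF G U hβ hDF hG hU hU0 ?_)) hFe
      refine germ_mul_left_cancel (analyticAt_coord i 0) (hDF.mul hG)
        ((analyticAt_monom β 0).mul hU) hx0 ?_
      filter_upwards [h, hFe] with x h2 h3
      simp only [monom_add, h3, monom_single, pow_one] at h2 ⊢
      linear_combination h2
    · have hGe : G =ᶠ[𝓝 0] fun x => monom (Pi.single i 1) x * DG x := by
        filter_upwards [hDGe, h1] with x h2 h3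
        simp only [Pi.zero_apply] at h3
        rw [h2, h3]; simp
      refine ih β F DG U hβ hF hDG hU hU0 ?_
      refine germ_mul_left_cancel (analyticAt_coord i 0) (hF.mul hDG)
        ((analyticAt_monom β 0).mul hU) hx0 ?_
      filter_upwards [h, hGe] with x h2 h3
      simp only [monom_add, h3, monom_single, pow_one] at h2 ⊢
      linear_combination h2

theorem Mono.of_mul_left {F G : (Fin n → ℝ) → ℝ} (hF : AnalyticAt ℝ F 0) (hG : AnalyticAt ℝ G 0)
    (h : Mono (fun x => F x * G x)) : Mono F := by
  obtain ⟨α, U, hU, hU0, hFU⟩ := h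
  exact mono_of_mul_aux _ α F G U rfl hF hG hU hU0 hFU

theorem Mono.of_mul_right {F G : (Fin n → ℝ) → ℝ} (hF : AnalyticAt ℝ F 0) (hG : AnalyticAt ℝ G 0)
    (h : Mono (fun x => F x * G x)) : Mono G :=
  Mono.of_mul_left hG hF (by simpa only [mul_comm] using h)

theorem Mono.of_prod {ι : Type*} {s : Finset ι} {F : ι → (Fin n → ℝ) → ℝ}
    (hF : ∀ i ∈ s, AnalyticAt ℝ (F i) 0) (h : Mono (fun x => ∏ i ∈ s, F i x)) :
    ∀ i ∈ s, Mono (F i) := by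
  classical
  intro i hi
  simp_rw [← Finset.mul_prod_erase s (fun i => F i _) hi] at h
  exact h.of_mul_left (hF i hi)
    (Finset.analyticAt_fun_prod _ fun j hj => hF j (Finset.mem_of_mem_erase hj))

theorem monom_le_or_le {α β : Fin n → ℕ} {U V : (Fin n → ℝ) → ℝ} (hU : AnalyticAt ℝ U 0)
    (hV : AnalyticAt ℝ V 0) (hU0 : U 0 ≠ 0) (hV0 : V 0 ≠ 0)
    (h : (fun x => monom α x * U x - monom β x * V x) =ᶠ[𝓝 0] 0 ∨
      Mono (fun x => monom α x * U x - monom β x * V x)) : α ≤ β ∨ β ≤ α := by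
  obtain ⟨γ, a, b, rfl, rfl, hab⟩ : ∃ γ a b : Fin n → ℕ, α = γ + a ∧ β = γ + b ∧
      ∀ i, a i = 0 ∨ b i = 0 := by
    refine ⟨α ⊓ β, α - α ⊓ β, β - α ⊓ β, ?_, ?_, fun i => ?_⟩
    · exact (add_tsub_cancel_of_le inf_le_left).symm
    · exact (add_tsub_cancel_of_le inf_le_right).symm
    · simp only [Pi.sub_apply, Pi.inf_apply]; omega
  set H : (Fin n → ℝ) → ℝ := fun x => monom a x * U x - monom b x * V x with hH
  have hHa : AnalyticAt ℝ H 0 :=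
    ((analyticAt_monom a 0).mul hU).sub ((analyticAt_monom b 0).mul hV)
  have he : (fun x => monom (γ + a) x * U x - monom (γ + b) x * V x) =
      fun x => monom γ x * H x := by
    ext x; simp only [monom_add, hH]; ring
  rw [he] at h
  have hH' : H =ᶠ[𝓝 0] 0 ∨ Mono H := by
    rcases h with h | h
    · exact Or.inl ((germ_eq_zero_or_eq_zero_of_mul (analyticAt_monom γ 0) hHa h).resolve_left
        (monom_germ_ne_zero γ))
    · exact Or.inr (h.of_mul_right (analyticAt_monom γ 0) hHa)
  by_contra! hne
  have ha : a ≠ 0 := by rintro rfl; exact hne.1 (by intro i; simp)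
  have hb : b ≠ 0 := by rintro rfl; exact hne.2 (by intro i; simp)
  obtain ⟨i, hi⟩ := Function.ne_iff.1 ha
  obtain ⟨k, hk⟩ := Function.ne_iff.1 hb
  simp only [Pi.zero_apply] at hi hk
  obtain ⟨j, hj⟩ : ∃ j, ∀ᶠ x in 𝓝 (0 : Fin n → ℝ), x j = 0 → H x = 0 := by
    rcases hH' with h0 | ⟨δ, W, hW, hW0, hHW⟩
    · exact ⟨i, h0.mono fun x hx _ => hx⟩
    · have hδ : δ ≠ 0 := by
        rintro rfl
        have := hHW.self_of_nhds
        simp [hH, monom_zero_apply ha, monom_zero_apply hb] at this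
        exact hW0 this.symm
      obtain ⟨j, hj⟩ := Function.ne_iff.1 hδ
      refine ⟨j, hHW.mono fun x hx hx0 => ?_⟩
      rw [hx]; simp only [monom_eq_zero hj hx0, zero_mul]
  have hev := (hj.and (hU.continuousAt.eventually_ne hU0)).and (hV.continuousAt.eventually_ne hV0)
  rcases hab j with h0 | h0
  · obtain ⟨x, ⟨⟨h1, h2⟩, h3⟩, h4, h5⟩ := exists_test_point hev {j, k}
    have h6 := h1 (h4 j (by simp))
    simp only [hH, monom_eq_zero hk (h4 k (by simp)), zero_mul, sub_zero] at h6
    refine mul_ne_zero (monom_ne_zero fun l hl => h5 l ?_) h2 h6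
    rintro (rfl | rfl)
    · exact hl h0
    · exact ((hab _).resolve_right hk ▸ hl) rfl
  · obtain ⟨x, ⟨⟨h1, h2⟩, h3⟩, h4, h5⟩ := exists_test_point hev {j, i}
    have h6 := h1 (h4 j (by simp))
    simp only [hH, monom_eq_zero hi (h4 i (by simp)), zero_mul, zero_sub, neg_eq_zero] at h6
    refine mul_ne_zero (monom_ne_zero fun l hl => h5 l ?_) h3 h6
    rintro (rfl | rfl)
    · exact hl h0
    · exact ((hab _).resolve_left hi ▸ hl) rfl

theorem Mono.comp_congr {m : ℕ} {F G : (Fin n → ℝ) → ℝ} {τ : (Fin m → ℝ) → (Fin n → ℝ)}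
    (hτ : AnalyticAt ℝ τ 0) (h0 : τ 0 = 0) (h : G =ᶠ[𝓝 0] F) (hF : Mono (fun x => F (τ x))) :
    Mono (fun x => G (τ x)) :=
  hF.congr ((tendsto_of_analyticAt hτ h0).eventually h)

end Monomials

section Reduction

variable {n : ℕ}

def shearMap (i : Fin n) (θ : (Fin n → ℝ) → ℝ) (x : Fin n → ℝ) : Fin n → ℝ :=
  Function.update x i (x i + θ x)

def powMap (i : Fin n) (N : ℕ) (ε : ℝ) (x : Fin n → ℝ) : Fin n → ℝ :=
  Function.update x i (ε * x i ^ N)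

def blowA (i j : Fin n) (b : ℝ) (x : Fin n → ℝ) : Fin n → ℝ :=
  Function.update x i (x j * (x i + b))

def blowB (i j : Fin n) (x : Fin n → ℝ) : Fin n → ℝ :=
  Function.update x j (x i * x j)

/-- The elementary families of charts, each chart with its Jacobian weight. -/
inductive Step : Set (((Fin n → ℝ) → (Fin n → ℝ)) × ((Fin n → ℝ) → ℝ)) → Prop
  | shear (i : Fin n) (θ : (Fin n → ℝ) → ℝ) (hθ : ContDiff ℝ (⊤ : ℕ∞) θ) (ha : AnalyticAt ℝ θ 0)
      (h0 : θ 0 = 0) (hi : ∀ x t, θ (Function.update x i t) = θ x) :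
      Step {(shearMap i θ, fun _ => 1)}
  | pow (i : Fin n) (N : ℕ) (hN : 0 < N) (hN2 : Even N) :
      Step {p | ∃ ε : ℝ, (ε = 1 ∨ ε = -1) ∧ p = (powMap i N ε, fun x => x i ^ (N - 1))}
  | blow (i j : Fin n) (hij : i ≠ j) :
      Step ({p | ∃ b : ℝ, p = (blowA i j b, fun x => x j)} ∪ {(blowB i j, fun x => x i)})

/-- `Red Q σ ρ`: after finitely many elementary families of charts, every resulting chart
satisfies `Q`. -/
inductive Red (Q : ((Fin n → ℝ) → (Fin n → ℝ)) → ((Fin n → ℝ) → ℝ) → Prop) :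
    ((Fin n → ℝ) → (Fin n → ℝ)) → ((Fin n → ℝ) → ℝ) → Prop
  | done (σ ρ) (h : Q σ ρ) : Red Q σ ρ
  | step (σ ρ) (S) (hS : Step S)
      (h : ∀ p ∈ S, Red Q (fun x => σ (p.1 x)) (fun x => ρ (p.1 x) * p.2 x)) : Red Q σ ρ

theorem Red.mono {Q Q' : ((Fin n → ℝ) → (Fin n → ℝ)) → ((Fin n → ℝ) → ℝ) → Prop}
    (hQ : ∀ σ ρ, Q σ ρ → Q' σ ρ) {σ ρ} (h : Red Q σ ρ) : Red Q' σ ρ := by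
  induction h with
  | done σ ρ h => exact .done _ _ (hQ _ _ h)
  | step σ ρ S hS _ ih => exact .step _ _ S hS ih

theorem Red.bind {Q Q' : ((Fin n → ℝ) → (Fin n → ℝ)) → ((Fin n → ℝ) → ℝ) → Prop}
    (hQ : ∀ σ ρ, Q σ ρ → Red Q' σ ρ) {σ ρ} (h : Red Q σ ρ) : Red Q' σ ρ := by
  induction h with
  | done σ ρ h => exact hQ _ _ h
  | step σ ρ S hS _ ih => exact .step _ _ S hS ih

theorem Red.comp {Q : ((Fin n → ℝ) → (Fin n → ℝ)) → ((Fin n → ℝ) → ℝ) → Prop}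
    {σ τ : (Fin n → ℝ) → (Fin n → ℝ)} {ρ r : (Fin n → ℝ) → ℝ}
    (h : Red (fun τ r => Q (fun x => σ (τ x)) (fun x => ρ (τ x) * r x)) τ r) :
    Red Q (fun x => σ (τ x)) (fun x => ρ (τ x) * r x) := by
  induction h with
  | done τ r h => exact .done _ _ h
  | step τ r S hS _ ih =>
    refine .step _ _ S hS fun p hp => ?_
    simpa only [mul_assoc] using ih p hp

structure Good (σ : (Fin n → ℝ) → (Fin n → ℝ)) (ρ : (Fin n → ℝ) → ℝ) : Prop where
  cont : Continuous σ
  contw : Continuous ρ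
  an : AnalyticAt ℝ σ 0
  anw : AnalyticAt ℝ ρ 0
  zero : σ 0 = 0

theorem good_id : Good (fun x : Fin n → ℝ => x) (fun _ => 1) :=
  ⟨continuous_id, continuous_const, analyticAt_id, analyticAt_const, rfl⟩

theorem Good.comp {σ ρ} {τ : (Fin n → ℝ) → (Fin n → ℝ)} {r : (Fin n → ℝ) → ℝ} (h : Good σ ρ)
    (h' : Good τ r) : Good (fun x => σ (τ x)) (fun x => ρ (τ x) * r x) where
  cont := h.cont.comp h'.cont
  contw := (h.contw.comp h'.cont).mul h'.contw
  an := AnalyticAt.fun_comp (by rw [h'.zero]; exact h.an) h'.an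
  anw := (AnalyticAt.fun_comp (by rw [h'.zero]; exact h.anw) h'.an).mul h'.anw
  zero := by rw [h'.zero, h.zero]

theorem analyticAt_update {g : (Fin n → ℝ) → ℝ} {a : Fin n → ℝ} (hg : AnalyticAt ℝ g a)
    (i : Fin n) : AnalyticAt ℝ (fun x => Function.update x i (g x)) a := by
  rw [analyticAt_pi_iff]
  intro j
  by_cases h : j = i
  · subst h; simpa using hg
  · simpa [h] using analyticAt_coord j a

theorem update_zero_of_eq_zero {i : Fin n} {t : ℝ} (ht : t = 0) :
    Function.update (0 : Fin n → ℝ) i t = 0 := by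
  rw [ht]; exact update_zero_zero i

theorem mono_coord_pow (i : Fin n) (k : ℕ) : Mono (fun x : Fin n → ℝ => x i ^ k) := by
  have := mono_monom (Pi.single i k)
  rwa [show monom (Pi.single i k) = fun x : Fin n → ℝ => x i ^ k by ext x; simp] at this

theorem mono_coord (i : Fin n) : Mono (fun x : Fin n → ℝ => x i) := by
  simpa using mono_coord_pow i 1

theorem Step.good {S : Set (((Fin n → ℝ) → (Fin n → ℝ)) × ((Fin n → ℝ) → ℝ))} (hS : Step S) :
    ∀ p ∈ S, Good p.1 p.2 ∧ Mono p.2 := by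
  cases hS with
  | shear i θ hθ ha h0 hi =>
    rintro p rfl
    refine ⟨⟨?_, continuous_const, ?_, analyticAt_const, ?_⟩, ?_⟩
    · have := hθ.continuous
      unfold shearMap; fun_prop
    · exact analyticAt_update ((analyticAt_coord i 0).add ha) i
    · exact update_zero_of_eq_zero (by simp [h0])
    · exact mono_of_ne_zero analyticAt_const one_ne_zero
  | pow i N hN hN2 =>
    rintro p ⟨ε, -, rfl⟩
    refine ⟨⟨?_, by fun_prop, ?_, (analyticAt_coord i 0).pow _, ?_⟩, mono_coord_pow _ _⟩
    · unfold powMap; fun_prop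
    · exact analyticAt_update (analyticAt_const.mul ((analyticAt_coord i 0).pow _)) i
    · exact update_zero_of_eq_zero (by simp [hN.ne'])
  | blow i j hij =>
    rintro p (⟨b, rfl⟩ | rfl)
    · refine ⟨⟨?_, by fun_prop, ?_, analyticAt_coord j 0, ?_⟩, mono_coord _⟩
      · unfold blowA; fun_prop
      · exact analyticAt_update
          ((analyticAt_coord j 0).mul ((analyticAt_coord i 0).add analyticAt_const)) i
      · exact update_zero_of_eq_zero (by simp)
    · refine ⟨⟨?_, by fun_prop, ?_, analyticAt_coord i 0, ?_⟩, mono_coord _⟩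
      · unfold blowB; fun_prop
      · exact analyticAt_update ((analyticAt_coord i 0).mul (analyticAt_coord j 0)) j
      · exact update_zero_of_eq_zero (by simp)

/-- `F` can be monomialized by elementary charts. -/
def Mzn (F : (Fin n → ℝ) → ℝ) : Prop :=
  Red (fun τ r => Good τ r ∧ Mono (fun x => F (τ x)) ∧ Mono r) (fun x => x) (fun _ => 1)

theorem Mono.mzn {F : (Fin n → ℝ) → ℝ} (hF : Mono F) : Mzn F :=
  .done _ _ ⟨good_id, hF, mono_of_ne_zero analyticAt_const one_ne_zero⟩

theorem Mzn.congr {F G : (Fin n → ℝ) → ℝ} (hF : Mzn F) (h : G =ᶠ[𝓝 0] F) : Mzn G :=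
  Red.mono (fun _ _ ⟨hg, h1, h2⟩ => ⟨hg, h1.comp_congr hg.an hg.zero h, h2⟩) hF

theorem Mzn.mul_unit {F U : (Fin n → ℝ) → ℝ} (h : Mzn F) (hU : AnalyticAt ℝ U 0) (hU0 : U 0 ≠ 0) :
    Mzn (fun x => F x * U x) :=
  Red.mono (fun _ _ ⟨hg, h1, h2⟩ => ⟨hg, h1.mul (mono_of_ne_zero (hU.comp_zero hg.an hg.zero)
    (by rwa [hg.zero])), h2⟩) h

/-- Reduce along an arbitrary reduction whose leaves can be monomialized. -/
theorem Red.mzn {F : (Fin n → ℝ) → ℝ} (hF : AnalyticAt ℝ F 0)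
    (h : Red (fun τ r => Good τ r ∧ Mzn (fun x => F (τ x) * r x)) (fun x => x) (fun _ => 1)) :
    Mzn F := by
  refine Red.bind (fun τ r ⟨hg, hm⟩ => ?_) h
  have key : Red (fun τ r => Good τ r ∧ Mono (fun x => F (τ x)) ∧ Mono r)
      (fun x => τ x) (fun x => r x * 1) := by
    refine Red.comp (σ := τ) (ρ := r) (τ := fun x => x) (r := fun _ => 1) ?_
    refine Red.mono (fun τ' r' ⟨hg', h1, h2⟩ => ?_) hm
    have a1 : AnalyticAt ℝ (fun x => F (τ (τ' x))) 0 :=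
      (hF.comp_zero hg.an hg.zero).comp_zero hg'.an hg'.zero
    have a2 : AnalyticAt ℝ (fun x => r (τ' x)) 0 := hg.anw.comp_zero hg'.an hg'.zero
    exact ⟨hg.comp hg', h1.of_mul_left a1 a2, (h1.of_mul_right a1 a2).mul h2⟩
  simpa using key

theorem Step.mzn {F : (Fin n → ℝ) → ℝ} (hF : AnalyticAt ℝ F 0)
    {S : Set (((Fin n → ℝ) → (Fin n → ℝ)) × ((Fin n → ℝ) → ℝ))} (hS : Step S)
    (h : ∀ p ∈ S, Mzn (fun x => F (p.1 x) * p.2 x)) : Mzn F := by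
  refine Red.mzn hF (.step _ _ S hS fun p hp => .done _ _ ?_)
  simpa using ⟨(hS.good p hp).1, h p hp⟩

/-- Lift a chart on the last `n` coordinates. -/
def liftMap (τ : (Fin n → ℝ) → (Fin n → ℝ)) (x : Fin (n + 1) → ℝ) : Fin (n + 1) → ℝ :=
  Fin.cons (x 0) (τ (Fin.tail x))

def liftFun (r : (Fin n → ℝ) → ℝ) (x : Fin (n + 1) → ℝ) : ℝ := r (Fin.tail x)

theorem cons_update_tail (x : Fin (n + 1) → ℝ) (i : Fin n) (t : ℝ) :
    (Fin.cons (x 0) (Function.update (Fin.tail x) i t) : Fin (n + 1) → ℝ) =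
      Function.update x i.succ t := by
  rw [Fin.cons_update, Fin.cons_self_tail]

theorem analyticAt_tail (a : Fin (n + 1) → ℝ) :
    AnalyticAt ℝ (fun x : Fin (n + 1) → ℝ => (Fin.tail x : Fin n → ℝ)) a := by
  rw [analyticAt_pi_iff]
  exact fun i => analyticAt_coord i.succ a

theorem tail_zero : Fin.tail (0 : Fin (n + 1) → ℝ) = (0 : Fin n → ℝ) := rfl

theorem Step.lift {S : Set (((Fin n → ℝ) → (Fin n → ℝ)) × ((Fin n → ℝ) → ℝ))} (hS : Step S) :
    ∃ S' : Set (((Fin (n + 1) → ℝ) → (Fin (n + 1) → ℝ)) × ((Fin (n + 1) → ℝ) → ℝ)), Step S' ∧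
      ∀ p' ∈ S', ∃ p ∈ S, p' = (liftMap p.1, liftFun p.2) := by
  cases hS with
  | shear i θ hθ ha h0 hi =>
    refine ⟨_, Step.shear i.succ (fun x => θ (Fin.tail x)) ?_ ?_ ?_ ?_, ?_⟩
    · exact hθ.comp (contDiff_pi.2 fun i => contDiff_apply ℝ ℝ i.succ)
    · exact ha.comp_zero (analyticAt_tail 0) tail_zero
    · rw [tail_zero, h0]
    · intro x t; rw [Fin.tail_update_succ, hi]
    · rintro p' rfl
      refine ⟨_, rfl, ?_⟩
      refine Prod.ext ?_ rfl
      ext1 x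
      exact (cons_update_tail x i _).symm
  | pow i N hN hN2 =>
    refine ⟨_, Step.pow i.succ N hN hN2, ?_⟩
    rintro p' ⟨ε, hε, rfl⟩
    refine ⟨_, ⟨ε, hε, rfl⟩, Prod.ext ?_ rfl⟩
    ext1 x
    exact (cons_update_tail x i _).symm
  | blow i j hij =>
    refine ⟨_, Step.blow i.succ j.succ (by simpa using hij), ?_⟩
    rintro p' (⟨b, rfl⟩ | rfl)
    · refine ⟨_, Or.inl ⟨b, rfl⟩, Prod.ext ?_ rfl⟩
      ext1 x
      exact (cons_update_tail x i _).symm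
    · refine ⟨_, Or.inr rfl, Prod.ext ?_ rfl⟩
      ext1 x
      exact (cons_update_tail x j _).symm

theorem Red.lift {Q : ((Fin n → ℝ) → (Fin n → ℝ)) → ((Fin n → ℝ) → ℝ) → Prop} {σ ρ}
    (h : Red Q σ ρ) :
    Red (fun τ' r' => ∃ τ r, Q τ r ∧ τ' = liftMap τ ∧ r' = liftFun r) (liftMap σ) (liftFun ρ) := by
  induction h with
  | done σ ρ h => exact .done _ _ ⟨σ, ρ, h, rfl, rfl⟩
  | step σ ρ S hS _ ih =>
    obtain ⟨S', hS', hl⟩ := hS.lift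
    refine .step _ _ S' hS' fun p' hp' => ?_
    obtain ⟨p, hp, rfl⟩ := hl p' hp'
    exact ih p hp

theorem Good.lift {τ : (Fin n → ℝ) → (Fin n → ℝ)} {r : (Fin n → ℝ) → ℝ} (h : Good τ r) :
    Good (liftMap τ) (liftFun r) where
  cont := by
    refine continuous_pi fun i => ?_
    refine Fin.cases ?_ (fun i => ?_) i
    · exact continuous_apply 0
    · exact (continuous_apply i).comp (h.cont.comp (continuous_pi fun i => continuous_apply i.succ))
  contw := h.contw.comp (continuous_pi fun i => continuous_apply i.succ)
  an := by
    rw [analyticAt_pi_iff]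
    intro i
    refine Fin.cases ?_ (fun i => ?_) i
    · exact analyticAt_coord 0 0
    · have := AnalyticAt.fun_comp (g := τ) (x := (0 : Fin (n + 1) → ℝ))
        (f := fun x => Fin.tail x) h.an (analyticAt_tail 0)
      exact (analyticAt_pi_iff.1 this) i
  anw := h.anw.comp_zero (analyticAt_tail 0) tail_zero
  zero := by
    ext i
    refine Fin.cases rfl (fun i => ?_) i
    simp [liftMap, tail_zero, h.zero]

theorem Mono.lift {r : (Fin n → ℝ) → ℝ} (h : Mono r) :
    ∃ (m : Fin (n + 1) → ℕ) (U : (Fin (n + 1) → ℝ) → ℝ), m 0 = 0 ∧ AnalyticAt ℝ U 0 ∧ U 0 ≠ 0 ∧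
      liftFun r =ᶠ[𝓝 0] fun x => monom m x * U x := by
  obtain ⟨α, U, hU, hU0, he⟩ := h
  refine ⟨Fin.cons 0 α, liftFun U, rfl, hU.comp_zero (analyticAt_tail 0) tail_zero,
    by rwa [liftFun, tail_zero], ?_⟩
  filter_upwards [(tendsto_of_analyticAt (analyticAt_tail 0) tail_zero).eventually he] with x hx
  simp only [liftFun]
  rw [hx]
  simp [monom, Fin.prod_univ_succ, Fin.tail]

end Reduction

section Tschirnhaus

variable {n : ℕ}

/-- Expansion of `G` in powers of the zeroth coordinate up to order `d`. -/
structure ZeroExp (d : ℕ) (c : ℕ → (Fin n → ℝ) → ℝ) (h G : (Fin (n + 1) → ℝ) → ℝ) : Prop where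
  anc : ∀ j, AnalyticAt ℝ (c j) 0
  anh : AnalyticAt ℝ h 0
  eq : G =ᶠ[𝓝 0] fun x => ∑ j ∈ Finset.range d, c j (Fin.tail x) * x 0 ^ j + x 0 ^ d * h x

theorem update_zero_eq_cons (x : Fin (n + 1) → ℝ) (t : ℝ) :
    Function.update x 0 t = Fin.cons t (Fin.tail x) := by
  refine funext fun i => Fin.cases ?_ (fun i => ?_) i
  · simp
  · simp [Fin.tail]

theorem analyticAt_cons_zero (a : Fin n → ℝ) :
    AnalyticAt ℝ (fun y : Fin n → ℝ => (Fin.cons 0 y : Fin (n + 1) → ℝ)) a := by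
  rw [analyticAt_pi_iff]
  intro i
  refine Fin.cases ?_ (fun i => ?_) i
  · exact analyticAt_const
  · exact analyticAt_coord i a

theorem cons_zero_zero : (Fin.cons 0 (0 : Fin n → ℝ) : Fin (n + 1) → ℝ) = 0 :=
  funext fun i => Fin.cases rfl (fun _ => rfl) i

theorem analyticAt_single (i : Fin n) (a : ℝ) :
    AnalyticAt ℝ (fun t : ℝ => (Pi.single i t : Fin n → ℝ)) a := by
  rw [analyticAt_pi_iff]
  intro j
  by_cases h : j = i
  · subst h; simpa using! analyticAt_id
  · simpa [h] using! analyticAt_const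

theorem tail_single_zero (t : ℝ) : Fin.tail (Pi.single 0 t : Fin (n + 1) → ℝ) = (0 : Fin n → ℝ) := by
  ext i; simp [Fin.tail]

theorem exists_rep (d : ℕ) : ∀ (G : (Fin (n + 1) → ℝ) → ℝ) (g : ℝ → ℝ), AnalyticAt ℝ G 0 →
    AnalyticAt ℝ g 0 → g 0 ≠ 0 → (∀ᶠ t in 𝓝 0, G (Pi.single 0 t) = t ^ d * g t) →
    ∃ c h, ZeroExp d c h G ∧ (∀ j < d, c j 0 = 0) ∧ h 0 ≠ 0 := by
  induction d with
  | zero =>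
    intro G g hG hg hg0 h
    refine ⟨fun _ _ => 0, G, ⟨fun _ => analyticAt_const, hG, by simp [EventuallyEq.refl]⟩,
      by simp, ?_⟩
    have := h.self_of_nhds
    simp at this
    rwa [this]
  | succ d ih =>
    intro G g hG hg hg0 h
    obtain ⟨D, hD, hDe⟩ := exists_divided_difference hG 0
    have ht : Tendsto (fun t : ℝ => (Pi.single 0 t : Fin (n + 1) → ℝ)) (𝓝 0) (𝓝 0) := by
      simpa using (analyticAt_single (0 : Fin (n + 1)) 0).continuousAt.tendsto
    have hD' : AnalyticAt ℝ (fun t : ℝ => D (Pi.single 0 t)) 0 :=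
      AnalyticAt.fun_comp (by simpa using hD) (analyticAt_single _ 0)
    have hG0 : G 0 = 0 := by simpa using h.self_of_nhds
    have hDg : (fun t : ℝ => D (Pi.single 0 t)) =ᶠ[𝓝 0] fun t => t ^ d * g t := by
      refine germ_mul_left_cancel (F := fun t : ℝ => t) analyticAt_id hD'
        ((analyticAt_id.pow d).mul hg) ?_ ?_
      · intro h0
        have : ∀ᶠ t : ℝ in 𝓝[≠] 0, t = 0 := h0.filter_mono nhdsWithin_le_nhds
        obtain ⟨t, h1, h2⟩ := (this.and self_mem_nhdsWithin).exists
        exact h2 h1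
      · filter_upwards [h, ht.eventually hDe] with t h1 h2
        rw [update_zero_eq_cons, tail_single_zero, cons_zero_zero, hG0, h1] at h2
        simp only [Pi.single_eq_same, zero_add] at h2
        rw [← h2]; ring
    obtain ⟨c, k, hr, hc, hk⟩ := ih D g hD hg hg0 hDg
    refine ⟨fun j => Nat.casesOn (motive := fun _ => (Fin n → ℝ) → ℝ) j (fun y => G (Fin.cons 0 y)) c, k, ⟨?_, hr.anh, ?_⟩, ?_, hk⟩
    · rintro (_ | j)
      · exact hG.comp_zero (analyticAt_cons_zero 0) cons_zero_zero
      · exact hr.anc j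
    · filter_upwards [hDe, hr.eq] with x h1 h2
      rw [h1, h2, Finset.sum_range_succ', update_zero_eq_cons, mul_add, Finset.mul_sum]
      simp only [pow_succ, pow_zero]
      have : ∀ j, x 0 * (c j (Fin.tail x) * x 0 ^ j) = c j (Fin.tail x) * (x 0 ^ j * x 0) :=
        fun j => by ring
      simp only [this]
      change _ = (∑ j ∈ Finset.range d, c j (Fin.tail x) * (x 0 ^ j * x 0)) +
        G (Fin.cons 0 (Fin.tail x)) * 1 + x 0 ^ d * x 0 * k x
      ring
    · rintro (_ | j) hj
      · simpa [cons_zero_zero] using hG0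
      · exact hc j (by omega)

/-- The partial derivative in the zeroth coordinate. -/
noncomputable def dZero (G : (Fin (n + 1) → ℝ) → ℝ) (x : Fin (n + 1) → ℝ) : ℝ :=
  deriv (fun s => G (Function.update x 0 s)) (x 0)

theorem hasDerivAt_update_zero (x : Fin (n + 1) → ℝ) (s : ℝ) :
    HasDerivAt (fun s => Function.update x 0 s) (Pi.single 0 1) s := by
  rw [hasDerivAt_pi]
  intro i
  refine Fin.cases ?_ (fun i => ?_) i
  · simpa using! hasDerivAt_id s
  · simpa using hasDerivAt_const s _

theorem hasDerivAt_dZero {G : (Fin (n + 1) → ℝ) → ℝ} {x : Fin (n + 1) → ℝ}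
    (hG : DifferentiableAt ℝ G x) :
    HasDerivAt (fun s => G (Function.update x 0 s)) (fderiv ℝ G x (Pi.single 0 1)) (x 0) := by
  have h := hasDerivAt_update_zero x (x 0)
  have hG' : HasFDerivAt G (fderiv ℝ G x) (Function.update x 0 (x 0)) := by
    rw [Function.update_eq_self]; exact hG.hasFDerivAt
  exact hG'.comp_hasDerivAt _ h

theorem dZero_analyticAt {G : (Fin (n + 1) → ℝ) → ℝ} (hG : AnalyticAt ℝ G 0) :
    AnalyticAt ℝ (dZero G) 0 := by
  have h1 : AnalyticAt ℝ (fun x => fderiv ℝ G x (Pi.single 0 1)) 0 :=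
    (ContinuousLinearMap.apply ℝ ℝ (Pi.single 0 1 : Fin (n + 1) → ℝ)).analyticAt _ |>.comp hG.fderiv
  refine h1.congr ?_
  filter_upwards [hG.eventually_analyticAt] with x hx
  exact (hasDerivAt_dZero hx.differentiableAt).deriv.symm

theorem ZeroExp.dZero {d : ℕ} {c : ℕ → (Fin n → ℝ) → ℝ} {h G : (Fin (n + 1) → ℝ) → ℝ}
    (hr : ZeroExp (d + 1) c h G) :
    ZeroExp d (fun j y => (j + 1) * c (j + 1) y) (fun x => (d + 1) * h x + x 0 * dZero h x)
      (dZero G) where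
  anc j := analyticAt_const.mul (hr.anc _)
  anh := (analyticAt_const.mul hr.anh).add ((analyticAt_coord 0 0).mul (dZero_analyticAt hr.anh))
  eq := by
    filter_upwards [hr.anh.eventually_analyticAt, hr.eq.eventually_nhds] with x hx he
    have hc : Tendsto (fun s => Function.update x 0 s) (𝓝 (x 0)) (𝓝 x) := by
      simpa using (hasDerivAt_update_zero x (x 0)).continuousAt.tendsto
    have he' := hc.eventually he
    simp only [Fin.tail_update_zero, Function.update_self] at he'
    have hd : HasDerivAt (fun s => ∑ j ∈ Finset.range (d + 1), c j (Fin.tail x) * s ^ j +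
        s ^ (d + 1) * h (Function.update x 0 s))
        (∑ j ∈ Finset.range (d + 1), c j (Fin.tail x) * (j * x 0 ^ (j - 1)) +
          (((d + 1 : ℕ) : ℝ) * x 0 ^ (d + 1 - 1) * h (Function.update x 0 (x 0)) +
            x 0 ^ (d + 1) * fderiv ℝ h x (Pi.single 0 1))) (x 0) :=
      (HasDerivAt.fun_sum fun j _ => (hasDerivAt_pow j (x 0)).const_mul _).add
        ((hasDerivAt_pow (d + 1) (x 0)).mul (hasDerivAt_dZero hx.differentiableAt))
    have e1 : _root_.dZero G x = _ := (hd.congr_of_eventuallyEq he').deriv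
    have e2 : _root_.dZero h x = _ := (hasDerivAt_dZero hx.differentiableAt).deriv
    rw [e1, e2, Finset.sum_range_succ', Function.update_eq_self]
    simp only [Nat.add_sub_cancel, Nat.cast_zero, Nat.cast_add, Nat.cast_one]
    have : ∀ j : ℕ, c (j + 1) (Fin.tail x) * (((j : ℝ) + 1) * x 0 ^ j) =
      (j + 1) * c (j + 1) (Fin.tail x) * x 0 ^ j := fun j => by ring
    simp only [this]
    ring

theorem ZeroExp.dZero_iterate (d : ℕ) : ∀ {c : ℕ → (Fin n → ℝ) → ℝ} {h G : (Fin (n + 1) → ℝ) → ℝ},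
    ZeroExp (d + 1) c h G → ∃ c' h', ZeroExp 1 c' h' (_root_.dZero^[d] G) ∧
      (∃ K : ℝ, K ≠ 0 ∧ ∀ y, c' 0 y = K * c d y) ∧ ∃ K : ℝ, K ≠ 0 ∧ h' 0 = K * h 0 := by
  induction d with
  | zero =>
    intro c h G hr
    exact ⟨c, h, hr, ⟨1, one_ne_zero, by simp⟩, 1, one_ne_zero, by simp⟩
  | succ d ih =>
    intro c h G hr
    obtain ⟨c', h', hr', ⟨K, hK, h1⟩, K', hK', h2⟩ := ih hr.dZero
    refine ⟨c', h', by simpa using hr', ⟨K * (d + 1), by positivity, fun y => ?_⟩,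
      K' * ((d + 1 : ℕ) + 1), by positivity, ?_⟩
    · rw [h1]; ring
    · rw [h2]; simp; ring

theorem dZero_shear {G : (Fin (n + 1) → ℝ) → ℝ} {θ : (Fin (n + 1) → ℝ) → ℝ}
    (hi : ∀ x t, θ (Function.update x 0 t) = θ x) :
    dZero (fun x => G (shearMap 0 θ x)) = fun x => dZero G (shearMap 0 θ x) := by
  ext x
  simp only [dZero, shearMap, hi, Function.update_self, Function.update_idem]
  rw [← deriv_comp_add_const (fun s => G (Function.update x 0 s)) (θ x) (x 0)]

theorem dZero_iterate_shear (d : ℕ) {G : (Fin (n + 1) → ℝ) → ℝ} {θ : (Fin (n + 1) → ℝ) → ℝ}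
    (hi : ∀ x t, θ (Function.update x 0 t) = θ x) :
    dZero^[d] (fun x => G (shearMap 0 θ x)) = fun x => dZero^[d] G (shearMap 0 θ x) := by
  induction d generalizing G with
  | zero => rfl
  | succ d ih => rw [Function.iterate_succ_apply, dZero_shear hi, ih]; rfl

/-- The analytic implicit function theorem for the zeroth coordinate. -/
theorem exists_implicit {g h : (Fin (n + 1) → ℝ) → ℝ} {c : ℕ → (Fin n → ℝ) → ℝ}
    (hr : ZeroExp 1 c h g) (hc : c 0 0 = 0) (hh : h 0 ≠ 0) :
    ∃ θ : (Fin (n + 1) → ℝ) → ℝ, AnalyticAt ℝ θ 0 ∧ θ 0 = 0 ∧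
      ∀ᶠ x in 𝓝 0, g (Function.update x 0 (θ x)) = 0 := by
  have hga : AnalyticAt ℝ g 0 := by
    refine AnalyticAt.congr ?_ hr.eq.symm
    refine (Finset.analyticAt_fun_sum _ fun j _ => ?_).add
      (((analyticAt_coord 0 0).pow _).mul hr.anh)
    exact ((hr.anc j).comp_zero (analyticAt_tail 0) tail_zero).mul ((analyticAt_coord 0 0).pow _)
  have hg0 : g 0 = 0 := by
    have := hr.eq.self_of_nhds
    simpa [hc, tail_zero] using this
  have hd : fderiv ℝ g 0 (Pi.single 0 1) = h 0 := by
    rw [← (hasDerivAt_dZero (G := g) (x := 0) hga.differentiableAt).deriv]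
    have := hr.dZero.eq.self_of_nhds
    simpa [_root_.dZero] using this
  set Ψ : (Fin (n + 1) → ℝ) → (Fin (n + 1) → ℝ) := fun x => Function.update x 0 (g x) with hΨ
  have hΨa : AnalyticAt ℝ Ψ 0 := analyticAt_update hga 0
  have hΨ0 : Ψ 0 = 0 := update_zero_of_eq_zero hg0
  set L : (Fin (n + 1) → ℝ) →L[ℝ] (Fin (n + 1) → ℝ) := ContinuousLinearMap.pi
    (fun i => Fin.cases (fderiv ℝ g 0) (fun i => ContinuousLinearMap.proj i.succ) i) with hL
  have hΨL : HasFDerivAt Ψ L 0 := by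
    rw [hasFDerivAt_pi']
    intro i
    refine Fin.cases ?_ (fun i => ?_) i
    · simpa [hΨ, hL] using hga.differentiableAt.hasFDerivAt
    · simpa [hΨ, hL] using!
        (ContinuousLinearMap.proj (R := ℝ) (φ := fun _ : Fin (n + 1) => ℝ) i.succ).hasFDerivAt
  have hinj : Function.Injective L := by
    rw [injective_iff_map_eq_zero]
    intro v hv
    have hs : ∀ i : Fin n, v i.succ = 0 := fun i => by
      have := congrFun hv i.succ
      simpa [hL] using this
    have hv' : v = v 0 • Pi.single 0 1 := by
      refine funext fun i => Fin.cases ?_ (fun i => ?_) i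
      · simp
      · simp [hs]
    have h0 : fderiv ℝ g 0 v = 0 := by simpa [hL] using congrFun hv 0
    rw [hv', map_smul, hd, smul_eq_mul] at h0
    rw [hv', (mul_eq_zero.1 h0).resolve_right hh, zero_smul]
  set L' : (Fin (n + 1) → ℝ) ≃L[ℝ] (Fin (n + 1) → ℝ) :=
    (LinearEquiv.ofInjectiveEndo (L : (Fin (n + 1) → ℝ) →ₗ[ℝ] (Fin (n + 1) → ℝ))
      hinj).toContinuousLinearEquiv with hL'
  have hLL : (L' : (Fin (n + 1) → ℝ) →L[ℝ] (Fin (n + 1) → ℝ)) = L := by ext; rfl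
  have hΨL' : HasFDerivAt Ψ (L' : (Fin (n + 1) → ℝ) →L[ℝ] (Fin (n + 1) → ℝ)) 0 := by rwa [hLL]
  have hcd : ContDiffAt ℝ (⊤ : WithTop ℕ∞) Ψ 0 := hΨa.contDiffAt
  have hst : HasStrictFDerivAt Ψ (L' : (Fin (n + 1) → ℝ) →L[ℝ] (Fin (n + 1) → ℝ)) 0 :=
    hcd.hasStrictFDerivAt' hΨL' (by simp)
  set Φ := hst.localInverse Ψ L' 0 with hΦ
  have hΦa : AnalyticAt ℝ Φ 0 := by
    have := (hcd.to_localInverse hΨL' (by simp)).analyticAt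
    rw [hΨ0] at this
    exact this
  have hΦ0 : Φ 0 = 0 := by
    have := hst.localInverse_apply_image
    rwa [hΨ0] at this
  have hinv : ∀ᶠ y in 𝓝 (0 : Fin (n + 1) → ℝ), Ψ (Φ y) = y := by
    have := hst.eventually_right_inverse
    rwa [hΨ0] at this
  refine ⟨fun x => Φ (Function.update x 0 0) 0, ?_, ?_, ?_⟩
  · exact (analyticAt_coord 0 _).comp_zero
      (AnalyticAt.fun_comp (by rw [update_zero_zero]; exact hΦa) (analyticAt_update_zero 0 0))
      (by rw [update_zero_zero, hΦ0])
  · simp [hΦ0]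
  · filter_upwards [(tendsto_update_zero 0).eventually hinv] with x hx
    have e0 : g (Φ (Function.update x 0 0)) = 0 := by simpa [hΨ] using congrFun hx 0
    have e1 : Function.update x 0 (Φ (Function.update x 0 0) 0) = Φ (Function.update x 0 0) := by
      refine funext fun i => Fin.cases ?_ (fun i => ?_) i
      · simp
      · have := congrFun hx i.succ
        simp [hΨ] at this
        simp [this]
    rw [e1, e0]

theorem exists_cutoff {n : ℕ} {s : Set (Fin n → ℝ)} (hs : s ∈ 𝓝 (0 : Fin n → ℝ)) :
    ∃ η : (Fin n → ℝ) → ℝ, ContDiff ℝ (⊤ : ℕ∞) η ∧ tsupport η ⊆ s ∧ HasCompactSupport η ∧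
      (∀ᶠ x in 𝓝 0, η x = 1) := by
  obtain ⟨r, hr, hrs⟩ := Metric.nhds_basis_closedBall.mem_iff.1 hs
  let η : ContDiffBump (0 : Fin n → ℝ) := ⟨r / 2, r, by positivity, by linarith⟩
  exact ⟨η, η.contDiff, by rwa [η.tsupport_eq], η.hasCompactSupport, η.eventuallyEq_one⟩

theorem exists_smooth_indep {θ : (Fin n → ℝ) → ℝ} (i : Fin n) (hθ : AnalyticAt ℝ θ 0) :
    ∃ θ' : (Fin n → ℝ) → ℝ, ContDiff ℝ (⊤ : ℕ∞) θ' ∧ AnalyticAt ℝ θ' 0 ∧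
      (∀ x t, θ' (Function.update x i t) = θ' x) ∧ θ' 0 = θ 0 ∧
      ∀ᶠ x in 𝓝 0, θ' x = θ (Function.update x i 0) := by
  obtain ⟨η, h1, h2, h3, h4⟩ := exists_cutoff hθ.eventually_analyticAt
  have hsm : ContDiff ℝ (⊤ : ℕ∞) (fun x => η x * θ x) := by
    rw [contDiff_iff_contDiffAt]
    intro x
    by_cases hx : x ∈ tsupport η
    · exact h1.contDiffAt.mul (AnalyticAt.contDiffAt (h2 hx))
    · have : (fun x => η x * θ x) =ᶠ[𝓝 x] fun _ => 0 := by
        filter_upwards [(isClosed_tsupport η).isOpen_compl.mem_nhds hx] with y hy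
        rw [image_eq_zero_of_notMem_tsupport hy, zero_mul]
      exact contDiffAt_const.congr_of_eventuallyEq this
  have hev : ∀ᶠ x in 𝓝 (0 : Fin n → ℝ), η (Function.update x i 0) * θ (Function.update x i 0) =
      θ (Function.update x i 0) := by
    filter_upwards [(tendsto_update_zero i).eventually h4] with x hx
    rw [hx, one_mul]
  refine ⟨fun x => η (Function.update x i 0) * θ (Function.update x i 0), ?_, ?_, ?_, ?_, hev⟩
  · refine hsm.comp (contDiff_pi.2 fun j => ?_)
    by_cases h : j = i
    · simpa [Function.update_apply, h] using contDiff_const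
    · simpa [Function.update_apply, h] using contDiff_apply ℝ ℝ j
  · exact (hθ.comp_zero (analyticAt_update_zero i 0) (update_zero_zero i)).congr
      (hev.mono fun x hx => hx.symm)
  · intro x t; simp
  · have := hev.self_of_nhds
    simpa [update_zero_zero] using this

theorem exists_tschirnhaus {d : ℕ} {c : ℕ → (Fin n → ℝ) → ℝ} {h G : (Fin (n + 1) → ℝ) → ℝ}
    (hG : AnalyticAt ℝ G 0) (hr : ZeroExp (d + 1) c h G) (hc : ∀ j < d + 1, c j 0 = 0) (hh : h 0 ≠ 0) :
    ∃ θ : (Fin (n + 1) → ℝ) → ℝ, ContDiff ℝ (⊤ : ℕ∞) θ ∧ AnalyticAt ℝ θ 0 ∧ θ 0 = 0 ∧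
      (∀ x t, θ (Function.update x 0 t) = θ x) ∧
      ∃ c' h', ZeroExp (d + 1) c' h' (fun x => G (shearMap 0 θ x)) ∧ (∀ j < d + 1, c' j 0 = 0) ∧
        h' 0 ≠ 0 ∧ c' d =ᶠ[𝓝 0] 0 := by
  obtain ⟨c₁, h₁, hr₁, ⟨K, hK, hcK⟩, K', hK', hhK⟩ := ZeroExp.dZero_iterate d hr
  obtain ⟨θ₀, hθ₀, hθ00, hz⟩ := exists_implicit hr₁ (by rw [hcK, hc d (by omega), mul_zero])
    (by rw [hhK]; positivity)
  obtain ⟨θ, hs, ha, hi, h0, he⟩ := exists_smooth_indep 0 hθ₀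
  rw [hθ00] at h0
  refine ⟨θ, hs, ha, h0, hi, ?_⟩
  have hsh : AnalyticAt ℝ (shearMap 0 θ) 0 := analyticAt_update ((analyticAt_coord 0 0).add ha) 0
  have hsh0 : shearMap 0 θ 0 = 0 := update_zero_of_eq_zero (by simp [h0])
  have hts : Tendsto (fun t : ℝ => (Pi.single 0 t : Fin (n + 1) → ℝ)) (𝓝 0) (𝓝 0) := by
    simpa using (analyticAt_single (0 : Fin (n + 1)) 0).continuousAt.tendsto
  obtain ⟨c', h', hr', hc', hh'⟩ := exists_rep (d + 1) (fun x => G (shearMap 0 θ x))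
    (fun t => h (Pi.single 0 t)) (hG.comp_zero hsh hsh0)
    (AnalyticAt.fun_comp (by simpa using hr.anh) (analyticAt_single _ 0)) (by simpa using hh) (by
      filter_upwards [hts.eventually hr.eq] with t ht
      have : shearMap 0 θ (Pi.single 0 t) = Pi.single 0 t := by
        have hθt : θ (Pi.single 0 t) = 0 := by rw [← h0]; exact hi 0 t
        simp [shearMap, hθt]
      rw [this, ht, tail_single_zero, Finset.sum_eq_zero, zero_add, Pi.single_eq_same]
      intro j hj
      rw [hc j (Finset.mem_range.1 hj), zero_mul])
  refine ⟨c', h', hr', hc', hh', ?_⟩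
  obtain ⟨c₂, h₂, hr₂, ⟨K₂, hK₂, hcK₂⟩, -⟩ := ZeroExp.dZero_iterate d hr'
  rw [dZero_iterate_shear d hi] at hr₂
  have ht := tendsto_of_analyticAt (analyticAt_cons_zero (0 : Fin n → ℝ)) cons_zero_zero
  filter_upwards [ht.eventually hr₂.eq, ht.eventually hz, ht.eventually he] with y h1 h2 h3
  have e1 : Function.update (Fin.cons 0 y : Fin (n + 1) → ℝ) 0 0 = Fin.cons 0 y := by
    rw [update_zero_eq_cons, Fin.tail_cons]
  rw [e1] at h3
  rw [← h3] at h2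
  simp only [shearMap, Fin.cons_zero, zero_add, h2, Finset.range_one, Finset.sum_singleton,
    Fin.tail_cons, hcK₂] at h1
  simpa [hK₂] using h1.symm

end Tschirnhaus

section Monomialization

variable {n : ℕ}

theorem monom_update (α : Fin n → ℕ) (y : Fin n → ℝ) (k : Fin n) (t : ℝ) :
    monom α (Function.update y k t) = t ^ α k * monom (Function.update α k 0) y := by
  classical
  rw [monom, monom, ← Finset.mul_prod_erase _ _ (Finset.mem_univ k),
    ← Finset.mul_prod_erase Finset.univ (fun i => y i ^ Function.update α k 0 i)
      (Finset.mem_univ k)]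
  simp only [Function.update_self, pow_zero, one_mul]
  congr 1
  refine Finset.prod_congr rfl fun i hi => ?_
  rw [Function.update_of_ne (Finset.ne_of_mem_erase hi),
    Function.update_of_ne (Finset.ne_of_mem_erase hi)]

theorem monom_update_mul (α : Fin n → ℕ) (y : Fin n → ℝ) (k : Fin n) (s : ℝ) :
    monom α (Function.update y k (s * y k)) = s ^ α k * monom α y := by
  conv_rhs => rw [← Function.update_eq_self k y, monom_update]
  rw [monom_update, mul_pow]; ring

theorem Mono.comp_powMap {F : (Fin n → ℝ) → ℝ} (hF : Mono F) (i : Fin n) {N : ℕ} (hN : 0 < N)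
    {ε : ℝ} (hε : ε ≠ 0) : Mono (fun x => F (powMap i N ε x)) := by
  obtain ⟨α, U, hU, hU0, he⟩ := hF
  have ha : AnalyticAt ℝ (powMap i N ε) 0 :=
    analyticAt_update (analyticAt_const.mul ((analyticAt_coord i 0).pow _)) i
  have h0 : powMap i N ε 0 = 0 := update_zero_of_eq_zero (by simp [hN.ne'])
  have h1 : Mono (fun x => monom α (powMap i N ε x)) := by
    have : (fun x => monom α (powMap i N ε x)) = fun x : Fin n → ℝ =>
        (ε ^ α i * (x i ^ (N * α i))) * monom (Function.update α i 0) x := by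
      ext x; rw [powMap, monom_update]; ring
    rw [this]
    exact ((mono_of_ne_zero analyticAt_const (pow_ne_zero _ hε)).mul (mono_coord_pow i _)).mul
      (mono_monom _)
  refine (h1.mul (mono_of_ne_zero (hU.comp_zero ha h0) (by rwa [h0]))).congr ?_
  exact (tendsto_of_analyticAt ha h0).eventually he

theorem red_powAll {N : ℕ} (hN : 0 < N) (hN2 : Even N) (T : Finset (Fin n)) :
    Red (fun τ r => Good τ r ∧ Mono r ∧ ∃ ε : Fin n → ℝ, (∀ i, ε i = 1 ∨ ε i = -1) ∧
      τ = fun y i => if i ∈ T then ε i * y i ^ N else y i) (fun x : Fin n → ℝ => x)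
      (fun _ => 1) := by
  classical
  induction T using Finset.induction_on with
  | empty =>
    exact .done _ _ ⟨good_id, mono_of_ne_zero analyticAt_const one_ne_zero, fun _ => 1, by simp,
      by simp⟩
  | insert a T ha ih =>
    refine Red.bind ?_ ih
    rintro τ r ⟨hg, hm, ε, hε, rfl⟩
    refine .step _ _ _ (Step.pow a N hN hN2) ?_
    rintro p ⟨δ, hδ, rfl⟩
    have hstep := (Step.pow a N hN hN2).good _ ⟨δ, hδ, rfl⟩
    have hδ0 : δ ≠ 0 := by rcases hδ with rfl | rfl <;> norm_num
    refine .done _ _ ⟨hg.comp hstep.1, (hm.comp_powMap a hN hδ0).mul hstep.2,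
      Function.update ε a δ, fun i => ?_, ?_⟩
    · by_cases h : i = a
      · subst h; simpa using hδ
      · simpa [h] using hε i
    · ext y i
      by_cases h : i = a
      · subst h; simp [ha, powMap]
      · simp [h, powMap]

theorem monom_sign_pow (α : Fin n → ℕ) (ε y : Fin n → ℝ) (N : ℕ) :
    monom α (fun i => ε i * y i ^ N) = monom α ε * monom (N • α) y := by
  simp [monom, ← Finset.prod_mul_distrib, mul_pow, pow_mul]

theorem mono_of_tail {r : (Fin n → ℝ) → ℝ} (h : Mono r) :
    Mono (fun x : Fin (n + 1) → ℝ => r (Fin.tail x)) := by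
  obtain ⟨m, U, -, hU, hU0, he⟩ := h.lift
  exact ⟨m, U, hU, hU0, he⟩

theorem rootMultiplicity_lt_of_coeff {P : Polynomial ℝ} (hP0 : P ≠ 0) {d : ℕ}
    (hdeg : P.natDegree ≤ d) (hd : 0 < d) (c1 : P.coeff (d - 1) = 0)
    (hj : ∃ j < d, P.coeff j ≠ 0) (b : ℝ) : P.rootMultiplicity b < d := by
  by_contra! hge
  obtain ⟨q, hq, -⟩ := Polynomial.exists_eq_pow_rootMultiplicity_mul_and_not_dvd P hP0 b
  have hdvd : (Polynomial.X - Polynomial.C b) ^ d ∣ P :=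
    (pow_dvd_pow _ hge).trans (Dvd.intro _ hq.symm)
  obtain ⟨r, hr⟩ := hdvd
  have hr0 : r ≠ 0 := by rintro rfl; simp [hP0] at hr
  have hmon : ((Polynomial.X - Polynomial.C b) ^ d).Monic :=
    (Polynomial.monic_X_sub_C b).pow d
  have hdr : r.natDegree = 0 := by
    have := congrArg Polynomial.natDegree hr
    rw [hmon.natDegree_mul' hr0, Polynomial.natDegree_pow, Polynomial.natDegree_X_sub_C] at this
    omega
  obtain ⟨s, rfl⟩ := Polynomial.natDegree_eq_zero.1 hdr
  have hs0 : s ≠ 0 := by rintro rfl; simp at hr0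
  rw [hr, Polynomial.coeff_mul_C, sub_eq_add_neg,
    ← Polynomial.C_neg, Polynomial.coeff_X_add_C_pow] at c1
  have hb0 : b = 0 := by
    have h1 : d - (d - 1) = 1 := by omega
    have h2 : d.choose (d - 1) ≠ 0 := (Nat.choose_pos (by omega)).ne'
    rw [h1, pow_one] at c1
    have c3 : (b = 0 ∨ d.choose (d - 1) = 0) ∨ s = 0 := by simpa using c1
    tauto
  obtain ⟨j₀, hj₀, hcj⟩ := hj
  rw [hr, hb0] at hcj
  simp [Polynomial.coeff_X_pow, show j₀ ≠ d by omega] at hcj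

set_option maxHeartbeats 1000000 in
/-- Blow-ups reduce the order in the zeroth coordinate. -/
theorem mzn_form {d : ℕ} (hd : 0 < d)
    (ih : ∀ d' < d, ∀ G : (Fin (n + 1) → ℝ) → ℝ, AnalyticAt ℝ G 0 → ∀ g : ℝ → ℝ,
      AnalyticAt ℝ g 0 → g 0 ≠ 0 → (∀ᶠ t in 𝓝 0, G (Pi.single 0 t) = t ^ d' * g t) →
      ∀ m : Fin n → ℕ, Mzn (fun x => monom m (Fin.tail x) * G x)) (N : ℕ) :
    ∀ (μ : Fin n → ℕ) (c : ℕ → (Fin (n + 1) → ℝ) → ℝ) (h : (Fin (n + 1) → ℝ) → ℝ) (m : Fin n → ℕ),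
      ∑ i, μ i = N → μ ≠ 0 → (∀ j, AnalyticAt ℝ (c j) 0) → AnalyticAt ℝ h 0 → h 0 ≠ 0 →
      (∃ j₀ < d - 1, c j₀ 0 ≠ 0) →
      Mzn (fun x => monom m (Fin.tail x) * (∑ j ∈ Finset.range (d - 1),
        monom ((d - j) • μ) (Fin.tail x) * c j x * x 0 ^ j + x 0 ^ d * h x)) := by
  classical
  induction N with
  | zero =>
    intro μ c h m hμ hμ0
    refine absurd ?_ hμ0
    ext i; simpa using Finset.sum_eq_zero_iff.1 hμ i (Finset.mem_univ i)
  | succ N ihN =>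
    intro μ c h m hμ hμ0 hc hh hh0 hj₀
    have hmt : ∀ α : Fin n → ℕ,
        AnalyticAt ℝ (fun x : Fin (n + 1) → ℝ => monom α (Fin.tail x)) 0 := fun α =>
      (analyticAt_monom α 0).comp_zero (analyticAt_tail 0) tail_zero
    obtain ⟨k, hk⟩ := Function.ne_iff.1 hμ0
    obtain ⟨ν, rfl⟩ : ∃ ν : Fin n → ℕ, μ = Pi.single k 1 + ν := by
      refine ⟨μ - Pi.single k 1, ?_⟩
      ext j
      by_cases hj : j = k
      · subst hj; simp at hk ⊢; omega
      · simp [hj]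
    have hν : ∑ j, ν j = N := by
      have : ∑ j, (Pi.single k 1 : Fin n → ℕ) j = 1 := by simp
      simp only [Pi.add_apply, Finset.sum_add_distrib] at hμ
      omega
    have hbr : ∀ (c : ℕ → (Fin (n + 1) → ℝ) → ℝ) (h q : (Fin (n + 1) → ℝ) → ℝ) (μ : ℕ → Fin n → ℕ),
        (∀ j, AnalyticAt ℝ (c j) 0) → AnalyticAt ℝ h 0 → AnalyticAt ℝ q 0 →
        AnalyticAt ℝ (fun x => ∑ j ∈ Finset.range (d - 1),
        monom (μ j) (Fin.tail x) * c j x * q x ^ j + q x ^ d * h x) 0 := by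
      intro c h q μ hc hh hq
      refine (Finset.analyticAt_fun_sum _ fun j _ => ?_).add ((hq.pow _).mul hh)
      exact ((hmt _).mul (hc j)).mul (hq.pow _)
    have hS := Step.blow (0 : Fin (n + 1)) k.succ (Fin.succ_ne_zero k).symm
    refine Step.mzn ((hmt m).mul (hbr c h _ _ hc hh (analyticAt_coord 0 0))) hS ?_
    intro p hp
    have hgood := (hS.good p hp).1
    rcases hp with ⟨b, rfl⟩ | rfl
    · set A := blowA (0 : Fin (n + 1)) k.succ b with hA
      have hcA : ∀ j, AnalyticAt ℝ (fun x => c j (A x)) 0 := fun j =>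
        (hc j).comp_zero hgood.an hgood.zero
      have hhA : AnalyticAt ℝ (fun x => h (A x)) 0 := hh.comp_zero hgood.an hgood.zero
      have hA0 : A 0 = 0 := hgood.zero
      have hb : AnalyticAt ℝ (fun x : Fin (n + 1) → ℝ => x 0 + b) 0 :=
        (analyticAt_coord 0 0).add analyticAt_const
      set Br : (Fin (n + 1) → ℝ) → ℝ := fun x => ∑ j ∈ Finset.range (d - 1),
        monom ((d - j) • ν) (Fin.tail x) * c j (A x) * (x 0 + b) ^ j + (x 0 + b) ^ d * h (A x)
        with hBr
      have hBra : AnalyticAt ℝ Br 0 := hbr _ _ _ _ hcA hhA hb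
      have key : ∀ x, (monom m (Fin.tail (A x)) * (∑ j ∈ Finset.range (d - 1),
          monom ((d - j) • (Pi.single k 1 + ν)) (Fin.tail (A x)) * c j (A x) * A x 0 ^ j +
          A x 0 ^ d * h (A x))) * x k.succ = monom (m + (d + 1) • Pi.single k 1) (Fin.tail x) * Br x := by
        intro x
        have e1 : Fin.tail (A x) = Fin.tail x := by rw [hA, blowA, Fin.tail_update_zero]
        have e2 : A x 0 = x k.succ * (x 0 + b) := by simp [hA, blowA]
        have e3 : ∑ j ∈ Finset.range (d - 1), monom ((d - j) • (Pi.single k 1 + ν)) (Fin.tail x) *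
            c j (A x) * (x k.succ * (x 0 + b)) ^ j = x k.succ ^ d * ∑ j ∈ Finset.range (d - 1),
            monom ((d - j) • ν) (Fin.tail x) * c j (A x) * (x 0 + b) ^ j := by
          rw [Finset.mul_sum]
          refine Finset.sum_congr rfl fun j hj => ?_
          have hjd : d = (d - j) + j := by have := Finset.mem_range.1 hj; omega
          rw [smul_add, monom_add, monom_nsmul (d - j) (Pi.single k 1), monom_single, pow_one]
          conv_rhs => rw [hjd, pow_add]
          simp only [Fin.tail, mul_pow]
          rw [← hjd]
          ring
        rw [e1, e2, e3, monom_add, monom_nsmul, monom_single, pow_one,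
          mul_pow]
        simp only [hBr, Fin.tail]
        ring
      suffices hs : Mzn (fun x => monom (m + (d + 1) • Pi.single k 1) (Fin.tail x) * Br x) from
        hs.congr (Eventually.of_forall key)
      by_cases hν0 : ν = 0
      · -- the order in the zeroth coordinate drops
        set P : Polynomial ℝ := ∑ j ∈ Finset.range (d - 1), Polynomial.C (c j 0) * Polynomial.X ^ j +
          Polynomial.C (h 0) * Polynomial.X ^ d with hP
        have hcoeff : ∀ i, P.coeff i = (if i < d - 1 then c i 0 else 0) + if i = d then h 0 else 0 := by
          intro i
          simp only [hP, Polynomial.coeff_add, Polynomial.finsetSum_coeff,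
            Polynomial.coeff_C_mul, Polynomial.coeff_X_pow, mul_ite, mul_one, mul_zero]
          congr 1
          by_cases hi : i < d - 1
          · rw [Finset.sum_eq_single i]
            · simp [hi]
            · intro j _ hj; simp [hj.symm]
            · intro hni; simp at hni; omega
          · rw [if_neg hi]
            refine Finset.sum_eq_zero fun j hj => ?_
            have := Finset.mem_range.1 hj
            rw [if_neg (by omega)]
        have hP0 : P ≠ 0 := by
          intro h0
          have := hcoeff d
          rw [h0, if_neg (by omega), if_pos rfl] at this
          simp at this
          exact hh0 this.symm
        have hdeg : P.natDegree ≤ d := by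
          refine Polynomial.natDegree_le_iff_coeff_eq_zero.2 fun i hi => ?_
          rw [hcoeff, if_neg (by omega), if_neg (by omega), zero_add]
        obtain ⟨q, hq, hqb⟩ := Polynomial.exists_eq_pow_rootMultiplicity_mul_and_not_dvd P hP0 b
        have hlt : P.rootMultiplicity b < d := by
          obtain ⟨j₀, hj₀, hcj⟩ := hj₀
          refine rootMultiplicity_lt_of_coeff hP0 hdeg hd ?_ ⟨j₀, by omega, ?_⟩ b
          · rw [hcoeff, if_neg (by omega), if_neg (by omega), zero_add]
          · rwa [hcoeff, if_pos hj₀, if_neg (by omega), add_zero]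
        refine ih _ hlt Br hBra (fun t => q.eval (t + b)) ?_ ?_ (Eventually.of_forall fun t => ?_) _
        · have : AnalyticAt ℝ (fun t : ℝ => t + b) 0 := analyticAt_id.add analyticAt_const
          simpa using! this.aeval_polynomial q
        · intro h0
          rw [zero_add] at h0
          exact hqb (Polynomial.dvd_iff_isRoot.2 h0)
        · have hAt : A (Pi.single 0 t) = 0 := by
            refine funext fun i => Fin.cases ?_ (fun i => ?_) i
            · simp [hA, blowA]
            · simp [hA, blowA]
          have : Br (Pi.single 0 t) = P.eval (t + b) := by
            simp only [hBr, hP, hAt, hν0, smul_zero, monom_zero, one_mul, Pi.single_eq_same,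
              Polynomial.eval_add, Polynomial.eval_finsetSum, Polynomial.eval_mul,
              Polynomial.eval_C, Polynomial.eval_pow, Polynomial.eval_X]
            ring
          rw [this]
          conv_lhs => rw [hq]
          simp
      · by_cases hb0 : b = 0
        · have := ihN ν (fun j x => c j (A x)) (fun x => h (A x)) (m + (d + 1) • Pi.single k 1) hν hν0
            hcA hhA (by rwa [hA0]) (by simpa only [hA0] using hj₀)
          simpa only [hBr, hb0, add_zero] using this
        · refine Mzn.mul_unit (mono_of_tail ?_).mzn hBra ?_
          · exact mono_monom _
          · have : ∀ j ∈ Finset.range (d - 1), monom ((d - j) • ν) (Fin.tail (0 : Fin (n + 1) → ℝ)) *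
                c j (A 0) * (((0 : Fin (n + 1) → ℝ)) 0 + b) ^ j = 0 := by
              intro j hj
              have := Finset.mem_range.1 hj
              rw [tail_zero, monom_zero_apply, zero_mul, zero_mul]
              exact smul_ne_zero (by omega) hν0
            simp only [hBr]
            rw [Finset.sum_eq_zero this]
            simp [hA0, hb0, hh0]
    · set B := blowB (0 : Fin (n + 1)) k.succ with hB
      set μ : Fin n → ℕ := Pi.single k 1 + ν with hμd
      have hcB : ∀ j, AnalyticAt ℝ (fun x => c j (B x)) 0 := fun j =>
        (hc j).comp_zero hgood.an hgood.zero
      have hhB : AnalyticAt ℝ (fun x => h (B x)) 0 := hh.comp_zero hgood.an hgood.zero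
      have hB0 : B 0 = 0 := hgood.zero
      set Br : (Fin (n + 1) → ℝ) → ℝ := fun x => ∑ j ∈ Finset.range (d - 1),
        monom ((d - j) • μ) (Fin.tail x) * c j (B x) * x 0 ^ ((d - j) * ν k) + h (B x) with hBr
      have hBra : AnalyticAt ℝ Br 0 := by
        refine (Finset.analyticAt_fun_sum _ fun j _ => ?_).add hhB
        exact ((hmt _).mul (hcB j)).mul ((analyticAt_coord 0 0).pow _)
      have key : ∀ x, (monom m (Fin.tail (B x)) * (∑ j ∈ Finset.range (d - 1),
          monom ((d - j) • μ) (Fin.tail (B x)) * c j (B x) * B x 0 ^ j +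
          B x 0 ^ d * h (B x))) * x 0 =
          (monom m (Fin.tail x) * x 0 ^ (m k + d + 1)) * Br x := by
        intro x
        have e1 : Fin.tail (B x) = Function.update (Fin.tail x) k (x 0 * Fin.tail x k) := by
          rw [hB, blowB, Fin.tail_update_succ]; rfl
        have e2 : B x 0 = x 0 := Function.update_of_ne (Fin.succ_ne_zero k).symm _ _
        have e3 : ∑ j ∈ Finset.range (d - 1), x 0 ^ (((d - j) • μ) k) *
            monom ((d - j) • μ) (Fin.tail x) * c j (B x) * x 0 ^ j = x 0 ^ d *
            ∑ j ∈ Finset.range (d - 1),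
            monom ((d - j) • μ) (Fin.tail x) * c j (B x) * x 0 ^ ((d - j) * ν k) := by
          rw [Finset.mul_sum]
          refine Finset.sum_congr rfl fun j hj => ?_
          have hjd : ((d - j) • μ) k + j = d + (d - j) * ν k := by
            have := Finset.mem_range.1 hj
            simp only [hμd, Pi.smul_apply, Pi.add_apply, Pi.single_eq_same, smul_eq_mul, mul_add]
            omega
          calc _ = x 0 ^ (((d - j) • μ) k + j) * (monom ((d - j) • μ) (Fin.tail x) * c j (B x)) := by
                rw [pow_add]; ring
            _ = _ := by rw [hjd, pow_add]; ring
        rw [e1, e2]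
        simp only [monom_update_mul]
        rw [e3]
        simp only [hBr]
        ring
      refine Mzn.congr (Mzn.mul_unit ?_ hBra ?_) (Eventually.of_forall key)
      · exact ((mono_of_tail (mono_monom _)).mul (mono_coord_pow 0 _)).mzn
      · have : ∀ j ∈ Finset.range (d - 1), monom ((d - j) • μ) (Fin.tail (0 : Fin (n + 1) → ℝ)) *
            c j (B 0) * ((0 : Fin (n + 1) → ℝ)) 0 ^ ((d - j) * ν k) = 0 := by
          intro j hj
          have := Finset.mem_range.1 hj
          rw [tail_zero, monom_zero_apply, zero_mul, zero_mul]
          exact smul_ne_zero (by omega) hμ0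
        simp only [hBr]
        rw [Finset.sum_eq_zero this]
        simp [hB0, hh0]

end Monomialization

section Family

variable {n : ℕ}

theorem Red.comp_id {Q : ((Fin n → ℝ) → (Fin n → ℝ)) → ((Fin n → ℝ) → ℝ) → Prop}
    {σ : (Fin n → ℝ) → (Fin n → ℝ)} {ρ : (Fin n → ℝ) → ℝ}
    (h : Red (fun τ r => Q (fun x => σ (τ x)) (fun x => ρ (τ x) * r x)) (fun x => x) (fun _ => 1)) :
    Red Q σ ρ := by
  simpa using Red.comp h

/-- Every nonzero analytic germ in `n` variables can be monomialized. -/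
def MznAll (n : ℕ) : Prop :=
  ∀ F : (Fin n → ℝ) → ℝ, AnalyticAt ℝ F 0 → ¬ F =ᶠ[𝓝 0] 0 → Mzn F

theorem germ_prod_ne_zero {ι : Type*} {F : ι → (Fin n → ℝ) → ℝ} (s : Finset ι)
    (hF : ∀ i ∈ s, AnalyticAt ℝ (F i) 0) (h0 : ∀ i ∈ s, ¬ F i =ᶠ[𝓝 0] 0) :
    ¬ (fun x => ∏ i ∈ s, F i x) =ᶠ[𝓝 0] 0 := by
  classical
  induction s using Finset.induction_on with
  | empty =>
    intro h
    simpa using! h.self_of_nhds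
  | insert a s ha ih =>
    intro h
    simp only [Finset.prod_insert ha] at h
    rcases germ_eq_zero_or_eq_zero_of_mul (hF a (by simp))
      (Finset.analyticAt_fun_prod s fun i hi => hF i (by simp [hi])) h with h | h
    · exact h0 a (by simp) h
    · exact ih (fun i hi => hF i (by simp [hi])) (fun i hi => h0 i (by simp [hi])) h

theorem MznAll.family (hM : MznAll n) {ι : Type*} [Finite ι] {F : ι → (Fin n → ℝ) → ℝ}
    (hF : ∀ i, AnalyticAt ℝ (F i) 0) :
    Red (fun τ r => Good τ r ∧ Mono r ∧ ∀ i, F i =ᶠ[𝓝 0] 0 ∨ Mono (fun x => F i (τ x)))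
      (fun x => x) (fun _ => 1) := by
  classical
  have := Fintype.ofFinite ι
  set s : Finset ι := Finset.univ.filter fun i => ¬ F i =ᶠ[𝓝 0] 0 with hs
  refine Red.mono (fun τ r ⟨hg, h1, h2⟩ => ⟨hg, h2, fun i => ?_⟩)
    (hM (fun x => ∏ i ∈ s, F i x) (Finset.analyticAt_fun_prod s fun i _ => hF i)
      (germ_prod_ne_zero s (fun i _ => hF i) fun i hi => (Finset.mem_filter.1 hi).2))
  by_cases hi : F i =ᶠ[𝓝 0] 0
  · exact Or.inl hi
  · exact Or.inr (Mono.of_prod (F := fun i x => F i (τ x)) (s := s)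
      (fun i _ => (hF i).comp_zero hg.an hg.zero) h1 i (by simp [hs, hi]))

theorem Mono.comp_powAll {F : (Fin n → ℝ) → ℝ} (hF : Mono F) {π : (Fin n → ℝ) → (Fin n → ℝ)}
    {ε : Fin n → ℝ} {N : ℕ} (hε : ∀ i, ε i ≠ 0) (hπ : π = fun y i => ε i * y i ^ N)
    (ha : AnalyticAt ℝ π 0) (h0 : π 0 = 0) : Mono (fun x => F (π x)) := by
  obtain ⟨α, U, hU, hU0, he⟩ := hF
  have h1 : Mono (fun x => monom α (π x)) := by
    have : (fun x => monom α (π x)) = fun x : Fin n → ℝ => monom α ε * monom (N • α) x := by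
      ext x; rw [hπ, monom_sign_pow]
    rw [this]
    exact (mono_of_ne_zero analyticAt_const (monom_ne_zero fun i _ => hε i)).mul (mono_monom _)
  exact (h1.mul (mono_of_ne_zero (hU.comp_zero ha h0) (by rwa [h0]))).congr
    ((tendsto_of_analyticAt ha h0).eventually he)

theorem exists_min_exponent {d : ℕ} {α : ℕ → Fin n → ℕ} (J : Finset ℕ) (hJ : J.Nonempty)
    (hd : ∀ j ∈ J, j < d)
    (h : ∀ i ∈ J, ∀ j ∈ J, (d.factorial / (d - i)) • α i ≤ (d.factorial / (d - j)) • α j ∨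
      (d.factorial / (d - j)) • α j ≤ (d.factorial / (d - i)) • α i) :
    ∃ j₀ ∈ J, ∀ j ∈ J, (d - j) • α j₀ ≤ (d - j₀) • α j := by
  obtain ⟨j₀, hj₀, hmin⟩ := Finset.exists_min_image J
    (fun j => ∑ k, ((d.factorial / (d - j)) • α j) k) hJ
  refine ⟨j₀, hj₀, fun j hj => ?_⟩
  have hle : (d.factorial / (d - j₀)) • α j₀ ≤ (d.factorial / (d - j)) • α j := by
    rcases h j₀ hj₀ j hj with h1 | h1
    · exact h1
    · have := hmin j hj
      intro k
      by_contra! hlt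
      exact absurd (Finset.sum_lt_sum (fun k _ => h1 k) ⟨k, Finset.mem_univ k, hlt⟩) (not_lt.2 this)
  have hf : ∀ i ∈ J, d.factorial / (d - i) * (d - i) = d.factorial := fun i hi =>
    Nat.div_mul_cancel (Nat.dvd_factorial (by have := hd i hi; omega) (by omega))
  intro k
  have h1 := hle k
  simp only [Pi.smul_apply, smul_eq_mul] at h1 ⊢
  have h2 := Nat.mul_le_mul_left ((d - j₀) * (d - j)) h1
  have h3 := hf j₀ hj₀
  have h4 := hf j hj
  have hpos : 0 < d.factorial := d.factorial_pos
  refine Nat.le_of_mul_le_mul_left ?_ hpos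
  calc d.factorial * ((d - j) * α j₀ k)
      = (d - j₀) * (d - j) * (d.factorial / (d - j₀) * α j₀ k) := by
        conv_lhs => rw [← h3]
        ring
    _ ≤ (d - j₀) * (d - j) * (d.factorial / (d - j) * α j k) := h2
    _ = d.factorial * ((d - j₀) * α j k) := by
        conv_rhs => rw [← h4]
        ring

/-- Simultaneous monomialization of the coefficients of a Weierstrass-type expansion. -/
theorem MznAll.coeffs (hM : MznAll n) {d : ℕ} {c : ℕ → (Fin n → ℝ) → ℝ}
    (hc : ∀ j, AnalyticAt ℝ (c j) 0) (hc0 : ∀ j < d - 1, c j 0 = 0)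
    (hne : ∃ j < d - 1, ¬ c j =ᶠ[𝓝 0] 0) (m : Fin n → ℕ) :
    Red (fun τ r => Good τ r ∧ Mono r ∧ Mono (fun x => monom m (τ x)) ∧
      ∃ (μ : Fin n → ℕ) (C : ℕ → (Fin n → ℝ) → ℝ), μ ≠ 0 ∧ (∀ j, AnalyticAt ℝ (C j) 0) ∧
        (∀ j < d - 1, (fun x => c j (τ x)) =ᶠ[𝓝 0] fun x => monom ((d - j) • μ) x * C j x) ∧
        ∃ j < d - 1, C j 0 ≠ 0) (fun x => x) (fun _ => 1) := by
  classical
  set e : ℕ → ℕ := fun j => d.factorial / (d - j) with he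
  refine Red.bind ?_ (hM.family (ι := Unit ⊕ Fin (d - 1) ⊕ (Fin (d - 1) × Fin (d - 1)))
    (F := Sum.elim (fun _ => monom m) (Sum.elim (fun j => c j)
      fun p x => c p.1 x ^ e p.1 - c p.2 x ^ e p.2)) ?_)
  swap
  · rintro (_ | j | p)
    · exact analyticAt_monom m 0
    · exact hc j
    · exact ((hc _).pow _).sub ((hc _).pow _)
  rintro τ r ⟨hg, hr, hall⟩
  have hm : Mono (fun x => monom m (τ x)) :=
    (hall (Sum.inl ())).resolve_left (monom_germ_ne_zero m)
  have hcj : ∀ j < d - 1, c j =ᶠ[𝓝 0] 0 ∨ Mono (fun x => c j (τ x)) := fun j hj =>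
    hall (Sum.inr (Sum.inl ⟨j, hj⟩))
  have hdiff : ∀ i < d - 1, ∀ j < d - 1, (fun x => c i (τ x) ^ e i - c j (τ x) ^ e j) =ᶠ[𝓝 0] 0 ∨
      Mono (fun x => c i (τ x) ^ e i - c j (τ x) ^ e j) := by
    intro i hi j hj
    rcases hall (Sum.inr (Sum.inr (⟨i, hi⟩, ⟨j, hj⟩))) with h | h
    · exact Or.inl ((tendsto_of_analyticAt hg.an hg.zero).eventually h)
    · exact Or.inr h
  set J : Finset ℕ := (Finset.range (d - 1)).filter fun j => ¬ c j =ᶠ[𝓝 0] 0 with hJ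
  have hJm : ∀ j ∈ J, j < d - 1 ∧ ¬ c j =ᶠ[𝓝 0] 0 := fun j hj => by simpa [hJ] using hj
  have hex : ∀ j, ∃ (α : Fin n → ℕ) (U : (Fin n → ℝ) → ℝ), j ∈ J → AnalyticAt ℝ U 0 ∧ U 0 ≠ 0 ∧
      (fun x => c j (τ x)) =ᶠ[𝓝 0] fun x => monom α x * U x := by
    intro j
    by_cases hj : j ∈ J
    · obtain ⟨α, U, h⟩ := (hcj j (hJm j hj).1).resolve_left (hJm j hj).2
      exact ⟨α, U, fun _ => h⟩
    · exact ⟨0, 0, fun h => absurd h hj⟩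
  choose α U hαU using hex
  obtain ⟨j₀, hj₀, hmin⟩ := exists_min_exponent (α := α) (d := d) J
    (by obtain ⟨j, hj, hj'⟩ := hne; exact ⟨j, by simp [hJ, hj, hj']⟩)
    (fun j hj => by have := (hJm j hj).1; omega) (by
      intro i hi j hj
      obtain ⟨hUi, hUi0, hi'⟩ := hαU i hi
      obtain ⟨hUj, hUj0, hj'⟩ := hαU j hj
      have heq : (fun x => c i (τ x) ^ e i - c j (τ x) ^ e j) =ᶠ[𝓝 0]
          fun x => monom (e i • α i) x * U i x ^ e i - monom (e j • α j) x * U j x ^ e j := by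
        filter_upwards [hi', hj'] with x h1 h2
        rw [h1, h2, monom_nsmul, monom_nsmul, mul_pow, mul_pow]
      refine monom_le_or_le (hUi.pow (e i)) (hUj.pow (e j)) (pow_ne_zero _ hUi0)
        (pow_ne_zero _ hUj0) ?_
      rcases hdiff i (hJm i hi).1 j (hJm j hj).1 with h | h
      · exact Or.inl (heq.symm.trans h)
      · exact Or.inr (h.congr heq.symm))
  obtain ⟨hj₀d, -⟩ := hJm j₀ hj₀
  have hα0 : α j₀ ≠ 0 := by
    intro h0
    obtain ⟨-, hU0, hh⟩ := hαU j₀ hj₀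
    have : c j₀ (τ 0) = monom (α j₀) 0 * U j₀ 0 := hh.self_of_nhds
    rw [hg.zero, hc0 j₀ hj₀d, h0, monom_zero, one_mul] at this
    exact hU0 this.symm
  set N := 2 * (d - j₀) with hN
  refine Red.comp_id ?_
  refine Red.mono ?_ (red_powAll (n := n) (N := N) (by omega) (even_two_mul _) Finset.univ)
  rintro π s ⟨hgπ, hs, ε, hε, hπ⟩
  simp only [Finset.mem_univ, if_true] at hπ
  have hε0 : ∀ i, ε i ≠ 0 := fun i => by rcases hε i with h | h <;> rw [h] <;> norm_num
  refine ⟨hg.comp hgπ, (hr.comp_powAll hε0 hπ hgπ.an hgπ.zero).mul hs,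
    hm.comp_powAll hε0 hπ hgπ.an hgπ.zero, 2 • α j₀,
    fun j x => if j ∈ J then monom (N • α j - (d - j) • 2 • α j₀) x *
      (monom (α j) ε * U j (π x)) else 0, ?_, ?_, ?_, ?_⟩
  · exact smul_ne_zero two_ne_zero hα0
  · intro j
    by_cases hj : j ∈ J
    · simp only [if_pos hj]
      exact (analyticAt_monom _ 0).mul
        (analyticAt_const.mul ((hαU j hj).1.comp_zero hgπ.an hgπ.zero))
    · simp only [if_neg hj]
      exact analyticAt_const
  · intro j hj
    by_cases hjJ : j ∈ J
    · simp only [if_pos hjJ]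
      filter_upwards [(tendsto_of_analyticAt hgπ.an hgπ.zero).eventually (hαU j hjJ).2.2] with x hx
      have hle : (d - j) • 2 • α j₀ ≤ N • α j := by
        intro k
        have := hmin j hjJ k
        simp only [Pi.smul_apply, smul_eq_mul, hN] at this ⊢
        nlinarith
      rw [hx, ← mul_assoc, ← monom_add, add_tsub_cancel_of_le hle]
      conv_lhs => rw [show monom (α j) (π x) = monom (α j) ε * monom (N • α j) x by
        rw [hπ, monom_sign_pow]]
      ring
    · simp only [if_neg hjJ, mul_zero]
      have h0 : c j =ᶠ[𝓝 0] 0 := by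
        by_contra h; exact hjJ (by simp [hJ, hj, h])
      exact (tendsto_of_analyticAt (hg.comp hgπ).an (hg.comp hgπ).zero).eventually h0
  · refine ⟨j₀, hj₀d, ?_⟩
    simp only [if_pos hj₀]
    have : N • α j₀ - (d - j₀) • 2 • α j₀ = 0 := by
      ext k
      simp only [Pi.smul_apply, Pi.sub_apply, smul_eq_mul, hN, Pi.zero_apply]
      rw [Nat.sub_eq_zero_iff_le]
      exact le_of_eq (by ring)
    rw [this, monom_zero, one_mul, hgπ.zero]
    exact mul_ne_zero (monom_ne_zero fun i _ => hε0 i) (hαU j₀ hj₀).2.1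

end Family

section Monomialization

variable {n : ℕ}

theorem tail_liftMap (τ : (Fin n → ℝ) → (Fin n → ℝ)) (x : Fin (n + 1) → ℝ) :
    Fin.tail (liftMap τ x) = τ (Fin.tail x) := Fin.tail_cons _ _

theorem mzn_of_order (hM : MznAll n) (d : ℕ) : ∀ G : (Fin (n + 1) → ℝ) → ℝ, AnalyticAt ℝ G 0 →
    ∀ g : ℝ → ℝ, AnalyticAt ℝ g 0 → g 0 ≠ 0 →
    (∀ᶠ t in 𝓝 0, G (Pi.single 0 t) = t ^ d * g t) →
    ∀ m : Fin n → ℕ, Mzn (fun x => monom m (Fin.tail x) * G x) := by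
  induction d using Nat.strong_induction_on with
  | _ d ih =>
  intro G hG g hg hg0 hGg m
  have hmt : AnalyticAt ℝ (fun x : Fin (n + 1) → ℝ => monom m (Fin.tail x)) 0 :=
    (analyticAt_monom m 0).comp_zero (analyticAt_tail 0) tail_zero
  rcases d with _ | d
  · have h0 : G 0 ≠ 0 := by
      have := hGg.self_of_nhds
      simp only [Pi.single_zero, pow_zero, one_mul] at this
      rwa [this]
    exact Mzn.mul_unit (mono_of_tail (mono_monom m)).mzn hG h0
  obtain ⟨c₀, h₀, hr₀, hc₀, hh₀⟩ := exists_rep (d + 1) G g hG hg hg0 hGg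
  obtain ⟨θ, hθ, hθa, hθ0, hθi, c, h, hr, hc0, hh0, hcd⟩ := exists_tschirnhaus hG hr₀ hc₀ hh₀
  have hS := Step.shear (0 : Fin (n + 1)) θ hθ hθa hθ0 hθi
  refine Step.mzn (hmt.mul hG) hS ?_
  rintro p rfl
  have hgood := (hS.good _ rfl).1
  have htail : ∀ x, Fin.tail (shearMap 0 θ x) = Fin.tail x := fun x => by
    rw [shearMap, Fin.tail_update_zero]
  simp only [htail, mul_one]
  have heq : (fun x => G (shearMap 0 θ x)) =ᶠ[𝓝 0] fun x =>
      ∑ j ∈ Finset.range d, c j (Fin.tail x) * x 0 ^ j + x 0 ^ (d + 1) * h x := by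
    filter_upwards [hr.eq, (tendsto_of_analyticAt (analyticAt_tail 0) tail_zero).eventually hcd]
      with x h1 h2
    rw [h1, Finset.sum_range_succ, h2]
    simp
  have hF : AnalyticAt ℝ (fun x => monom m (Fin.tail x) * G (shearMap 0 θ x)) 0 :=
    hmt.mul (hG.comp_zero hgood.an hgood.zero)
  by_cases hz : ∀ j < d, c j =ᶠ[𝓝 0] 0
  · have h1 : (fun x => G (shearMap 0 θ x)) =ᶠ[𝓝 0] fun x => x 0 ^ (d + 1) * h x := by
      have : ∀ᶠ x : Fin (n + 1) → ℝ in 𝓝 0, ∀ j ∈ Finset.range d, c j (Fin.tail x) = 0 := by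
        rw [Filter.eventually_all_finset]
        exact fun j hj => (tendsto_of_analyticAt (analyticAt_tail 0) tail_zero).eventually
          (hz j (Finset.mem_range.1 hj))
      filter_upwards [heq, this] with x h1 h2
      rw [h1, Finset.sum_eq_zero fun j hj => by rw [h2 j hj, zero_mul], zero_add]
    exact ((mono_of_tail (mono_monom m)).mul (((mono_coord_pow 0 _).mul
      (mono_of_ne_zero hr.anh hh0)).congr h1)).mzn
  push Not at hz
  refine Red.mzn hF ?_
  have hL := (hM.coeffs (d := d + 1) hr.anc (fun j hj => hc0 j (by omega)) (by simpa using hz) m).lift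
  have e1 : liftMap (fun x : Fin n → ℝ => x) = fun x => x := by
    ext1 x; exact Fin.cons_self_tail x
  rw [e1] at hL
  refine Red.mono ?_ hL
  rintro _ _ ⟨τ, r, ⟨hg', hr', hm', μ, C, hμ, hC, hcC, j₀, hj₀, hCj⟩, rfl, rfl⟩
  have hgl := hg'.lift
  refine ⟨hgl, ?_⟩
  obtain ⟨m', V, hV, hV0, hmr⟩ := hm'.mul hr'
  have hCt : ∀ j, AnalyticAt ℝ (fun x : Fin (n + 1) → ℝ => C j (Fin.tail x)) 0 := fun j =>
    (hC j).comp_zero (analyticAt_tail 0) tail_zero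
  have hform := mzn_form (d := d + 1) (by omega) (fun d' hd' => ih d' hd') _ μ
    (fun j x => C j (Fin.tail x)) (fun x => h (liftMap τ x)) m' rfl hμ hCt
    (hr.anh.comp_zero hgl.an hgl.zero) (by rwa [hgl.zero]) ⟨j₀, hj₀, by rwa [tail_zero]⟩
  have hVt : AnalyticAt ℝ (fun x : Fin (n + 1) → ℝ => V (Fin.tail x)) 0 :=
    hV.comp_zero (analyticAt_tail 0) tail_zero
  refine Mzn.congr (hform.mul_unit hVt (by rwa [tail_zero])) ?_
  have tt := tendsto_of_analyticAt (analyticAt_tail (n := n) 0) tail_zero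
  have hcC' : ∀ᶠ x : Fin (n + 1) → ℝ in 𝓝 0, ∀ j ∈ Finset.range d,
      c j (τ (Fin.tail x)) = monom ((d + 1 - j) • μ) (Fin.tail x) * C j (Fin.tail x) := by
    rw [Filter.eventually_all_finset]
    exact fun j hj => tt.eventually (hcC j (by have := Finset.mem_range.1 hj; omega))
  filter_upwards [tt.eventually hmr, hcC',
    (tendsto_of_analyticAt hgl.an hgl.zero).eventually heq] with x h1 h2 h3
  rw [h3]
  simp only [tail_liftMap, liftFun, Nat.add_sub_cancel]
  rw [Finset.sum_congr rfl fun j hj => by rw [h2 j hj]]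
  have h4 : liftMap τ x 0 = x 0 := rfl
  rw [h4]
  linear_combination (∑ j ∈ Finset.range d, monom ((d + 1 - j) • μ) (Fin.tail x) *
    C j (Fin.tail x) * x 0 ^ j + x 0 ^ (d + 1) * h (liftMap τ x)) * h1

end Monomialization

section MonomializationTheorem

variable {n : ℕ}

theorem red_shears (v : Fin (n + 1) → ℝ) (T : Finset (Fin (n + 1))) (hT : 0 ∉ T) :
    Red (fun τ r => Good τ r ∧ r = (fun _ => 1) ∧
      τ = fun y i => if i ∈ T then y i + v i * y 0 else y i) (fun x : Fin (n + 1) → ℝ => x)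
      (fun _ => 1) := by
  classical
  induction T using Finset.induction_on with
  | empty => exact .done _ _ ⟨good_id, rfl, by simp⟩
  | insert a T ha ih =>
    have ha0 : a ≠ 0 := fun h => hT (by simp [h])
    have hT0 : 0 ∉ T := fun h => hT (by simp [h])
    refine Red.bind ?_ (ih hT0)
    rintro τ r ⟨hg, rfl, rfl⟩
    have hS := Step.shear a (fun x : Fin (n + 1) → ℝ => v a * x 0) (by fun_prop)
      (analyticAt_const.mul (analyticAt_coord 0 0)) (by simp)
      (fun x t => by simp [Function.update_of_ne ha0.symm])
    refine .step _ _ _ hS ?_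
    rintro p rfl
    refine .done _ _ ⟨hg.comp (hS.good _ rfl).1, by simp, ?_⟩
    ext y i
    by_cases h : i = a
    · subst h; simp [ha, shearMap]
    · simp [h, shearMap, Function.update_of_ne ha0.symm]

theorem exists_nonflat_line {F : (Fin (n + 1) → ℝ) → ℝ} (hF : AnalyticAt ℝ F 0)
    (h0 : ¬ F =ᶠ[𝓝 0] 0) : ∃ v : Fin (n + 1) → ℝ, v 0 = 1 ∧ ¬ ∀ᶠ t : ℝ in 𝓝 0, F (t • v) = 0 := by
  obtain ⟨r, hr, hball⟩ := Metric.eventually_nhds_iff_ball.1 hF.eventually_analyticAt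
  obtain ⟨p, hp, hpF, hp0⟩ : ∃ p ∈ Metric.ball (0 : Fin (n + 1) → ℝ) r, F p ≠ 0 ∧ p 0 ≠ 0 := by
    by_contra! hcon
    have : ∀ᶠ x in 𝓝 0, F x * x 0 = 0 := by
      filter_upwards [Metric.ball_mem_nhds (0 : Fin (n + 1) → ℝ) hr] with x hx
      by_cases hFx : F x = 0
      · rw [hFx, zero_mul]
      · rw [hcon x hx hFx, mul_zero]
    rcases germ_eq_zero_or_eq_zero_of_mul hF (analyticAt_coord 0 0) this with h | h
    · exact h0 h
    · exact (mono_coord 0).germ_ne_zero h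
  refine ⟨(p 0)⁻¹ • p, by simp [hp0], fun hcon => hpF ?_⟩
  have hl : ∀ t : ℝ, AnalyticAt ℝ (fun t : ℝ => t • p) t := fun t =>
    analyticAt_id.smul analyticAt_const
  have hφ : AnalyticOnNhd ℝ (fun t : ℝ => F (t • p)) (Set.Icc 0 1) := by
    intro t ht
    refine AnalyticAt.fun_comp (hball _ ?_) (hl t)
    rw [mem_ball_zero_iff] at hp ⊢
    calc ‖t • p‖ = |t| * ‖p‖ := norm_smul _ _
      _ ≤ 1 * ‖p‖ := by
          gcongr; rw [abs_le]; exact ⟨by linarith [ht.1], ht.2⟩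
      _ < r := by rwa [one_mul]
  have hz : (fun t : ℝ => F (t • p)) =ᶠ[𝓝 0] 0 := by
    have ht : Tendsto (fun t : ℝ => t * p 0) (𝓝 0) (𝓝 0) := by
      simpa using (continuous_mul_const (p 0)).tendsto 0
    filter_upwards [ht.eventually hcon] with t h
    rwa [smul_smul, mul_assoc, mul_inv_cancel₀ hp0, mul_one] at h
  have := hφ.eqOn_zero_of_preconnected_of_eventuallyEq_zero isPreconnected_Icc
    (Set.left_mem_Icc.2 zero_le_one) hz (Set.right_mem_Icc.2 zero_le_one)
  simpa using this

theorem mznAll_succ (hM : MznAll n) : MznAll (n + 1) := by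
  intro F hF h0
  obtain ⟨v, hv, hnf⟩ := exists_nonflat_line hF h0
  refine Red.mzn hF (Red.mono ?_ (red_shears v (Finset.univ.erase 0) (by simp)))
  rintro τ r ⟨hg, rfl, hτ⟩
  refine ⟨hg, ?_⟩
  simp only [mul_one]
  have hG : AnalyticAt ℝ (fun x => F (τ x)) 0 := hF.comp_zero hg.an hg.zero
  have hτs : ∀ t : ℝ, τ (Pi.single 0 t) = t • v := by
    intro t
    ext i
    rw [hτ]
    by_cases hi : i = 0
    · subst hi; simp [hv]
    · simp [hi, mul_comm]
  have hline : AnalyticAt ℝ (fun t : ℝ => F (t • v)) 0 := by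
    have h1 : AnalyticAt ℝ (fun t : ℝ => t • v) 0 := analyticAt_id.smul analyticAt_const
    exact AnalyticAt.fun_comp (by rwa [zero_smul]) h1
  obtain ⟨d, g, hg', hg0, hgd⟩ := hline.exists_eventuallyEq_pow_smul_nonzero_iff.2 hnf
  have := mzn_of_order hM d _ hG g hg' hg0 (by
    filter_upwards [hgd] with t ht
    rw [hτs, ht, sub_zero, smul_eq_mul]) 0
  simpa using this

theorem mznAll (n : ℕ) : MznAll n := by
  induction n with
  | zero =>
    intro F hF h0
    refine (mono_of_ne_zero hF fun h => h0 ?_).mzn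
    filter_upwards with x
    rw [Subsingleton.elim x 0, h]; rfl
  | succ n ih => exact mznAll_succ ih

end MonomializationTheorem

section Nondegenerate

variable {n : ℕ}

/-- Composition with `τ` is injective on analytic germs. -/
def Nondeg (τ : (Fin n → ℝ) → (Fin n → ℝ)) : Prop :=
  ∀ F : (Fin n → ℝ) → ℝ, AnalyticAt ℝ F 0 → (fun x => F (τ x)) =ᶠ[𝓝 0] 0 → F =ᶠ[𝓝 0] 0

theorem germ_eq_zero_of_frequently {F : (Fin n → ℝ) → ℝ} (hF : AnalyticAt ℝ F 0)
    (h : ∃ᶠ p in 𝓝 0, F =ᶠ[𝓝 p] 0) : F =ᶠ[𝓝 0] 0 := by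
  obtain ⟨r, hr, hball⟩ := Metric.eventually_nhds_iff_ball.1 hF.eventually_analyticAt
  obtain ⟨p, hp, hpr⟩ := (h.and_eventually (Metric.ball_mem_nhds 0 hr)).exists
  have := AnalyticOnNhd.eqOn_zero_of_preconnected_of_eventuallyEq_zero (fun x hx => hball x hx)
    (convex_ball (0 : Fin n → ℝ) r).isPreconnected hpr hp
  exact this.eventuallyEq_of_mem (Metric.ball_mem_nhds 0 hr)

theorem nondeg_of_section {τ : (Fin n → ℝ) → (Fin n → ℝ)} (hτ : ContinuousAt τ 0) (h0 : τ 0 = 0)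
    (κ : (Fin n → ℝ) → (Fin n → ℝ))
    (h : ∀ s : ℝ, 0 < s → ContinuousAt κ (τ fun _ => s) ∧ κ (τ fun _ => s) = (fun _ => s) ∧
      ∀ᶠ x in 𝓝 (τ fun _ => s), τ (κ x) = x) : Nondeg τ := by
  intro F hF hz
  refine germ_eq_zero_of_frequently hF ?_
  have hc : Tendsto (fun s : ℝ => (fun _ : Fin n => s)) (𝓝[>] 0) (𝓝 0) :=
    ((continuous_pi fun _ => continuous_id).tendsto' 0 (0 : Fin n → ℝ) rfl).mono_left
      nhdsWithin_le_nhds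
  have ht : Tendsto (fun s : ℝ => τ (fun _ : Fin n => s)) (𝓝[>] 0) (𝓝 0) := by
    have : Tendsto τ (𝓝 0) (𝓝 0) := by simpa [h0] using hτ.tendsto
    exact this.comp hc
  refine ht.frequently (Eventually.frequently ?_)
  filter_upwards [self_mem_nhdsWithin, hc.eventually hz.eventually_nhds] with s hs hs2
  obtain ⟨h1, h2, h3⟩ := h s hs
  have h4 : Tendsto κ (𝓝 (τ fun _ => s)) (𝓝 (fun _ => s)) := by simpa only [h2] using h1.tendsto
  filter_upwards [h3, h4.eventually hs2] with x hx1 hx2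
  rw [← hx1]; exact hx2

theorem continuousAt_update {g : (Fin n → ℝ) → ℝ} {a : Fin n → ℝ} (i : Fin n)
    (hg : ContinuousAt g a) : ContinuousAt (fun x => Function.update x i (g x)) a :=
  continuousAt_id.update i hg

theorem Step.nondeg {S : Set (((Fin n → ℝ) → (Fin n → ℝ)) × ((Fin n → ℝ) → ℝ))} (hS : Step S) :
    ∀ p ∈ S, Nondeg p.1 := by
  intro p hp
  have hg := (hS.good p hp).1
  cases hS with
  | shear i θ hθ ha h0 hi =>
    subst hp
    refine nondeg_of_section hg.cont.continuousAt hg.zero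
      (fun x => Function.update x i (x i - θ x)) fun s _ => ⟨?_, ?_, Eventually.of_forall fun x => ?_⟩
    · have := hθ.continuous
      exact continuousAt_update i (by fun_prop)
    · simp only [shearMap, hi]
      ext j; by_cases h : j = i <;> simp [h]
    · simp only [shearMap, hi]
      ext j; by_cases h : j = i
      · subst h; simp
      · simp [h]
  | pow i N hN hN2 =>
    obtain ⟨ε, hε, rfl⟩ := hp
    have hε2 : ε * ε = 1 := by rcases hε with rfl | rfl <;> norm_num
    refine nondeg_of_section hg.cont.continuousAt hg.zero
      (fun x => Function.update x i ((ε * x i) ^ ((N : ℝ)⁻¹))) fun s hs => ⟨?_, ?_, ?_⟩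
    · exact continuousAt_update i (ContinuousAt.rpow_const
        (continuous_const.mul (continuous_apply i)).continuousAt (Or.inr (by positivity)))
    · ext j; by_cases h : j = i
      · subst h
        simp only [powMap, Function.update_self, ← mul_assoc, hε2, one_mul]
        exact Real.pow_rpow_inv_natCast hs.le hN.ne'
      · simp [powMap, h]
    · have hpos : 0 < ε * (powMap i N ε fun _ => s) i := by
        simp only [powMap, Function.update_self, ← mul_assoc, hε2, one_mul]
        positivity
      have hc : ContinuousAt (fun x : Fin n → ℝ => ε * x i) (powMap i N ε fun _ => s) :=
        (continuous_const.mul (continuous_apply i)).continuousAt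
      filter_upwards [hc.eventually (lt_mem_nhds hpos)] with x hx
      ext j; by_cases h : j = i
      · subst h
        simp only [powMap, Function.update_self]
        rw [Real.rpow_inv_natCast_pow hx.le hN.ne', ← mul_assoc, hε2, one_mul]
      · simp [powMap, h]
  | blow i j hij =>
    rcases hp with ⟨b, rfl⟩ | rfl
    · have hx0 : ∀ s : ℝ, blowA i j b (fun _ => s) j = s := fun s => by
        simp [blowA, Function.update_of_ne hij.symm]
      refine nondeg_of_section hg.cont.continuousAt hg.zero
        (fun x => Function.update x i (x i / x j - b)) fun s hs => ⟨?_, ?_, ?_⟩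
      · refine continuousAt_update i (ContinuousAt.sub (ContinuousAt.div
          (continuous_apply i).continuousAt (continuous_apply j).continuousAt ?_) continuousAt_const)
        exact ne_of_eq_of_ne (hx0 s) hs.ne'
      · ext k; by_cases h : k = i
        · subst h
          simp [blowA, Function.update_of_ne hij.symm, mul_div_cancel_left₀ _ hs.ne']
        · simp [blowA, h]
      · have hc : ContinuousAt (fun x : Fin n → ℝ => x j) (blowA i j b fun _ => s) :=
          (continuous_apply j).continuousAt
        have hpos : 0 < blowA i j b (fun _ => s) j := by rw [hx0]; exact hs
        filter_upwards [hc.eventually (lt_mem_nhds hpos)] with x hx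
        ext k; by_cases h : k = i
        · subst h
          simp [blowA, Function.update_of_ne hij.symm, mul_div_cancel₀ _ hx.ne']
        · simp [blowA, h]
    · have hx0 : ∀ s : ℝ, blowB i j (fun _ => s) i = s := fun s => by
        simp [blowB, Function.update_of_ne hij]
      refine nondeg_of_section hg.cont.continuousAt hg.zero
        (fun x => Function.update x j (x j / x i)) fun s hs => ⟨?_, ?_, ?_⟩
      · refine continuousAt_update j (ContinuousAt.div (continuous_apply j).continuousAt
          (continuous_apply i).continuousAt ?_)
        exact ne_of_eq_of_ne (hx0 s) hs.ne'
      · ext k; by_cases h : k = j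
        · subst h
          simp [blowB, Function.update_of_ne hij, mul_div_cancel_left₀ _ hs.ne']
        · simp [blowB, h]
      · have hc : ContinuousAt (fun x : Fin n → ℝ => x i) (blowB i j fun _ => s) :=
          (continuous_apply i).continuousAt
        have hpos : 0 < blowB i j (fun _ => s) i := by rw [hx0]; exact hs
        filter_upwards [hc.eventually (lt_mem_nhds hpos)] with x hx
        ext k; by_cases h : k = j
        · subst h
          simp [blowB, Function.update_of_ne hij, mul_div_cancel₀ _ hx.ne']
        · simp [blowB, h]

theorem Red.nondeg {Q : ((Fin n → ℝ) → (Fin n → ℝ)) → ((Fin n → ℝ) → ℝ) → Prop} {σ ρ}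
    (h : Red Q σ ρ) (hg : Good σ ρ) (hn : Nondeg σ) : Red (fun τ r => Nondeg τ ∧ Q τ r) σ ρ := by
  induction h with
  | done τ r h => exact .done _ _ ⟨hn, h⟩
  | step τ r S hS _ ih =>
    refine .step _ _ S hS fun p hp => ih p hp (hg.comp (hS.good p hp).1) fun F hF hz => ?_
    exact hn F hF (hS.nondeg p hp _ (hF.comp_zero hg.an hg.zero) hz)

end Nondegenerate

section Elimination

variable {n : ℕ}

/-- `G` is a multiple of `F` by an analytic germ vanishing at `0`. -/
def Dominated (F G : (Fin n → ℝ) → ℝ) : Prop :=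
  ∃ h : (Fin n → ℝ) → ℝ, AnalyticAt ℝ h 0 ∧ h 0 = 0 ∧ G =ᶠ[𝓝 0] fun x => F x * h x

theorem Dominated.comp {F G : (Fin n → ℝ) → ℝ} (h : Dominated F G) {τ : (Fin n → ℝ) → (Fin n → ℝ)}
    (ha : AnalyticAt ℝ τ 0) (h0 : τ 0 = 0) :
    Dominated (fun x => F (τ x)) (fun x => G (τ x)) := by
  obtain ⟨k, hk, hk0, he⟩ := h
  exact ⟨fun x => k (τ x), hk.comp_zero ha h0, by simp only [h0, hk0], (tendsto_of_analyticAt ha h0).eventually he⟩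

theorem Dominated.sub_smul {F G H : (Fin n → ℝ) → ℝ} (hG : Dominated F G) (hH : Dominated F H)
    (t : ℝ) : Dominated F (fun x => G x - t * H x) := by
  obtain ⟨k, hk, hk0, he⟩ := hG
  obtain ⟨l, hl, hl0, he'⟩ := hH
  refine ⟨fun x => k x - t * l x, hk.sub (analyticAt_const.mul hl), by simp [hk0, hl0], ?_⟩
  filter_upwards [he, he'] with x h1 h2
  rw [h1, h2]; ring

theorem Dominated.exponent_ne {F G U V : (Fin n → ℝ) → ℝ} {α β : Fin n → ℕ} (h : Dominated F G)
    (hU : AnalyticAt ℝ U 0) (hV : AnalyticAt ℝ V 0) (hV0 : V 0 ≠ 0)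
    (hF : F =ᶠ[𝓝 0] fun x => monom α x * U x) (hG : G =ᶠ[𝓝 0] fun x => monom β x * V x) :
    α ≠ β := by
  rintro rfl
  obtain ⟨k, hk, hk0, he⟩ := h
  have := germ_mul_left_cancel (analyticAt_monom α 0) hV (hU.mul hk) (monom_germ_ne_zero α) (by
    filter_upwards [hF, hG, he] with x h1 h2 h3
    rw [← h2, h3, h1, Pi.mul_apply]; ring)
  refine hV0 ?_
  rw [this.self_of_nhds]
  simp [hk0]

variable {ι : Type*} [Fintype ι]

/-- The linear combination with coefficients `a` of the functions `Φ`. -/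
def lin (Φ : ι → (Fin n → ℝ) → ℝ) (a : ι → ℝ) (x : Fin n → ℝ) : ℝ := ∑ l, a l * Φ l x

theorem lin_sub_smul (Φ : ι → (Fin n → ℝ) → ℝ) (a b : ι → ℝ) (t : ℝ) (x : Fin n → ℝ) :
    lin Φ (a - t • b) x = lin Φ a x - t * lin Φ b x := by
  simp only [lin, Finset.mul_sum, ← Finset.sum_sub_distrib]
  refine Finset.sum_congr rfl fun l _ => ?_
  simp only [Pi.sub_apply, Pi.smul_apply, smul_eq_mul]; ring

theorem analyticAt_lin {Φ : ι → (Fin n → ℝ) → ℝ} (hΦ : ∀ l, AnalyticAt ℝ (Φ l) 0) (a : ι → ℝ) :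
    AnalyticAt ℝ (lin Φ a) 0 :=
  Finset.univ.analyticAt_fun_sum fun l _ => analyticAt_const.mul (hΦ l)

theorem linearIndependent_sub_smul {B : ι → ι → ℝ} (hB : LinearIndependent ℝ B) {i₀ : ι} {t : ι → ℝ}
    (ht : t i₀ = 0) : LinearIndependent ℝ (fun j => B j - t j • B i₀) := by
  classical
  rw [Fintype.linearIndependent_iff] at hB ⊢
  intro a ha
  have key : ∑ j, (a j - if j = i₀ then ∑ k, a k * t k else 0) • B j = 0 := by
    rw [← ha]
    simp only [sub_smul, smul_sub, Finset.sum_sub_distrib, ite_smul, zero_smul, Finset.sum_ite_eq',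
      Finset.mem_univ, if_true, Finset.sum_smul, smul_smul]
  have h1 := hB _ key
  have h2 : ∀ j, j ≠ i₀ → a j = 0 := fun j hj => by simpa [hj] using h1 j
  intro j
  by_cases hj : j = i₀
  · subst hj
    have h3 := h1 j
    rw [if_pos rfl, Finset.sum_eq_zero, sub_zero] at h3
    · exact h3
    · intro k _
      by_cases hk : k = j
      · rw [hk, ht, mul_zero]
      · rw [h2 k hk, zero_mul]
  · exact h2 j hj

/-- A partially eliminated system: the functions indexed by `D` are pairwise comparable and
dominate all the others. -/
structure Elim (Φ : ι → (Fin n → ℝ) → ℝ) (k : ℕ) (τ : (Fin n → ℝ) → (Fin n → ℝ))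
    (r : (Fin n → ℝ) → ℝ) (B : ι → ι → ℝ) (D : Finset ι) : Prop where
  good : Good τ r
  mono : Mono r
  card : D.card = k
  indep : LinearIndependent ℝ B
  dom : ∀ i ∈ D, ∀ j ∉ D, Dominated (fun x => lin Φ (B i) (τ x)) (fun x => lin Φ (B j) (τ x))
  comparable : ∀ i ∈ D, ∀ j ∈ D, i ≠ j →
    Dominated (fun x => lin Φ (B i) (τ x)) (fun x => lin Φ (B j) (τ x)) ∨
    Dominated (fun x => lin Φ (B j) (τ x)) (fun x => lin Φ (B i) (τ x))

theorem Elim.comp {Φ : ι → (Fin n → ℝ) → ℝ} {k : ℕ} {τ τ' : (Fin n → ℝ) → (Fin n → ℝ)}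
    {r r' : (Fin n → ℝ) → ℝ} {B : ι → ι → ℝ} {D : Finset ι} (h : Elim Φ k τ r B D)
    (hg : Good τ' r') (hr : Mono (fun x => r (τ' x))) (hr' : Mono r') :
    Elim Φ k (fun x => τ (τ' x)) (fun x => r (τ' x) * r' x) B D where
  good := h.good.comp hg
  mono := hr.mul hr'
  card := h.card
  indep := h.indep
  dom i hi j hj := (h.dom i hi j hj).comp hg.an hg.zero
  comparable i hi j hj hij := (h.comparable i hi j hj hij).imp
    (fun h => h.comp hg.an hg.zero) (fun h => h.comp hg.an hg.zero)

theorem Elim.refine {Φ : ι → (Fin n → ℝ) → ℝ} (hΦ : ∀ l, AnalyticAt ℝ (Φ l) 0)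
    (hind : ∀ a : ι → ℝ, a ≠ 0 → ¬ lin Φ a =ᶠ[𝓝 0] 0) {k : ℕ} {τ : (Fin n → ℝ) → (Fin n → ℝ)}
    {r : (Fin n → ℝ) → ℝ} {B : ι → ι → ℝ} {D : Finset ι} (h : Elim Φ k τ r B D) (hn : Nondeg τ) :
    Red (fun τ r => Elim Φ k τ r B D ∧ (∀ i, Mono (fun x => lin Φ (B i) (τ x))) ∧
      ∀ i j, (fun x => lin Φ (B i) (τ x) - lin Φ (B j) (τ x)) =ᶠ[𝓝 0] 0 ∨
        Mono (fun x => lin Φ (B i) (τ x) - lin Φ (B j) (τ x))) τ r := by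
  have hl : ∀ i, AnalyticAt ℝ (fun x => lin Φ (B i) (τ x)) 0 := fun i =>
    (analyticAt_lin hΦ _).comp_zero h.good.an h.good.zero
  refine Red.comp_id (Red.mono ?_ ((mznAll n).family (ι := Unit ⊕ ι ⊕ (ι × ι))
    (F := Sum.elim (fun _ => r) (Sum.elim (fun i x => lin Φ (B i) (τ x))
      fun p x => lin Φ (B p.1) (τ x) - lin Φ (B p.2) (τ x))) ?_))
  · rintro τ' r' ⟨hg, hr', hall⟩
    refine ⟨h.comp hg ((hall (Sum.inl ())).resolve_left h.mono.germ_ne_zero) hr', fun i => ?_,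
      fun i j => ?_⟩
    · refine (hall (Sum.inr (Sum.inl i))).resolve_left fun hz => ?_
      exact hind (B i) (h.indep.ne_zero i) (hn _ (analyticAt_lin hΦ _) hz)
    · rcases hall (Sum.inr (Sum.inr (i, j))) with hz | hz
      · exact Or.inl ((tendsto_of_analyticAt hg.an hg.zero).eventually hz)
      · exact Or.inr hz
  · rintro (_ | i | p)
    · exact h.good.anw
    · exact hl i
    · exact (hl _).sub (hl _)

theorem Elim.extend {Φ : ι → (Fin n → ℝ) → ℝ} {k : ℕ} {τ : (Fin n → ℝ) → (Fin n → ℝ)}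
    {r : (Fin n → ℝ) → ℝ} {B : ι → ι → ℝ} {D : Finset ι} (h : Elim Φ k τ r B D)
    (hk : k < Fintype.card ι) (hm : ∀ i, Mono (fun x => lin Φ (B i) (τ x)))
    (hd : ∀ i j, (fun x => lin Φ (B i) (τ x) - lin Φ (B j) (τ x)) =ᶠ[𝓝 0] 0 ∨
        Mono (fun x => lin Φ (B i) (τ x) - lin Φ (B j) (τ x))) :
    ∃ B' D', Elim Φ (k + 1) τ r B' D' := by
  classical
  choose α U hU hU0 he using hm
  obtain ⟨i₀, hi₀, hmin⟩ := Finset.exists_min_image Dᶜ (fun i => ∑ l, α i l) (by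
    rw [← Finset.card_pos, Finset.card_compl, h.card]; omega)
  have hi₀' : i₀ ∉ D := Finset.mem_compl.1 hi₀
  have hle : ∀ j ∉ D, α i₀ ≤ α j := by
    intro j hj
    have h1 := hmin j (Finset.mem_compl.2 hj)
    have heq : (fun x => lin Φ (B i₀) (τ x) - lin Φ (B j) (τ x)) =ᶠ[𝓝 0]
        fun x => monom (α i₀) x * U i₀ x - monom (α j) x * U j x := by
      filter_upwards [he i₀, he j] with x h1 h2
      rw [h1, h2]
    rcases monom_le_or_le (hU i₀) (hU j) (hU0 i₀) (hU0 j)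
      ((hd i₀ j).imp (fun h => heq.symm.trans h) fun h => h.congr heq.symm) with h2 | h2
    · exact h2
    · intro l
      by_contra! hlt
      exact absurd (Finset.sum_lt_sum (fun k _ => h2 k) ⟨l, Finset.mem_univ l, hlt⟩) (not_lt.2 h1)
  set q : ι → (Fin n → ℝ) → ℝ := fun j x => monom (α j - α i₀) x * (U j x * (U i₀ x)⁻¹) with hq
  have hqa : ∀ j, AnalyticAt ℝ (q j) 0 := fun j =>
    (analyticAt_monom _ 0).mul ((hU j).mul ((hU i₀).inv (hU0 i₀)))
  have hqe : ∀ j ∉ D, ∀ᶠ x in 𝓝 0, lin Φ (B j) (τ x) = lin Φ (B i₀) (τ x) * q j x := by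
    intro j hj
    filter_upwards [he i₀, he j, (hU i₀).continuousAt.eventually_ne (hU0 i₀)] with x h1 h2 h3
    rw [h1, h2]
    simp only [hq]
    have : monom (α j) x = monom (α i₀) x * monom (α j - α i₀) x := by
      rw [← monom_add, add_tsub_cancel_of_le (hle j hj)]
    rw [this]
    field_simp
  set t : ι → ℝ := fun j => if j ∈ insert i₀ D then 0 else q j 0 with ht
  have ht0 : ∀ j ∈ insert i₀ D, t j = 0 := fun j hj => by simp only [ht, if_pos hj]
  have hB' : ∀ j ∈ insert i₀ D, B j - t j • B i₀ = B j := fun j hj => by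
    rw [ht0 j hj, zero_smul, sub_zero]
  refine ⟨fun j => B j - t j • B i₀, insert i₀ D, h.good, h.mono, ?_,
    linearIndependent_sub_smul h.indep (ht0 i₀ (by simp)), ?_, ?_⟩
  · rw [Finset.card_insert_of_notMem hi₀', h.card]
  · intro i hi j hj
    have hjD : j ∉ D := fun h => hj (by simp [h])
    simp only [hB' i hi, lin_sub_smul]
    rcases Finset.mem_insert.1 hi with rfl | hiD
    · refine ⟨fun x => q j x - q j 0, (hqa j).sub analyticAt_const, sub_self _, ?_⟩
      filter_upwards [hqe j hjD] with x hx
      simp only [ht, if_neg hj]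
      rw [hx]; ring
    · exact (h.dom i hiD j hjD).sub_smul (h.dom i hiD i₀ hi₀') _
  · intro i hi j hj hij
    simp only [hB' i hi, hB' j hj]
    rcases Finset.mem_insert.1 hi with rfl | hiD
    · rcases Finset.mem_insert.1 hj with rfl | hjD
      · exact absurd rfl hij
      · exact Or.inr (h.dom j hjD i hi₀')
    · rcases Finset.mem_insert.1 hj with rfl | hjD
      · exact Or.inl (h.dom i hiD j hi₀')
      · exact h.comparable i hiD j hjD hij

theorem nondeg_id : Nondeg (fun x : Fin n → ℝ => x) := fun _ _ h => h

theorem red_elim {Φ : ι → (Fin n → ℝ) → ℝ} (hΦ : ∀ l, AnalyticAt ℝ (Φ l) 0)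
    (hind : ∀ a : ι → ℝ, a ≠ 0 → ¬ lin Φ a =ᶠ[𝓝 0] 0) (k : ℕ) (hk : k ≤ Fintype.card ι) :
    Red (fun τ r => ∃ B D, Elim Φ k τ r B D) (fun x => x) (fun _ => 1) := by
  classical
  induction k with
  | zero =>
    refine .done _ _ ⟨fun i => Pi.single i 1, ∅, good_id, mono_of_ne_zero analyticAt_const one_ne_zero,
      rfl, Pi.linearIndependent_single_one ι ℝ, by simp, by simp⟩
  | succ k ih =>
    refine Red.bind ?_ ((ih (by omega)).nondeg good_id nondeg_id)
    rintro τ r ⟨hn, B, D, h⟩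
    refine Red.mono ?_ (h.refine hΦ hind hn)
    rintro τ r ⟨h, hm, hd⟩
    exact h.extend hk hm hd

/-- In suitable charts, every system of linearly independent analytic germs vanishing at `0` has a
basis of its span consisting of monomials times units, with pairwise distinct exponents. -/
theorem red_basis {Φ : ι → (Fin n → ℝ) → ℝ} (hΦ : ∀ l, AnalyticAt ℝ (Φ l) 0)
    (hΦ0 : ∀ l, Φ l 0 = 0) (hind : ∀ a : ι → ℝ, a ≠ 0 → ¬ lin Φ a =ᶠ[𝓝 0] 0) :
    Red (fun τ r => Good τ r ∧ Mono r ∧ ∃ (B : ι → ι → ℝ) (α : ι → Fin n → ℕ)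
      (U : ι → (Fin n → ℝ) → ℝ), LinearIndependent ℝ B ∧ Function.Injective α ∧ (∀ i, α i ≠ 0) ∧
      ∀ i, AnalyticAt ℝ (U i) 0 ∧ U i 0 ≠ 0 ∧
        (fun x => lin Φ (B i) (τ x)) =ᶠ[𝓝 0] fun x => monom (α i) x * U i x)
      (fun x => x) (fun _ => 1) := by
  refine Red.bind ?_ ((red_elim hΦ hind _ le_rfl).nondeg good_id nondeg_id)
  rintro τ r ⟨hn, B, D, h⟩
  refine Red.mono ?_ (h.refine hΦ hind hn)
  rintro τ r ⟨h, hm, -⟩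
  have hD : D = Finset.univ := (Finset.card_eq_iff_eq_univ D).1 h.card
  choose α U hU hU0 he using hm
  refine ⟨h.good, h.mono, B, α, U, h.indep, fun i j hij => ?_, fun i h0 => hU0 i ?_,
    fun i => ⟨hU i, hU0 i, he i⟩⟩
  · by_contra hne
    rcases h.comparable i (by simp [hD]) j (by simp [hD]) hne with hc | hc
    · exact hc.exponent_ne (hU i) (hU j) (hU0 j) (he i) (he j) hij
    · exact hc.exponent_ne (hU j) (hU i) (hU0 i) (he j) (he i) hij.symm
  · have : lin Φ (B i) (τ 0) = monom (α i) 0 * U i 0 := (he i).self_of_nhds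
    rw [h.good.zero, h0, monom_zero, one_mul] at this
    rw [← this]
    simp [lin, hΦ0]

end Elimination

section VanDerCorput

/-- On `[a, b]`, each `q j` is differentiable with derivative `q (j + 1)`. -/
def DerivSeq (q : ℕ → ℝ → ℝ) (a b : ℝ) : Prop :=
  ∀ j, ∀ s ∈ Set.Icc a b, HasDerivAt (q j) (q (j + 1) s) s

variable {q : ℕ → ℝ → ℝ} {a b μ M : ℝ}

theorem DerivSeq.mono (h : DerivSeq q a b) {c d : ℝ} (hc : a ≤ c) (hd : d ≤ b) :
    DerivSeq q c d := fun j s hs => h j s ⟨hc.trans hs.1, hs.2.trans hd⟩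

theorem DerivSeq.neg (h : DerivSeq q a b) : DerivSeq (fun j s => -q j s) a b :=
  fun j s hs => (h j s hs).neg

theorem DerivSeq.continuousOn (h : DerivSeq q a b) (j : ℕ) : ContinuousOn (q j) (Set.Icc a b) :=
  fun s hs => (h j s hs).continuousAt.continuousWithinAt

theorem DerivSeq.continuousOn_exp (h : DerivSeq q a b) :
    ContinuousOn (fun s => exp (I * q 0 s)) (Set.Icc a b) :=
  (continuous_exp.comp (continuous_const.mul continuous_ofReal)).comp_continuousOn (h.continuousOn 0)

theorem norm_exp_I_mul (t : ℝ) : ‖exp (I * t)‖ = 1 := by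
  rw [mul_comm]; exact norm_exp_ofReal_mul_I t

theorem norm_integral_exp_neg (f : ℝ → ℝ) (a b : ℝ) :
    ‖∫ s in a..b, exp (I * ((-f s : ℝ) : ℂ))‖ = ‖∫ s in a..b, exp (I * f s)‖ := by
  have : ∀ s, exp (I * ((-f s : ℝ) : ℂ)) = (starRingEnd ℂ) (exp (I * f s)) := fun s => by
    rw [← exp_conj]; simp
  simp only [this]
  have h2 : ∀ s t : ℝ, ∫ x in Set.Ioc s t, (starRingEnd ℂ) (exp (I * f x)) =
      (starRingEnd ℂ) (∫ x in Set.Ioc s t, exp (I * f x)) := fun s t => integral_conj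
  rw [intervalIntegral, h2, h2, ← map_sub, RCLike.norm_conj, intervalIntegral]

theorem norm_integral_exp_le (f : ℝ → ℝ) (hab : a ≤ b) :
    ‖∫ s in a..b, exp (I * f s)‖ ≤ b - a := by
  have := intervalIntegral.norm_integral_le_of_norm_le_const (a := a) (b := b)
    (f := fun s => exp (I * f s)) (C := 1) fun s _ => (norm_exp_I_mul _).le
  rwa [one_mul, abs_of_nonneg (sub_nonneg.2 hab)] at this

theorem norm_integral_exp_le_of_deriv (h : DerivSeq q a b) (hab : a ≤ b) (hμ : 0 < μ)
    (h1 : ∀ s ∈ Set.Icc a b, μ ≤ |q 1 s|) :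
    ‖∫ s in a..b, exp (I * q 0 s)‖ ≤ 2 / μ + ∫ s in a..b, |q 2 s| / q 1 s ^ 2 := by
  have hne : ∀ s ∈ Set.Icc a b, (q 1 s : ℂ) ≠ 0 := fun s hs => by
    have := hμ.trans_le (h1 s hs)
    exact_mod_cast abs_pos.1 this
  have hne' : ∀ s ∈ Set.Icc a b, q 1 s ≠ 0 := fun s hs => by exact_mod_cast hne s hs
  have hu : Set.uIcc a b = Set.Icc a b := Set.uIcc_of_le hab
  have hc1 : ContinuousOn (fun s => exp (I * q 0 s)) (Set.uIcc a b) := by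
    rw [hu]; exact h.continuousOn_exp
  have hc2 : ContinuousOn (fun s => exp (I * q 0 s) * (q 2 s / (I * (q 1 s) ^ 2)))
      (Set.uIcc a b) := by
    rw [hu] at hc1 ⊢
    refine hc1.mul (ContinuousOn.div (continuous_ofReal.comp_continuousOn (h.continuousOn 2))
      (continuousOn_const.mul ((continuous_ofReal.comp_continuousOn (h.continuousOn 1)).pow 2)) ?_)
    intro s hs
    exact mul_ne_zero I_ne_zero (pow_ne_zero 2 (hne s hs))
  have hc3 : ContinuousOn (fun s => |q 2 s| / q 1 s ^ 2) (Set.uIcc a b) := by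
    rw [hu]
    exact (h.continuousOn 2).abs.div ((h.continuousOn 1).pow 2) fun s hs => pow_ne_zero 2 (hne' s hs)
  have hd : ∀ s ∈ Set.uIcc a b, HasDerivAt (fun s => exp (I * q 0 s) / (I * q 1 s))
      (exp (I * q 0 s) - exp (I * q 0 s) * (q 2 s / (I * (q 1 s) ^ 2))) s := by
    intro s hs
    rw [hu] at hs
    have e0 := (((h 0 s hs).ofReal_comp).const_mul I).cexp
    have e1 := ((h 1 s hs).ofReal_comp).const_mul I
    convert! e0.div e1 (mul_ne_zero I_ne_zero (hne s hs)) using 1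
    have := hne s hs
    field_simp
  have key := intervalIntegral.integral_eq_sub_of_hasDerivAt hd
    (hc1.intervalIntegrable.sub hc2.intervalIntegrable)
  rw [intervalIntegral.integral_sub hc1.intervalIntegrable hc2.intervalIntegrable,
    sub_eq_iff_eq_add] at key
  rw [key]
  have hend : ∀ s ∈ Set.Icc a b, ‖exp (I * q 0 s) / (I * q 1 s)‖ ≤ 1 / μ := fun s hs => by
    rw [norm_div, norm_exp_I_mul, norm_mul, norm_I, one_mul, norm_real, Real.norm_eq_abs]
    exact one_div_le_one_div_of_le hμ (h1 s hs)
  refine (norm_add_le _ _).trans (add_le_add ((norm_sub_le _ _).trans ?_) ?_)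
  · have e1 := hend b ⟨hab, le_rfl⟩
    have e2 := hend a ⟨le_rfl, hab⟩
    have : 2 / μ = 1 / μ + 1 / μ := by ring
    rw [this]; exact add_le_add e1 e2
  · refine intervalIntegral.norm_integral_le_of_norm_le hab (Eventually.of_forall fun s _ => ?_)
      hc3.intervalIntegrable
    rw [norm_mul, norm_exp_I_mul, one_mul, norm_div, norm_mul, norm_I, one_mul, norm_pow, norm_real,
      norm_real, Real.norm_eq_abs, Real.norm_eq_abs, sq_abs]

theorem integral_deriv_div_sq (h : DerivSeq q a b) (hab : a ≤ b)
    (h1 : ∀ s ∈ Set.Icc a b, q 1 s ≠ 0) :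
    ∫ s in a..b, q 2 s / q 1 s ^ 2 = (q 1 a)⁻¹ - (q 1 b)⁻¹ := by
  have hu : Set.uIcc a b = Set.Icc a b := Set.uIcc_of_le hab
  have := intervalIntegral.integral_eq_sub_of_hasDerivAt (a := a) (b := b)
    (f := fun s => -(q 1 s)⁻¹) (f' := fun s => q 2 s / q 1 s ^ 2) ?_ ?_
  · rw [this]; ring
  · intro s hs
    rw [hu] at hs
    convert! ((h 1 s hs).inv (h1 s hs)).neg using 1
    ring
  · refine ContinuousOn.intervalIntegrable ?_
    rw [hu]
    exact (h.continuousOn 2).div ((h.continuousOn 1).pow 2) fun s hs => pow_ne_zero 2 (h1 s hs)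

theorem norm_integral_exp_le_of_monotone (h : DerivSeq q a b) (hab : a ≤ b) (hμ : 0 < μ)
    (h1 : ∀ s ∈ Set.Icc a b, μ ≤ |q 1 s|)
    (h2 : (∀ s ∈ Set.Icc a b, 0 ≤ q 2 s) ∨ ∀ s ∈ Set.Icc a b, q 2 s ≤ 0) :
    ‖∫ s in a..b, exp (I * q 0 s)‖ ≤ 4 / μ := by
  have hne : ∀ s ∈ Set.Icc a b, q 1 s ≠ 0 := fun s hs => abs_pos.1 (hμ.trans_le (h1 s hs))
  refine (norm_integral_exp_le_of_deriv h hab hμ h1).trans ?_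
  have hend : ∀ s ∈ Set.Icc a b, |(q 1 s)⁻¹| ≤ 1 / μ := fun s hs => by
    rw [abs_inv, ← one_div]; exact one_div_le_one_div_of_le hμ (h1 s hs)
  have ha := abs_le.1 (hend a ⟨le_rfl, hab⟩)
  have hb := abs_le.1 (hend b ⟨hab, le_rfl⟩)
  have hI := integral_deriv_div_sq h hab hne
  have e : (4 : ℝ) / μ = 2 / μ + (1 / μ + 1 / μ) := by ring
  rw [e]
  refine add_le_add le_rfl ?_
  have hu : Set.uIcc a b = Set.Icc a b := Set.uIcc_of_le hab
  rcases h2 with h2 | h2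
  · rw [intervalIntegral.integral_congr (g := fun s => q 2 s / q 1 s ^ 2)
      fun s hs => by simp only; rw [abs_of_nonneg (h2 s (hu ▸ hs))], hI]
    linarith [ha.2, hb.1]
  · rw [intervalIntegral.integral_congr (g := fun s => -(q 2 s / q 1 s ^ 2))
      fun s hs => by simp only; rw [abs_of_nonpos (h2 s (hu ▸ hs)), neg_div],
      intervalIntegral.integral_neg, hI]
    linarith [ha.1, hb.2]

theorem norm_integral_exp_le_of_bound (h : DerivSeq q a b) (hab : a ≤ b) (hμ : 0 < μ)
    (h1 : ∀ s ∈ Set.Icc a b, μ ≤ |q 1 s|) (h2 : ∀ s ∈ Set.Icc a b, |q 2 s| ≤ M) :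
    ‖∫ s in a..b, exp (I * q 0 s)‖ ≤ 2 / μ + M / μ ^ 2 * (b - a) := by
  refine (norm_integral_exp_le_of_deriv h hab hμ h1).trans (add_le_add le_rfl ?_)
  have := intervalIntegral.norm_integral_le_of_norm_le_const (a := a) (b := b)
    (f := fun s => |q 2 s| / q 1 s ^ 2) (C := M / μ ^ 2) fun s hs => by
      rw [Set.uIoc_of_le hab] at hs
      have hs' := Set.Ioc_subset_Icc_self hs
      rw [Real.norm_eq_abs, abs_of_nonneg (by positivity), ← sq_abs (q 1 s)]
      have := h1 s hs'
      have := h2 s hs'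
      have : 0 ≤ M := (abs_nonneg _).trans this
      gcongr
  rw [abs_of_nonneg (sub_nonneg.2 hab)] at this
  exact (le_abs_self _).trans this

theorem exists_center (h : DerivSeq q a b) (hab : a ≤ b) (k : ℕ)
    (hk : ∀ s ∈ Set.Icc a b, μ ≤ q (k + 1) s) :
    ∃ c ∈ Set.Icc a b, (∀ s ∈ Set.Icc a b, c < s → μ * (s - c) ≤ q k s) ∧
      ∀ s ∈ Set.Icc a b, s < c → q k s ≤ μ * (s - c) := by
  have hgrow : ∀ s ∈ Set.Icc a b, ∀ t ∈ Set.Icc a b, s ≤ t → μ * (t - s) ≤ q k t - q k s := by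
    intro s hs t ht hst
    refine Convex.mul_sub_le_image_sub_of_le_deriv (convex_Icc a b) (h.continuousOn k)
      (fun x hx => (h k x (interior_subset hx)).differentiableAt.differentiableWithinAt)
      (fun x hx => ?_) s hs t ht hst
    rw [(h k x (interior_subset hx)).deriv]
    exact hk x (interior_subset hx)
  by_cases ha : 0 ≤ q k a
  · refine ⟨a, ⟨le_rfl, hab⟩, fun s hs _ => ?_, fun s hs h => absurd hs.1 (not_le.2 h)⟩
    linarith [hgrow a ⟨le_rfl, hab⟩ s hs hs.1]
  by_cases hb : q k b ≤ 0
  · refine ⟨b, ⟨hab, le_rfl⟩, fun s hs h => absurd hs.2 (not_le.2 h), fun s hs _ => ?_⟩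
    linarith [hgrow s hs b ⟨hab, le_rfl⟩ hs.2]
  obtain ⟨c, hc, h0⟩ := intermediate_value_Icc hab (h.continuousOn k)
    ⟨(not_le.1 ha).le, (not_le.1 hb).le⟩
  refine ⟨c, hc, fun s hs hcs => ?_, fun s hs hsc => ?_⟩
  · linarith [hgrow c hc s hs hcs.le]
  · linarith [hgrow s hs c hc hsc.le]

theorem integral_split (f : ℝ → ℂ) (hf : ContinuousOn f (Set.Icc a b)) {c : ℝ}
    (hc : c ∈ Set.Icc a b) : ∫ s in a..b, f s = (∫ s in a..c, f s) + ∫ s in c..b, f s := by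
  refine (intervalIntegral.integral_add_adjacent_intervals ?_ ?_).symm
  · refine (hf.mono ?_).intervalIntegrable
    rw [Set.uIcc_of_le hc.1]; exact Set.Icc_subset_Icc le_rfl hc.2
  · refine (hf.mono ?_).intervalIntegrable
    rw [Set.uIcc_of_le hc.2]; exact Set.Icc_subset_Icc hc.1 le_rfl

theorem van_der_corput (k : ℕ) : ∃ C : ℝ, 0 < C ∧ ∀ (q : ℕ → ℝ → ℝ) (a b μ : ℝ), a ≤ b →
    0 < μ → DerivSeq q a b → (∀ s ∈ Set.Icc a b, μ ≤ q (k + 1) s) →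
    (k = 0 → (∀ s ∈ Set.Icc a b, 0 ≤ q 2 s) ∨ ∀ s ∈ Set.Icc a b, q 2 s ≤ 0) →
    ‖∫ s in a..b, exp (I * q 0 s)‖ ≤ C * μ ^ (-(1 : ℝ) / (k + 1)) := by
  induction k with
  | zero =>
    refine ⟨4, by norm_num, fun q a b μ hab hμ hq h1 h2 => ?_⟩
    have := norm_integral_exp_le_of_monotone hq hab hμ (fun s hs => (h1 s hs).trans (le_abs_self _))
      (h2 rfl)
    simpa [Real.rpow_neg_one, div_eq_mul_inv] using this
  | succ k ih =>
    obtain ⟨C, hC, ih⟩ := ih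
    refine ⟨2 * C + 2, by positivity, fun q a b μ hab hμ hq h1 _ => ?_⟩
    set d : ℝ := μ ^ (-(1 : ℝ) / ((k + 1 : ℕ) + 1)) with hd
    have hd0 : 0 < d := by positivity
    obtain ⟨c, hc, hc1, hc2⟩ := exists_center hq hab (k + 1) h1
    have hμd : (μ * d) ^ (-(1 : ℝ) / (k + 1)) = d := by
      have h2 : μ * d = μ ^ (1 + -(1 : ℝ) / ((k + 1 : ℕ) + 1)) := by
        rw [Real.rpow_add hμ, Real.rpow_one]
      rw [h2, ← Real.rpow_mul hμ.le, hd]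
      congr 1
      push_cast
      field_simp
      ring
    have hside : ∀ (q : ℕ → ℝ → ℝ) (s t : ℝ), s ≤ t → DerivSeq q s t →
        (∀ x ∈ Set.Icc s t, μ * d ≤ q (k + 1) x) →
        ((∀ x ∈ Set.Icc s t, 0 ≤ q (k + 2) x) ∨ ∀ x ∈ Set.Icc s t, q (k + 2) x ≤ 0) →
        ‖∫ x in s..t, exp (I * q 0 x)‖ ≤ C * d := by
      intro q s t hst hq h1 h2
      have := ih q s t (μ * d) hst (by positivity) hq h1 (by rintro rfl; exact h2)
      rwa [hμd] at this
    set p := max a (c - d) with hp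
    set r := min b (c + d) with hr
    have hap : a ≤ p := le_max_left _ _
    have hpc : p ≤ c := max_le hc.1 (by linarith)
    have hcr : c ≤ r := le_min hc.2 (by linarith)
    have hrb : r ≤ b := min_le_left _ _
    have hpr : p ≤ r := hpc.trans hcr
    have hcont := hq.continuousOn_exp
    rw [integral_split _ hcont ⟨hap, hpc.trans hc.2⟩,
      integral_split _ (hcont.mono (Set.Icc_subset_Icc hap le_rfl))
        ⟨hpr, hrb⟩]
    have b1 : ‖∫ s in a..p, exp (I * q 0 s)‖ ≤ C * d := by
      rcases le_total a (c - d) with h | h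
      · have hpe : p = c - d := max_eq_right h
        rw [← norm_integral_exp_neg]
        have hpb : p ≤ b := hpr.trans hrb
        refine hside (fun j s => -q j s) a p hap (hq.mono le_rfl hpb).neg (fun x hx => ?_)
          (Or.inr fun x hx => ?_)
        · have h3 := hc2 x ⟨hx.1, hx.2.trans hpb⟩ (by linarith [hx.2])
          have : μ * d ≤ μ * (c - x) := by gcongr; linarith [hx.2]
          linarith
        · have h3 := h1 x ⟨hx.1, hx.2.trans hpb⟩
          simp only [Left.neg_nonpos_iff]; exact hμ.le.trans h3
      · rw [show p = a from max_eq_left h]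
        simp only [intervalIntegral.integral_same, norm_zero]; positivity
    have b2 : ‖∫ s in p..r, exp (I * q 0 s)‖ ≤ 2 * d := by
      refine (norm_integral_exp_le _ hpr).trans ?_
      have : c - d ≤ p := le_max_right _ _
      have : r ≤ c + d := min_le_right _ _
      linarith
    have b3 : ‖∫ s in r..b, exp (I * q 0 s)‖ ≤ C * d := by
      rcases le_total b (c + d) with h | h
      · rw [show r = b from min_eq_left h]
        simp only [intervalIntegral.integral_same, norm_zero]; positivity
      · have hre : r = c + d := min_eq_right h
        have har : a ≤ r := hap.trans hpr
        refine hside q r b hrb (hq.mono har le_rfl) (fun x hx => ?_) (Or.inl fun x hx => ?_)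
        · have h3 := hc1 x ⟨har.trans hx.1, hx.2⟩ (by linarith [hx.1])
          have : μ * d ≤ μ * (x - c) := by gcongr; linarith [hx.1]
          linarith
        · exact hμ.le.trans (h1 x ⟨har.trans hx.1, hx.2⟩)
    refine (norm_add_le _ _).trans ((add_le_add b1 ((norm_add_le _ _).trans
      (add_le_add b2 b3))).trans (le_of_eq ?_))
    ring

end VanDerCorput

section Oscillatory

variable {q : ℕ → ℝ → ℝ} {a b : ℝ}

theorem rpow_neg_le_of_le {Λ : ℝ} (hΛ : 1 ≤ Λ) {k m : ℕ} (hkm : k ≤ m) :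
    Λ ^ (-(1 : ℝ) / (k + 1)) ≤ Λ ^ (-(1 : ℝ) / (m + 1)) := by
  refine Real.rpow_le_rpow_of_exponent_le hΛ ?_
  rw [neg_div, neg_div, neg_le_neg_iff]
  have : (k : ℝ) ≤ m := by exact_mod_cast hkm
  gcongr

theorem norm_integral_exp_le_short (m : ℕ) {c₀ C₀ : ℝ} (hc₀ : 0 < c₀) (hC₀ : 0 < C₀) :
    ∃ C : ℝ, 0 < C ∧ ∀ (q : ℕ → ℝ → ℝ) (a b Λ : ℝ), a ≤ b → b - a ≤ 1 →
      C₀ * (b - a) ≤ c₀ / 2 → 1 ≤ Λ → DerivSeq q a b →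
      (∃ j ≤ m, c₀ * Λ ≤ |q (j + 1) a|) →
      (∀ j ≤ m, ∀ s ∈ Set.Icc a b, |q (j + 2) s| ≤ C₀ * Λ) →
      ‖∫ s in a..b, exp (I * q 0 s)‖ ≤ C * Λ ^ (-(1 : ℝ) / (m + 1)) := by
  choose D hD hvdc using van_der_corput
  set A : ℝ := 2 / (c₀ / 2) + C₀ / (c₀ / 2) ^ 2 with hA
  have hA0 : 0 < A := by positivity
  have hS : ∀ k ∈ Finset.range (m + 1), 0 ≤ D k * (c₀ / 2) ^ (-(1 : ℝ) / (k + 1)) := fun k _ => by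
    have := hD k; positivity
  refine ⟨A + ∑ k ∈ Finset.range (m + 1), D k * (c₀ / 2) ^ (-(1 : ℝ) / (k + 1)),
    add_pos_of_pos_of_nonneg hA0 (Finset.sum_nonneg hS), ?_⟩
  intro q a b Λ hab hab1 hsmall hΛ hq ⟨j, hj, hja⟩ hup
  have hΛ0 : 0 < Λ := by linarith
  set μ : ℝ := c₀ / 2 * Λ with hμ
  have hμ0 : 0 < μ := by positivity
  have hvar : ∀ s ∈ Set.Icc a b, |q (j + 1) s - q (j + 1) a| ≤ μ := by
    intro s hs
    have := (convex_Icc a b).norm_image_sub_le_of_norm_hasDerivWithin_le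
      (f := q (j + 1)) (f' := q (j + 2)) (C := C₀ * Λ)
      (fun x hx => (hq (j + 1) x hx).hasDerivWithinAt) (fun x hx => hup j hj x hx)
      ⟨le_rfl, hab⟩ hs
    rw [Real.norm_eq_abs, Real.norm_eq_abs, abs_of_nonneg (sub_nonneg.2 hs.1)] at this
    refine this.trans ?_
    have h1 : s - a ≤ b - a := by linarith [hs.2]
    calc C₀ * Λ * (s - a) ≤ C₀ * Λ * (b - a) := by gcongr
      _ = C₀ * (b - a) * Λ := by ring
      _ ≤ c₀ / 2 * Λ := by gcongr
  have hfin : ∀ k ≤ m, k = 0 ∨ D k * μ ^ (-(1 : ℝ) / (k + 1)) ≤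
      (A + ∑ k ∈ Finset.range (m + 1), D k * (c₀ / 2) ^ (-(1 : ℝ) / (k + 1))) *
        Λ ^ (-(1 : ℝ) / (m + 1)) := by
    intro k hk
    right
    rw [hμ, Real.mul_rpow (by positivity) hΛ0.le, ← mul_assoc]
    have h1 := Finset.single_le_sum hS (Finset.mem_range.2 (Nat.lt_succ_of_le hk))
    have h2 := hD k
    refine mul_le_mul (by linarith) (rpow_neg_le_of_le hΛ hk) (by positivity) ?_
    exact add_nonneg hA0.le (Finset.sum_nonneg hS)
  rcases Nat.eq_zero_or_pos j with rfl | hj0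
  · have h1 : ∀ s ∈ Set.Icc a b, μ ≤ |q 1 s| := fun s hs => by
      have h2 := hvar s hs
      have h3 := abs_sub_abs_le_abs_sub (q 1 a) (q 1 s)
      rw [abs_sub_comm] at h3
      simp only [zero_add] at h2 hja
      have : c₀ * Λ = 2 * μ := by rw [hμ]; ring
      linarith
    refine (norm_integral_exp_le_of_bound hq hab hμ0 h1 (hup 0 (Nat.zero_le _))).trans ?_
    have h4 : 2 / μ + C₀ * Λ / μ ^ 2 * (b - a) ≤ A * Λ⁻¹ := by
      have : 2 / μ + C₀ * Λ / μ ^ 2 * (b - a) ≤ 2 / μ + C₀ * Λ / μ ^ 2 * 1 := by gcongr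
      refine this.trans (le_of_eq ?_)
      rw [hA, hμ]; field_simp
    refine h4.trans (mul_le_mul (le_add_of_nonneg_right (Finset.sum_nonneg hS)) ?_ (by positivity)
      (add_nonneg hA0.le (Finset.sum_nonneg hS)))
    rw [← Real.rpow_neg_one]
    simpa using rpow_neg_le_of_le hΛ (Nat.zero_le m)
  · refine le_trans ?_ ((hfin j hj).resolve_left hj0.ne')
    rcases le_total 0 (q (j + 1) a) with hs | hs
    · refine hvdc j q a b μ hab hμ0 hq (fun s hs' => ?_) (fun h => absurd h hj0.ne')
      have h2 := (abs_le.1 (hvar s hs')).1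
      rw [abs_of_nonneg hs] at hja
      have : c₀ * Λ = 2 * μ := by rw [hμ]; ring
      linarith
    · rw [← norm_integral_exp_neg]
      refine hvdc j (fun j s => -q j s) a b μ hab hμ0 hq.neg (fun s hs' => ?_)
        (fun h => absurd h hj0.ne')
      have h2 := (abs_le.1 (hvar s hs')).2
      rw [abs_of_nonpos hs] at hja
      have : c₀ * Λ = 2 * μ := by rw [hμ]; ring
      linarith

theorem norm_integral_amplitude_le (h : DerivSeq q a b) (hab : a ≤ b) (hab1 : b - a ≤ 1)
    {A A' : ℝ → ℝ} (hA : ∀ s ∈ Set.Icc a b, HasDerivAt A (A' s) s)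
    (hA' : ContinuousOn A' (Set.Icc a b)) {K R : ℝ} (hK : ∀ s ∈ Set.Icc a b, |A s| ≤ K)
    (hK' : ∀ s ∈ Set.Icc a b, |A' s| ≤ K)
    (hR : ∀ t ∈ Set.Icc a b, ‖∫ s in a..t, exp (I * q 0 s)‖ ≤ R) :
    ‖∫ s in a..b, A s * exp (I * q 0 s)‖ ≤ 2 * K * R := by
  have hu : Set.uIcc a b = Set.Icc a b := Set.uIcc_of_le hab
  have hK0 : 0 ≤ K := (abs_nonneg _).trans (hK a ⟨le_rfl, hab⟩)
  have hR0 : 0 ≤ R := (norm_nonneg _).trans (hR a ⟨le_rfl, hab⟩)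
  set E : ℝ → ℂ := Set.IccExtend hab ((Set.Icc a b).domRestrict fun s => exp (I * q 0 s)) with hE
  have hEc : Continuous E := (continuousOn_iff_continuous_domRestrict.1 h.continuousOn_exp).Icc_extend'
  have hEe : ∀ s ∈ Set.Icc a b, E s = exp (I * q 0 s) := fun s hs => by
    rw [hE, Set.IccExtend_of_mem _ _ hs]; rfl
  have hv : ∀ t, HasDerivAt (fun t => ∫ s in a..t, E s) (E t) t := fun t =>
    (hEc.integral_hasStrictDerivAt a t).hasDerivAt
  have hvR : ∀ t ∈ Set.Icc a b, ‖∫ s in a..t, E s‖ ≤ R := fun t ht => by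
    rw [intervalIntegral.integral_congr (g := fun s => exp (I * q 0 s))]
    · exact hR t ht
    · intro s hs
      rw [Set.uIcc_of_le ht.1] at hs
      exact hEe s ⟨hs.1, hs.2.trans ht.2⟩
  have hcA' : ContinuousOn (fun s => (A' s : ℂ)) (Set.uIcc a b) := by
    rw [hu]; exact continuous_ofReal.comp_continuousOn hA'
  have hparts := intervalIntegral.integral_mul_deriv_eq_deriv_mul (a := a) (b := b)
    (u := fun s => (A s : ℂ)) (u' := fun s => (A' s : ℂ)) (v := fun t => ∫ s in a..t, E s) (v' := E)
    (fun s hs => (hA s (hu ▸ hs)).ofReal_comp) (fun s _ => hv s) hcA'.intervalIntegrable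
    (hEc.intervalIntegrable _ _)
  have hcongr : ∫ s in a..b, A s * exp (I * q 0 s) = ∫ s in a..b, A s * E s :=
    intervalIntegral.integral_congr fun s hs => by
      show _ = (A s : ℂ) * E s
      rw [hEe s (hu ▸ hs)]
  rw [hcongr, hparts]
  simp only [intervalIntegral.integral_same, mul_zero, sub_zero]
  have h1 : ‖(A b : ℂ) * ∫ s in a..b, E s‖ ≤ K * R := by
    rw [norm_mul, norm_real, Real.norm_eq_abs]
    exact mul_le_mul (hK b ⟨hab, le_rfl⟩) (hvR b ⟨hab, le_rfl⟩) (norm_nonneg _) hK0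
  have h2 : ‖∫ t in a..b, (A' t : ℂ) * ∫ s in a..t, E s‖ ≤ K * R * |b - a| := by
    refine intervalIntegral.norm_integral_le_of_norm_le_const fun t ht => ?_
    rw [Set.uIoc_of_le hab] at ht
    have ht' := Set.Ioc_subset_Icc_self ht
    rw [norm_mul, norm_real, Real.norm_eq_abs]
    exact mul_le_mul (hK' t ht') (hvR t ht') (norm_nonneg _) hK0
  rw [abs_of_nonneg (sub_nonneg.2 hab)] at h2
  have h3 : K * R * (b - a) ≤ K * R * 1 := by gcongr
  refine (norm_sub_le _ _).trans ?_
  linarith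

theorem oscillatory_bound (m : ℕ) {c₀ C₀ : ℝ} (hc₀ : 0 < c₀) (hC₀ : 0 < C₀) :
    ∃ C : ℝ, 0 < C ∧ ∀ (q : ℕ → ℝ → ℝ) (A A' : ℝ → ℝ) (Λ K : ℝ), 0 ≤ Λ → DerivSeq q 0 1 →
      (∀ s ∈ Set.Icc (0 : ℝ) 1, ∃ j ≤ m, c₀ * Λ ≤ |q (j + 1) s|) →
      (∀ j ≤ m, ∀ s ∈ Set.Icc (0 : ℝ) 1, |q (j + 2) s| ≤ C₀ * Λ) →
      (∀ s ∈ Set.Icc (0 : ℝ) 1, HasDerivAt A (A' s) s) → ContinuousOn A' (Set.Icc 0 1) →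
      (∀ s ∈ Set.Icc (0 : ℝ) 1, |A s| ≤ K) → (∀ s ∈ Set.Icc (0 : ℝ) 1, |A' s| ≤ K) →
      ‖∫ s in (0 : ℝ)..1, A s * exp (I * q 0 s)‖ ≤
        C * K * (1 + Λ) ^ (-(1 : ℝ) / (m + 1)) := by
  obtain ⟨D, hD, hshort⟩ := norm_integral_exp_le_short m hc₀ hC₀
  obtain ⟨N, hN⟩ := exists_nat_gt (2 * C₀ / c₀)
  have hN0 : (0 : ℝ) < N := lt_trans (by positivity) hN
  set δ : ℝ := -(1 : ℝ) / (m + 1) with hδ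
  have hδ0 : δ ≤ 0 := div_nonpos_of_nonpos_of_nonneg (by norm_num) (by positivity)
  have hcmp : ∀ Λ : ℝ, 0 ≤ Λ → ∀ t : ℝ, 0 < t → 1 + Λ ≤ 2 * t → t ^ δ ≤ 2 ^ (-δ) * (1 + Λ) ^ δ := by
    intro Λ hΛ t ht h
    have h1 : (2 * t) ^ δ ≤ (1 + Λ) ^ δ :=
      Real.rpow_le_rpow_of_nonpos (by linarith) h hδ0
    rw [Real.mul_rpow two_pos.le ht.le] at h1
    calc t ^ δ = 2 ^ (-δ) * (2 ^ δ * t ^ δ) := by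
          rw [← mul_assoc, ← Real.rpow_add two_pos]; simp
      _ ≤ _ := by gcongr
  refine ⟨(N * (2 * D) + 1) * 2 ^ (-δ), by positivity, ?_⟩
  intro q A A' Λ K hΛ hq hlow hup hA hA' hK hK'
  have hK0 : 0 ≤ K := (abs_nonneg _).trans (hK 0 (by simp))
  have htriv : ‖∫ s in (0 : ℝ)..1, A s * exp (I * q 0 s)‖ ≤ K := by
    have := intervalIntegral.norm_integral_le_of_norm_le_const (a := (0 : ℝ)) (b := 1)
      (f := fun s => A s * exp (I * q 0 s)) (C := K) fun s hs => by
        rw [Set.uIoc_of_le zero_le_one] at hs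
        rw [norm_mul, norm_exp_I_mul, mul_one, norm_real]
        exact hK s (Set.Ioc_subset_Icc_self hs)
    simpa using this
  rcases lt_or_ge Λ 1 with hΛ1 | hΛ1
  · have h1 := hcmp Λ hΛ 1 one_pos (by linarith)
    rw [Real.one_rpow] at h1
    calc _ ≤ K := htriv
      _ ≤ K * ((N * (2 * D) + 1) * (2 ^ (-δ) * (1 + Λ) ^ δ)) := by
          refine le_mul_of_one_le_right hK0 (one_le_mul_of_one_le_of_one_le ?_ h1)
          nlinarith [mul_nonneg hN0.le hD.le]
      _ = _ := by ring
  have hpt : ∀ k ≤ N, ((k : ℝ) / N) ∈ Set.Icc (0 : ℝ) 1 := fun k hk =>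
    ⟨by positivity, (div_le_one hN0).2 (by exact_mod_cast hk)⟩
  have hcont : ContinuousOn (fun s => A s * exp (I * q 0 s)) (Set.Icc 0 1) :=
    (continuous_ofReal.comp_continuousOn fun s hs =>
      (hA s hs).continuousAt.continuousWithinAt).mul hq.continuousOn_exp
  have hsum := intervalIntegral.sum_integral_adjacent_intervals (n := N)
    (f := fun s => A s * exp (I * q 0 s)) (a := fun k : ℕ => (k : ℝ) / N) (μ := volume) (fun k hk => by
      refine (hcont.mono ?_).intervalIntegrable
      exact Set.uIcc_subset_Icc (hpt k hk.le) (hpt (k + 1) hk))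
  simp only [Nat.cast_zero, zero_div, div_self hN0.ne'] at hsum
  rw [← hsum]
  have hterm : ∀ k ∈ Finset.range N,
      ‖∫ s in ((k : ℝ) / N)..(((k + 1 : ℕ) : ℝ) / N), A s * exp (I * q 0 s)‖ ≤
        2 * K * (D * Λ ^ (-(1 : ℝ) / (m + 1))) := by
    intro k hk
    have hk := Finset.mem_range.1 hk
    have h0 := hpt k hk.le
    have h1 := hpt (k + 1) hk
    have hle : (k : ℝ) / N ≤ ((k + 1 : ℕ) : ℝ) / N := by gcongr; simp
    have hlen : ((k + 1 : ℕ) : ℝ) / N - (k : ℝ) / N = 1 / N := by push_cast; ring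
    have hsub : Set.Icc ((k : ℝ) / N) (((k + 1 : ℕ) : ℝ) / N) ⊆ Set.Icc 0 1 :=
      Set.Icc_subset_Icc h0.1 h1.2
    have hN1 : 1 / (N : ℝ) ≤ 1 := by
      rw [div_le_one hN0]
      have : 0 < N := by exact_mod_cast hN0
      exact_mod_cast this
    refine norm_integral_amplitude_le (hq.mono h0.1 h1.2) hle (by rw [hlen]; exact hN1)
      (fun s hs => hA s (hsub hs)) (hA'.mono hsub) (fun s hs => hK s (hsub hs))
      (fun s hs => hK' s (hsub hs)) fun t ht => ?_
    have hsub' : Set.Icc ((k : ℝ) / N) t ⊆ Set.Icc 0 1 :=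
      (Set.Icc_subset_Icc le_rfl ht.2).trans hsub
    have hlen' : t - (k : ℝ) / N ≤ 1 / N := by rw [← hlen]; linarith [ht.2]
    refine hshort q _ t Λ ht.1 (hlen'.trans hN1) ?_ hΛ1 (hq.mono h0.1 (ht.2.trans h1.2))
      (hlow _ h0) (fun j hj s hs => hup j hj s (hsub' hs))
    calc C₀ * (t - (k : ℝ) / N) ≤ C₀ * (1 / N) := by gcongr
      _ ≤ c₀ / 2 := by
        rw [div_lt_iff₀ hc₀] at hN
        rw [mul_one_div, div_le_div_iff₀ hN0 two_pos]; linarith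
  refine (norm_sum_le_of_le _ hterm).trans ?_
  rw [Finset.sum_const, Finset.card_range, nsmul_eq_mul]
  have h1 := hcmp Λ hΛ Λ (by linarith) (by linarith)
  have h2 : 0 ≤ K * Λ ^ δ := by positivity
  calc (N : ℝ) * (2 * K * (D * Λ ^ δ)) ≤ (N * (2 * D) + 1) * (K * Λ ^ δ) := by nlinarith
    _ ≤ (N * (2 * D) + 1) * (K * (2 ^ (-δ) * (1 + Λ) ^ δ)) := by gcongr
    _ = _ := by ring

end Oscillatory

section ChangeOfVariables

variable {n : ℕ}

theorem lintegral_affine {a : ℝ} (ha : a ≠ 0) (c : ℝ) {F : ℝ → ENNReal} (hF : Measurable F) :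
    ∫⁻ t, F (a * t + c) * ‖a‖ₑ = ∫⁻ t, F t := by
  have hm : Measurable fun t : ℝ => a * t := measurable_const_mul a
  have hF' : Measurable fun t => F (t + c) := hF.comp (measurable_add_const c)
  have hm2 : Measurable fun t => F (a * t + c) := hF'.comp hm
  rw [lintegral_mul_const _ hm2, ← lintegral_map (f := fun t => F (t + c)) hF' hm,
    Real.map_volume_mul_left ha, lintegral_smul_measure, lintegral_add_right_eq_self (μ := volume) F c,
    Real.enorm_eq_ofReal_abs, smul_eq_mul, mul_comm, ← mul_assoc,
    ← ENNReal.ofReal_mul (abs_nonneg a), ← abs_mul, mul_inv_cancel₀ ha]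
  simp

theorem lintegral_even {F : ℝ → ENNReal} (hF : ∀ t, F (-t) = F t) :
    ∫⁻ t, F t = 2 * ∫⁻ t in Set.Ioi 0, F t := by
  have h1 : ∫⁻ t in Set.Iio 0, F t = ∫⁻ t in Set.Ioi 0, F t := by
    have := lintegral_image_eq_lintegral_abs_deriv_mul (s := Set.Ioi (0 : ℝ)) (f := fun t => -t)
      (f' := fun _ => -1) measurableSet_Ioi (fun x _ => (hasDerivAt_neg x).hasDerivWithinAt)
      neg_injective.injOn F
    simpa [hF] using this
  rw [← setLIntegral_univ, ← Set.Iic_union_Ioi (a := (0 : ℝ)),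
    lintegral_union measurableSet_Ioi (Set.Iic_disjoint_Ioi le_rfl), setLIntegral_congr Iio_ae_eq_Iic.symm,
    h1, two_mul]

theorem lintegral_pow {N : ℕ} (hN : 0 < N) (hN2 : Even N) {ε : ℝ} (hε : ε = 1 ∨ ε = -1)
    (F : ℝ → ENNReal) :
    N * ∫⁻ t, F (ε * t ^ N) * ‖t ^ (N - 1)‖ₑ = 2 * ∫⁻ t in (fun t => ε * t) '' Set.Ioi 0, F t := by
  have hε0 : ε ≠ 0 := by rcases hε with rfl | rfl <;> norm_num
  have hεa : |ε| = 1 := by rcases hε with rfl | rfl <;> norm_num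
  rw [lintegral_even fun t => by rw [hN2.neg_pow]; simp only [enorm_pow, enorm_neg], mul_left_comm]
  congr 1
  have himg : (fun t : ℝ => ε * t) '' Set.Ioi 0 = (fun t : ℝ => ε * t ^ N) '' Set.Ioi 0 := by
    ext y; constructor
    · rintro ⟨t, ht, rfl⟩
      refine ⟨t ^ ((N : ℝ)⁻¹), Real.rpow_pos_of_pos ht _, ?_⟩
      simp only [Real.rpow_inv_natCast_pow (le_of_lt ht) hN.ne']
    · rintro ⟨t, ht, rfl⟩
      exact ⟨t ^ N, Set.mem_Ioi.2 (pow_pos ht N), rfl⟩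
  rw [himg, lintegral_image_eq_lintegral_abs_deriv_mul (f' := fun t => ε * (N * t ^ (N - 1)))
    measurableSet_Ioi (fun x _ => ((hasDerivAt_pow N x).const_mul ε).hasDerivWithinAt),
    ← lintegral_const_mul']
  · refine lintegral_congr fun t => ?_
    rw [abs_mul, hεa, one_mul, abs_mul, Nat.abs_cast, ENNReal.ofReal_mul (by positivity),
      ENNReal.ofReal_natCast, ← Real.enorm_eq_ofReal_abs]
    ring
  · simp
  · intro s hs t ht h
    exact (pow_left_inj₀ (le_of_lt hs) (le_of_lt ht) hN.ne').1 (mul_left_cancel₀ hε0 h)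

theorem lintegral_pow_add {N : ℕ} (hN : 0 < N) (hN2 : Even N) (F : ℝ → ENNReal) :
    N * ((∫⁻ t, F (1 * t ^ N) * ‖t ^ (N - 1)‖ₑ) + ∫⁻ t, F (-1 * t ^ N) * ‖t ^ (N - 1)‖ₑ) =
      2 * ∫⁻ t, F t := by
  rw [mul_add, lintegral_pow hN hN2 (Or.inl rfl), lintegral_pow hN hN2 (Or.inr rfl), ← mul_add]
  congr 1
  have h1 : (fun t : ℝ => 1 * t) '' Set.Ioi 0 = Set.Ioi 0 := by simp
  have h2 : (fun t : ℝ => -1 * t) '' Set.Ioi 0 = Set.Iio 0 := by simp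
  rw [h1, h2, add_comm, setLIntegral_congr Iio_ae_eq_Iic,
    ← lintegral_union measurableSet_Ioi (Set.Iic_disjoint_Ioi le_rfl), Set.Iic_union_Ioi,
    setLIntegral_univ]

theorem lintegral_le_of_update {F G : (Fin n → ℝ) → ENNReal} (hF : Measurable F) (hG : Measurable G)
    (i : Fin n) (h : ∀ x, ∫⁻ t, F (Function.update x i t) ≤ ∫⁻ t, G (Function.update x i t)) :
    ∫⁻ x, F x ≤ ∫⁻ x, G x := by
  refine lintegral_le_of_lmarginal_le (μ := fun _ => volume) {i} hF hG fun x => ?_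
  simpa only [lmarginal_singleton] using h x

theorem lintegral_eq_of_update {F G : (Fin n → ℝ) → ENNReal} (hF : Measurable F) (hG : Measurable G)
    (i : Fin n) (h : ∀ x, ∫⁻ t, F (Function.update x i t) = ∫⁻ t, G (Function.update x i t)) :
    ∫⁻ x, F x = ∫⁻ x, G x :=
  le_antisymm (lintegral_le_of_update hF hG i fun x => (h x).le)
    (lintegral_le_of_update hG hF i fun x => (h x).ge)

/-- Change of variables for a map which is affine in the `i`-th coordinate. -/
theorem lintegral_update_affine (i : Fin n) {a c : (Fin n → ℝ) → ℝ} (ha : Measurable a)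
    (hc : Measurable c) (hai : ∀ x t, a (Function.update x i t) = a x)
    (hci : ∀ x t, c (Function.update x i t) = c x) (ha0 : ∀ᵐ x, a x ≠ 0)
    {K : (Fin n → ℝ) → ENNReal} (hK : Measurable K) :
    ∫⁻ x, K (Function.update x i (a x * x i + c x)) * ‖a x‖ₑ = ∫⁻ x, K x := by
  have hs : MeasurableSet {x | a x ≠ 0} := ha (measurableSet_singleton 0).compl
  have h1 : ∫⁻ x, K x = ∫⁻ x, Set.indicator {x | a x ≠ 0} K x := by
    refine lintegral_congr_ae ?_
    filter_upwards [ha0] with x hx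
    rw [Set.indicator_of_mem (show x ∈ {x | a x ≠ 0} from hx)]
  rw [h1]
  have hm : Measurable fun x : Fin n → ℝ => Function.update x i (a x * x i + c x) := by
    rw [measurable_pi_iff]
    intro j
    by_cases hj : j = i
    · subst hj; simp only [Function.update_self]; fun_prop
    · simp only [Function.update_of_ne hj]; fun_prop
  refine lintegral_eq_of_update ((hK.comp hm).mul ha.enorm) (hK.indicator hs) i fun x => ?_
  simp only [hai, hci, Function.update_self, Function.update_idem]
  by_cases hx : a x = 0
  · simp [hx, hai]
  · have : ∀ t, Set.indicator {x | a x ≠ 0} K (Function.update x i t) = K (Function.update x i t) :=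
      fun t => Set.indicator_of_mem (by simpa [hai] using hx) _
    simp only [this]
    exact lintegral_affine hx (c x) (F := fun t => K (Function.update x i t))
      (hK.comp (measurable_update x))

/-- Transfer of a change of variables from `lintegral` to the Bochner integral. -/
theorem sum_integral_comp_mul {ι : Type*} [Fintype ι] {e : ι → (Fin n → ℝ) → (Fin n → ℝ)}
    {w : ι → (Fin n → ℝ) → ℝ} (he : ∀ l, Measurable (e l)) (hw : ∀ l, Measurable (w l)) (c : NNReal)
    (h : ∀ K : (Fin n → ℝ) → ENNReal, Measurable K →
      ∑ l, ∫⁻ u, K (e l u) * ‖w l u‖ₑ = c * ∫⁻ u, K u)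
    {K : (Fin n → ℝ) → ℂ} (hK : Integrable K) :
    ∑ l, ∫ u, |w l u| • K (e l u) = c • ∫ u, K u := by
  set ν : ι → Measure (Fin n → ℝ) := fun l => (volume.withDensity fun u => ‖w l u‖ₑ).map (e l) with hν
  have hsum : ∑ l, ν l = c • volume := by
    refine Measure.ext_of_lintegral _ fun F hF => ?_
    rw [lintegral_finsetSum_measure, lintegral_smul_measure, ENNReal.smul_def, smul_eq_mul, ← h F hF]
    refine Finset.sum_congr rfl fun l _ => ?_
    have hm : Measurable fun u => F (e l u) := hF.comp (he l)
    rw [hν, lintegral_map hF (he l), lintegral_withDensity_eq_lintegral_mul _ (hw l).enorm hm]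
    refine lintegral_congr fun u => ?_
    simp [mul_comm]
  have hint : ∀ l, Integrable K (ν l) := fun l =>
    (hK.smul_measure_nnreal (c := c)).mono_measure (by
      rw [← hsum]
      exact Finset.single_le_sum (fun _ _ => Measure.zero_le _) (Finset.mem_univ l))
  rw [← integral_smul_nnreal_measure, ← hsum, integral_finsetSum_measure fun l _ => hint l]
  refine Finset.sum_congr rfl fun l _ => ?_
  rw [hν, integral_map (he l).aemeasurable (hint l).aestronglyMeasurable,
    integral_withDensity_eq_integral_toReal_smul (hw l).enorm (by simp)]
  simp

end ChangeOfVariables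

section StepIntegrals

variable {n : ℕ}

theorem ae_coord_ne_zero (i : Fin n) : ∀ᵐ x : Fin n → ℝ, x i ≠ 0 := by
  rw [ae_iff]
  simpa [volume_pi] using Measure.pi_hyperplane (fun _ : Fin n => (volume : Measure ℝ)) i 0

theorem lintegral_shearMap {i : Fin n} {θ : (Fin n → ℝ) → ℝ} (hθ : Continuous θ)
    (hi : ∀ x t, θ (Function.update x i t) = θ x) {K : (Fin n → ℝ) → ENNReal} (hK : Measurable K) :
    ∫⁻ x, K (shearMap i θ x) * ‖(1 : ℝ)‖ₑ = ∫⁻ x, K x := by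
  simpa [shearMap] using lintegral_update_affine i (a := fun _ => 1) measurable_const hθ.measurable
    (fun _ _ => rfl) hi (by simp) hK

theorem lintegral_blowA {i j : Fin n} (hij : i ≠ j) (b : ℝ) {K : (Fin n → ℝ) → ENNReal}
    (hK : Measurable K) : ∫⁻ x, K (blowA i j b x) * ‖x j‖ₑ = ∫⁻ x, K x := by
  simpa [blowA, mul_add] using lintegral_update_affine i (a := fun x => x j) (c := fun x => x j * b)
    (by fun_prop) (by fun_prop) (fun _ _ => by simp [hij.symm]) (fun _ _ => by simp [hij.symm])
    (ae_coord_ne_zero j) hK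

theorem lintegral_blowB {i j : Fin n} (hij : i ≠ j) {K : (Fin n → ℝ) → ENNReal}
    (hK : Measurable K) : ∫⁻ x, K (blowB i j x) * ‖x i‖ₑ = ∫⁻ x, K x := by
  simpa [blowB] using lintegral_update_affine j (a := fun x => x i) (c := fun _ => 0)
    (by fun_prop) (by fun_prop) (fun _ _ => by simp [hij]) (fun _ _ => rfl)
    (ae_coord_ne_zero i) hK

theorem measurable_powMap (i : Fin n) (N : ℕ) (ε : ℝ) : Measurable (powMap i N ε) := by
  have : Continuous (powMap i N ε) := by unfold powMap; fun_prop
  exact this.measurable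

theorem lintegral_powMap {i : Fin n} {N : ℕ} (hN : 0 < N) (hN2 : Even N)
    {K : (Fin n → ℝ) → ENNReal} (hK : Measurable K) :
    N * ((∫⁻ x, K (powMap i N 1 x) * ‖x i ^ (N - 1)‖ₑ) +
      ∫⁻ x, K (powMap i N (-1) x) * ‖x i ^ (N - 1)‖ₑ) = 2 * ∫⁻ x, K x := by
  have hw : Measurable fun x : Fin n → ℝ => ‖x i ^ (N - 1)‖ₑ := by fun_prop
  have hm : ∀ ε, Measurable fun x => K (powMap i N ε x) * ‖x i ^ (N - 1)‖ₑ := fun ε =>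
    (hK.comp (measurable_powMap i N ε)).mul hw
  have hm2 : Measurable fun x => K (powMap i N 1 x) * ‖x i ^ (N - 1)‖ₑ +
      K (powMap i N (-1) x) * ‖x i ^ (N - 1)‖ₑ := (hm 1).add (hm (-1))
  rw [← lintegral_add_left (hm 1), ← lintegral_const_mul _ hm2, ← lintegral_const_mul _ hK]
  refine lintegral_eq_of_update (hm2.const_mul _) (hK.const_mul _) i fun x => ?_
  have hx : ∀ ε, Measurable fun t => K (powMap i N ε (Function.update x i t)) *
      ‖(Function.update x i t : Fin n → ℝ) i ^ (N - 1)‖ₑ := fun ε => (hm ε).comp (measurable_update x)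
  have hx2 : Measurable fun t => K (powMap i N 1 (Function.update x i t)) *
      ‖(Function.update x i t : Fin n → ℝ) i ^ (N - 1)‖ₑ +
      K (powMap i N (-1) (Function.update x i t)) *
      ‖(Function.update x i t : Fin n → ℝ) i ^ (N - 1)‖ₑ := (hx 1).add (hx (-1))
  have hx3 : Measurable fun t => K (Function.update x i t) := hK.comp (measurable_update x)
  rw [lintegral_const_mul _ hx2, lintegral_add_left (hx 1), lintegral_const_mul _ hx3]
  simpa [powMap] using lintegral_pow_add hN hN2 (fun t => K (Function.update x i t))

theorem Step.lintegral_le {S : Set (((Fin n → ℝ) → (Fin n → ℝ)) × ((Fin n → ℝ) → ℝ))} (hS : Step S)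
    {p} (hp : p ∈ S) {K : (Fin n → ℝ) → ENNReal} (hK : Measurable K) :
    ∫⁻ u, K (p.1 u) * ‖p.2 u‖ₑ ≤ 2 * ∫⁻ x, K x := by
  have h2 : ∫⁻ x, K x ≤ 2 * ∫⁻ x, K x := by rw [two_mul]; exact le_self_add
  cases hS with
  | shear i θ hθ ha h0 hi =>
    subst hp
    exact (lintegral_shearMap hθ.continuous hi hK).trans_le h2
  | pow i N hN hN2 =>
    obtain ⟨ε, hε, rfl⟩ := hp
    rw [← lintegral_powMap hN hN2 hK]
    have h1 : (1 : ENNReal) ≤ N := by exact_mod_cast hN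
    rcases hε with rfl | rfl
    · exact le_self_add.trans (le_mul_of_one_le_left zero_le h1)
    · exact le_add_self.trans (le_mul_of_one_le_left zero_le h1)
  | blow i j hij =>
    rcases hp with ⟨b, rfl⟩ | rfl
    · exact (lintegral_blowA hij b hK).trans_le h2
    · exact (lintegral_blowB hij hK).trans_le h2

/-- The weighted pushforward of Lebesgue measure under `σ` is dominated by Lebesgue measure. -/
def Dom (σ : (Fin n → ℝ) → (Fin n → ℝ)) (ρ : (Fin n → ℝ) → ℝ) : Prop :=
  ∃ C : NNReal, ∀ H : (Fin n → ℝ) → ENNReal, Measurable H → ∫⁻ u, H (σ u) * ‖ρ u‖ₑ ≤ C * ∫⁻ x, H x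

theorem dom_id : Dom (fun x : Fin n → ℝ => x) (fun _ => 1) := ⟨1, fun H _ => by simp⟩

theorem Red.dom {Q : ((Fin n → ℝ) → (Fin n → ℝ)) → ((Fin n → ℝ) → ℝ) → Prop} {σ ρ}
    (h : Red Q σ ρ) (hg : Good σ ρ) (hd : Dom σ ρ) : Red (fun τ r => Dom τ r ∧ Q τ r) σ ρ := by
  induction h with
  | done τ r h => exact .done _ _ ⟨hd, h⟩
  | step σ ρ S hS _ ih =>
    refine .step _ _ S hS fun p hp => ih p hp (hg.comp (hS.good p hp).1) ?_
    obtain ⟨C, hC⟩ := hd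
    refine ⟨2 * C, fun H hH => ?_⟩
    have hm : Measurable fun x => H (σ x) * ‖ρ x‖ₑ :=
      (hH.comp hg.cont.measurable).mul hg.contw.measurable.enorm
    have := hS.lintegral_le hp hm
    simp only [mul_assoc, ← enorm_mul] at this
    refine this.trans ?_
    rw [ENNReal.coe_mul, mul_assoc]
    exact mul_le_mul_right (hC H hH) _

end StepIntegrals

section Partition

/-- A smooth partition of unity on the projective line: finitely many affine charts, and a
neighbourhood of infinity. -/
theorem exists_projective_partition (δ : ℝ → ℝ) (hδ : ∀ b, 0 < δ b) {δ' : ℝ} (hδ' : 0 < δ') :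
    ∃ (T : Finset ℝ) (ψ : T → ℝ → ℝ) (ψ' : ℝ → ℝ), (∀ b, ContDiff ℝ 1 (ψ b)) ∧ ContDiff ℝ 1 ψ' ∧
      (∀ (b : T) (t : ℝ), δ b < |t - (b : ℝ)| → ψ b t = 0) ∧ (∀ v, δ' < |v| → ψ' v = 0) ∧
      (∀ b t, |ψ b t| ≤ 1) ∧ (∀ v, |ψ' v| ≤ 1) ∧ ∀ t ≠ 0, ∑ b, ψ b t + ψ' t⁻¹ = 1 := by
  set ε : ℝ := min 1 (δ' ^ 2) / 4 with hε
  have hε0 : 0 < ε := by positivity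
  have hε1 : 4 * ε ≤ 1 := by
    rw [hε, mul_div_cancel₀ _ (by norm_num : (4 : ℝ) ≠ 0)]; exact min_le_left _ _
  have hε2 : 4 * ε ≤ δ' ^ 2 := by
    rw [hε, mul_div_cancel₀ _ (by norm_num : (4 : ℝ) ≠ 0)]; exact min_le_right _ _
  set s : Set ℝ := Set.Icc (-ε⁻¹) ε⁻¹ with hs
  obtain ⟨T, -, hT⟩ := (isCompact_Icc (a := -ε⁻¹) (b := ε⁻¹)).elim_nhds_subcover
    (fun b => Metric.ball b (δ b)) fun b _ => Metric.ball_mem_nhds b (hδ b)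
  obtain ⟨f, hf⟩ := SmoothPartitionOfUnity.exists_isSubordinate (modelWithCornersSelf ℝ ℝ)
    (s := s) isClosed_Icc (fun b : T => Metric.ball (b : ℝ) (δ b)) (fun b => Metric.isOpen_ball)
    (fun x hx => by
      obtain ⟨b, hb, hx'⟩ := Set.mem_iUnion₂.1 (hT hx)
      exact Set.mem_iUnion.2 ⟨⟨b, hb⟩, hx'⟩)
  set h : ℝ → ℝ := fun t => Real.smoothTransition ((1 + t ^ 2)⁻¹ / ε - 1) with hh
  have hpos : ∀ t : ℝ, 0 < 1 + t ^ 2 := fun t => by positivity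
  have hhc : ContDiff ℝ 1 h := by
    refine Real.smoothTransition.contDiff.comp (((ContDiff.inv (by fun_prop) ?_).div_const _).sub
      contDiff_const)
    exact fun t => (hpos t).ne'
  have hh0 : ∀ t, 0 ≤ h t := fun t => Real.smoothTransition.nonneg _
  have hh1 : ∀ t, h t ≤ 1 := fun t => Real.smoothTransition.le_one _
  have hhs : ∀ t, t ∉ s → h t = 0 := by
    intro t ht
    refine Real.smoothTransition.zero_of_nonpos ?_
    rw [sub_nonpos, div_le_one hε0]
    refine inv_le_of_inv_le₀ hε0 ?_
    have h1 : ε⁻¹ < |t| := by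
      by_contra! h; exact ht (abs_le.1 h)
    have h2 : 1 ≤ ε⁻¹ := (one_le_inv₀ hε0).2 (by linarith)
    rw [← sq_abs t]; nlinarith
  refine ⟨T, fun b t => f b t * h t, fun v => 1 - Real.smoothTransition (v ^ 2 * (1 + v ^ 2)⁻¹ / ε - 1),
    fun b => ((f b).contMDiff.contDiff.of_le (by norm_num)).mul hhc, ?_, ?_, ?_, ?_, ?_, ?_⟩
  · refine contDiff_const.sub (Real.smoothTransition.contDiff.comp ((((contDiff_id.pow 2).mul
      (ContDiff.inv (by fun_prop) ?_)).div_const _).sub contDiff_const))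
    exact fun t => (hpos t).ne'
  · intro b t ht
    have : f b t = 0 := by
      by_contra hne
      have := hf b (subset_tsupport _ hne)
      rw [Metric.mem_ball, Real.dist_eq] at this
      linarith
    simp only [this, zero_mul]
  · intro v hv
    refine sub_eq_zero.2 (Real.smoothTransition.one_of_one_le ?_).symm
    rw [le_sub_iff_add_le, le_div_iff₀ hε0, ← div_eq_mul_inv, le_div_iff₀ (hpos v)]
    have : δ' ^ 2 < v ^ 2 := by rw [← sq_abs v]; gcongr
    nlinarith
  · intro b t
    rw [abs_of_nonneg (mul_nonneg (f.nonneg b t) (hh0 t))]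
    exact mul_le_one₀ (f.le_one b t) (hh0 t) (hh1 t)
  · intro v
    rw [abs_le]
    constructor <;> linarith [Real.smoothTransition.nonneg (v ^ 2 * (1 + v ^ 2)⁻¹ / ε - 1),
      Real.smoothTransition.le_one (v ^ 2 * (1 + v ^ 2)⁻¹ / ε - 1)]
  · intro t ht
    have e1 : (t⁻¹) ^ 2 * (1 + (t⁻¹) ^ 2)⁻¹ = (1 + t ^ 2)⁻¹ := by
      have := hpos t; field_simp; ring
    simp only [e1, ← Finset.sum_mul]
    change _ + (1 - h t) = 1
    by_cases hts : t ∈ s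
    · have := f.sum_eq_one hts
      rw [finsum_eq_sum_of_fintype] at this
      rw [this]; ring
    · rw [hhs t hts]; ring

end Partition

section Transfer

variable {n : ℕ} {Ξ : Type*}

/-- The weighted oscillatory integrals in the chart `σ` with density `ρ` are bounded by `B`,
for amplitudes supported near the origin. -/
def Bd (G : Ξ → (Fin n → ℝ) → ℂ) (B : Ξ → ℝ) (σ : (Fin n → ℝ) → (Fin n → ℝ))
    (ρ : (Fin n → ℝ) → ℝ) : Prop :=
  ∃ δ > 0, ∀ φ : (Fin n → ℝ) → ℝ, ContDiff ℝ 1 φ → (∀ x, δ < ‖x‖ → φ x = 0) →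
    ∃ C : ℝ, ∀ ξ, ‖∫ u, (φ u * |ρ u|) • G ξ (σ u)‖ ≤ C * B ξ

theorem integral_comp_mul {e : (Fin n → ℝ) → (Fin n → ℝ)} {w : (Fin n → ℝ) → ℝ}
    (he : Measurable e) (hw : Measurable w)
    (h : ∀ K : (Fin n → ℝ) → ENNReal, Measurable K → ∫⁻ u, K (e u) * ‖w u‖ₑ = ∫⁻ u, K u)
    {K : (Fin n → ℝ) → ℂ} (hK : Integrable K) : ∫ u, |w u| • K (e u) = ∫ u, K u := by
  simpa using sum_integral_comp_mul (ι := Unit) (e := fun _ => e) (w := fun _ => w) (fun _ => he)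
    (fun _ => hw) 1 (by simpa using h) hK

theorem integrable_amplitude {φ ρ : (Fin n → ℝ) → ℝ} {σ : (Fin n → ℝ) → (Fin n → ℝ)}
    {g : (Fin n → ℝ) → ℂ} {r : ℝ} (hφ : Continuous φ) (hρ : Continuous ρ) (hσ : Continuous σ)
    (hg : Continuous g) (h0 : ∀ x, r < ‖x‖ → φ x = 0) :
    Integrable fun u => (φ u * |ρ u|) • g (σ u) := by
  refine Continuous.integrable_of_hasCompactSupport ((hφ.mul hρ.abs).smul (hg.comp hσ)) ?_
  refine HasCompactSupport.intro (isCompact_closedBall (0 : Fin n → ℝ) r) fun x hx => ?_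
  rw [h0 x (by simpa using hx), zero_mul, zero_smul]

theorem norm_le_of_update {x : Fin n → ℝ} {i : Fin n} {t r : ℝ} (hr : 0 ≤ r)
    (h : ‖Function.update x i t‖ ≤ r) (hi : |x i| ≤ r) : ‖x‖ ≤ r := by
  rw [pi_norm_le_iff_of_nonneg hr] at h ⊢
  intro j
  by_cases hj : j = i
  · rw [hj]; exact hi
  · simpa [hj] using h j

theorem abs_update_le {x : Fin n → ℝ} {i : Fin n} {t r : ℝ}
    (h : ‖Function.update x i t‖ ≤ r) : |t| ≤ r := by
  simpa using (norm_le_pi_norm (Function.update x i t) i).trans h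

variable {G : Ξ → (Fin n → ℝ) → ℂ} {B : Ξ → ℝ} {σ : (Fin n → ℝ) → (Fin n → ℝ)}
  {ρ : (Fin n → ℝ) → ℝ}

theorem contDiff_update_coord {g : (Fin n → ℝ) → ℝ} (hg : ContDiff ℝ 1 g) (i : Fin n) :
    ContDiff ℝ 1 (fun x => Function.update x i (g x)) := by
  rw [contDiff_pi]
  intro j
  by_cases h : j = i
  · subst h; simpa using hg
  · simpa [h] using contDiff_apply ℝ ℝ j

theorem bd_shear {i : Fin n} {θ : (Fin n → ℝ) → ℝ} (hG : ∀ ξ, Continuous (G ξ)) (hσ : Good σ ρ)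
    (hθ : ContDiff ℝ (⊤ : ℕ∞) θ) (h0 : θ 0 = 0)
    (hi : ∀ x t, θ (Function.update x i t) = θ x)
    (h : Bd G B (fun x => σ (shearMap i θ x)) (fun x => ρ (shearMap i θ x) * 1)) : Bd G B σ ρ := by
  obtain ⟨δ, hδ, h⟩ := h
  have hθ1 : ContDiff ℝ 1 θ := hθ.of_le (by exact_mod_cast le_top)
  have hinv : ContinuousAt (fun x : Fin n → ℝ => Function.update x i (x i - θ x)) 0 :=
    continuousAt_update i ((continuous_apply i).sub hθ.continuous).continuousAt
  have hinv0 : Function.update (0 : Fin n → ℝ) i ((0 : Fin n → ℝ) i - θ 0) = 0 :=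
    update_zero_of_eq_zero (by simp [h0])
  obtain ⟨r, hr, hball⟩ := Metric.continuousAt_iff.1 hinv δ hδ
  refine ⟨r / 2, by positivity, fun φ hφ hφ0 => ?_⟩
  have hsm : ContDiff ℝ 1 (shearMap i θ) := contDiff_update_coord ((contDiff_apply ℝ ℝ i).add hθ1) i
  obtain ⟨C, hC⟩ := h (fun u => φ (shearMap i θ u)) (hφ.comp hsm) (by
    intro u hu
    by_contra hne
    have h1 : ‖shearMap i θ u‖ ≤ r / 2 := by
      by_contra! hlt; exact hne (hφ0 _ hlt)
    have h2 := hball (x := shearMap i θ u) (by rw [dist_zero_right]; linarith)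
    rw [hinv0, dist_zero_right] at h2
    have h3 : Function.update (shearMap i θ u) i (shearMap i θ u i - θ (shearMap i θ u)) = u := by
      simp only [shearMap, hi]
      ext j; by_cases hj : j = i
      · subst hj; simp
      · simp [hj]
    rw [h3] at h2
    linarith)
  refine ⟨C, fun ξ => ?_⟩
  rw [← integral_comp_mul hsm.continuous.measurable measurable_const
    (fun K hK => lintegral_shearMap hθ.continuous hi hK)
    (integrable_amplitude hφ.continuous hσ.contw hσ.cont (hG ξ) hφ0)]
  simpa using hC ξ

theorem bd_pow {i : Fin n} {N : ℕ} (hN : 0 < N) (hN2 : Even N) (hG : ∀ ξ, Continuous (G ξ))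
    (hσ : Good σ ρ)
    (h : ∀ ε : ℝ, ε = 1 ∨ ε = -1 →
      Bd G B (fun x => σ (powMap i N ε x)) (fun x => ρ (powMap i N ε x) * x i ^ (N - 1))) :
    Bd G B σ ρ := by
  set s : Bool → ℝ := fun b => if b then 1 else -1 with hs
  have hs1 : ∀ b, s b = 1 ∨ s b = -1 := by intro b; cases b <;> simp [hs]
  choose δ hδ h using fun b => h (s b) (hs1 b)
  set r : ℝ := min (δ true) (δ false) with hr
  have hr0 : 0 < r := lt_min (hδ _) (hδ _)
  have hrδ : ∀ b, r ≤ δ b := by intro b; cases b <;> simp [hr]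
  set r' : ℝ := min r (r ^ N) with hr'
  refine ⟨r', lt_min hr0 (pow_pos hr0 N), fun φ hφ hφ0 => ?_⟩
  have hsm : ∀ ε, ContDiff ℝ 1 (powMap i N ε) := fun ε =>
    contDiff_update_coord (contDiff_const.mul ((contDiff_apply ℝ ℝ i).pow N)) i
  choose C hC using fun b => h b (fun u => φ (powMap i N (s b) u)) (hφ.comp (hsm _)) (by
    intro u hu
    by_contra hne
    have h1 : ‖powMap i N (s b) u‖ ≤ r' := by
      by_contra! hlt; exact hne (hφ0 _ hlt)
    refine absurd hu (not_lt.2 (le_trans ?_ (hrδ b)))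
    refine norm_le_of_update hr0.le (h1.trans (min_le_left _ _)) ?_
    have h2 := (abs_update_le h1).trans (min_le_right _ _)
    have h3 : |s b| = 1 := by rcases hs1 b with h | h <;> simp [h]
    rw [abs_mul, h3, one_mul, abs_pow] at h2
    exact (pow_le_pow_iff_left₀ (abs_nonneg _) hr0.le hN.ne').1 h2)
  refine ⟨N / 2 * (C true + C false), fun ξ => ?_⟩
  have key := sum_integral_comp_mul (ι := Bool) (e := fun b => powMap i N (s b))
    (w := fun _ x => x i ^ (N - 1)) (fun b => (hsm _).continuous.measurable) (fun b => by fun_prop)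
    (2 / N) (fun K hK => ?_)
    (integrable_amplitude hφ.continuous hσ.contw hσ.cont (hG ξ) hφ0)
  · have hN0 : (N : NNReal) ≠ 0 := by exact_mod_cast hN.ne'
    have h1 : ∫ u, (φ u * |ρ u|) • G ξ (σ u) = ((N : NNReal) / 2) • ∑ b : Bool,
        ∫ u, |u i ^ (N - 1)| • ((φ (powMap i N (s b) u) * |ρ (powMap i N (s b) u)|) •
          G ξ (σ (powMap i N (s b) u))) := by
      rw [key, smul_smul, div_mul_div_comm, mul_comm, div_self (by simp [hN.ne']), one_smul]
    have h2 : ∀ b, ‖∫ u, |u i ^ (N - 1)| • ((φ (powMap i N (s b) u) * |ρ (powMap i N (s b) u)|) •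
          G ξ (σ (powMap i N (s b) u)))‖ ≤ C b * B ξ := fun b => by
      refine (le_of_eq ?_).trans (hC b ξ)
      congr 2
      ext u
      rw [smul_smul, abs_mul]
      ring_nf
    rw [h1, NNReal.smul_def, norm_smul, Fintype.sum_bool]
    have h3 : ‖(((N : NNReal) / 2 : NNReal) : ℝ)‖ = N / 2 := by simp
    rw [h3, mul_assoc, add_mul]
    gcongr
    exact (norm_add_le _ _).trans (add_le_add (h2 _) (h2 _))
  · rw [Fintype.sum_bool]
    have := lintegral_powMap (i := i) hN hN2 hK
    have hN0 : (N : ENNReal) ≠ 0 := by exact_mod_cast hN.ne'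
    simp only [hs, if_true, Bool.false_eq_true, if_false]
    rw [ENNReal.coe_div (by simp [hN.ne']), ENNReal.coe_natCast, ENNReal.div_eq_inv_mul, mul_assoc,
      ENNReal.coe_ofNat, ← this, ← mul_assoc, ENNReal.inv_mul_cancel hN0 (by simp), one_mul]

end Transfer

section Transfer

variable {n : ℕ} {Ξ : Type*} {G : Ξ → (Fin n → ℝ) → ℂ} {B : Ξ → ℝ}
  {σ : (Fin n → ℝ) → (Fin n → ℝ)} {ρ : (Fin n → ℝ) → ℝ}

theorem bd_of_chart {e : (Fin n → ℝ) → (Fin n → ℝ)} {w m η φ : (Fin n → ℝ) → ℝ} {δ : ℝ}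
    (he : ContDiff ℝ 1 e) (hw : Continuous w)
    (h : ∀ K : (Fin n → ℝ) → ENNReal, Measurable K → ∫⁻ u, K (e u) * ‖w u‖ₑ = ∫⁻ u, K u)
    (hm : Measurable m) (hm1 : ∀ x, |m x| ≤ 1) (hη : ContDiff ℝ 1 η)
    (hmη : ∀ u, w u ≠ 0 → m (e u) = η u)
    (hint : ∀ ξ, Integrable fun x => (φ x * |ρ x|) • G ξ (σ x))
    (hB : ∀ φ : (Fin n → ℝ) → ℝ, ContDiff ℝ 1 φ → (∀ x, δ < ‖x‖ → φ x = 0) →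
      ∃ C : ℝ, ∀ ξ, ‖∫ u, (φ u * |ρ (e u) * w u|) • G ξ (σ (e u))‖ ≤ C * B ξ)
    (hφ : ContDiff ℝ 1 φ) (hsupp : ∀ u, δ < ‖u‖ → η u * φ (e u) = 0) :
    (∀ ξ, Integrable fun x => m x • ((φ x * |ρ x|) • G ξ (σ x))) ∧
      ∃ C : ℝ, ∀ ξ, ‖∫ x, m x • ((φ x * |ρ x|) • G ξ (σ x))‖ ≤ C * B ξ := by
  have h1 : ∀ ξ, Integrable fun x => m x • ((φ x * |ρ x|) • G ξ (σ x)) := fun ξ =>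
    (hint ξ).bdd_smul (𝕜 := ℝ) 1 hm.aestronglyMeasurable (Eventually.of_forall hm1)
  refine ⟨h1, ?_⟩
  obtain ⟨C, hC⟩ := hB _ (hη.mul (hφ.comp he)) hsupp
  refine ⟨C, fun ξ => ?_⟩
  rw [← integral_comp_mul he.continuous.measurable hw.measurable h (h1 ξ)]
  refine (le_of_eq ?_).trans (hC ξ)
  congr 2
  ext u
  simp only [Function.comp]
  by_cases h0 : w u = 0
  · simp [h0]
  · rw [hmη u h0, smul_smul, smul_smul, abs_mul]
    ring_nf

theorem bd_blow {i j : Fin n} (hij : i ≠ j) (hG : ∀ ξ, Continuous (G ξ)) (hσ : Good σ ρ)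
    (hA : ∀ b, Bd G B (fun x => σ (blowA i j b x)) (fun x => ρ (blowA i j b x) * x j))
    (hB : Bd G B (fun x => σ (blowB i j x)) (fun x => ρ (blowB i j x) * x i)) : Bd G B σ ρ := by
  choose δ hδ hA using hA
  obtain ⟨δ', hδ', hB⟩ := hB
  obtain ⟨T, ψ, ψ', hψ, hψ', hψs, hψs', hψ1, hψ1', hsum⟩ := exists_projective_partition δ hδ hδ'
  obtain ⟨r, hr0, hrδ', hrδ⟩ : ∃ r > 0, r ≤ δ' ∧ ∀ b ∈ T, r ≤ δ b := by
    refine ⟨(insert δ' (T.image δ)).min' (Finset.insert_nonempty _ _), ?_, ?_, ?_⟩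
    · rw [gt_iff_lt, Finset.lt_min'_iff]
      simp [hδ, hδ']
    · exact Finset.min'_le _ _ (by simp)
    · exact fun b hb => Finset.min'_le _ _ (by simp; exact Or.inr ⟨b, hb, rfl⟩)
  refine ⟨r, hr0, fun φ hφ hφ0 => ?_⟩
  have hci : ∀ l : Fin n, ContDiff ℝ 1 fun x : Fin n → ℝ => x l := fun l => contDiff_apply ℝ ℝ l
  have hint : ∀ ξ, Integrable fun x => (φ x * |ρ x|) • G ξ (σ x) := fun ξ =>
    integrable_amplitude hφ.continuous hσ.contw hσ.cont (hG ξ) hφ0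
  have hsA : ∀ b, ContDiff ℝ 1 (blowA i j b) := fun b =>
    contDiff_update_coord ((hci j).mul ((hci i).add contDiff_const)) i
  have hsB : ContDiff ℝ 1 (blowB i j) := contDiff_update_coord ((hci i).mul (hci j)) j
  have cA := fun b : T => bd_of_chart (m := fun x => ψ b (x i / x j)) (η := fun u => ψ b (u i + b))
    (hsA b) (continuous_apply j) (fun K hK => lintegral_blowA hij b hK)
    ((hψ b).continuous.measurable.comp (by fun_prop)) (fun x => hψ1 b _)
    ((hψ b).comp ((hci i).add contDiff_const))
    (fun u hu => by simp [blowA, hij.symm, mul_div_cancel_left₀ _ hu]) hint (hA b) hφ (by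
      intro u hu
      by_contra hne
      obtain ⟨h1, h2⟩ := mul_ne_zero_iff.1 hne
      have h3 : |u i| ≤ δ b := by
        by_contra! hlt
        exact h1 (hψs b _ (by simpa using hlt))
      have h4 : ‖blowA i j b u‖ ≤ r := by
        by_contra! hlt; exact h2 (hφ0 _ hlt)
      exact absurd hu (not_lt.2 (norm_le_of_update (hδ b).le (h4.trans (hrδ b b.2)) h3)))
  obtain ⟨iB, CB, hCB⟩ := bd_of_chart (m := fun x => ψ' (x j / x i)) (η := fun u => ψ' (u j))
    hsB (continuous_apply i) (fun K hK => lintegral_blowB hij hK)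
    (hψ'.continuous.measurable.comp (by fun_prop)) (fun x => hψ1' _)
    (hψ'.comp (hci j))
    (fun u hu => by simp [blowB, hij, mul_div_cancel_left₀ _ hu]) hint hB hφ (by
      intro u hu
      by_contra hne
      obtain ⟨h1, h2⟩ := mul_ne_zero_iff.1 hne
      have h3 : |u j| ≤ δ' := by
        by_contra! hlt
        exact h1 (hψs' _ hlt)
      have h4 : ‖blowB i j u‖ ≤ r := by
        by_contra! hlt; exact h2 (hφ0 _ hlt)
      exact absurd hu (not_lt.2 (norm_le_of_update hδ'.le (h4.trans hrδ') h3)))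
  choose iA CA hCA using cA
  refine ⟨∑ b, CA b + CB, fun ξ => ?_⟩
  have key : ∫ x, (φ x * |ρ x|) • G ξ (σ x) =
      (∑ b, ∫ x, ψ b (x i / x j) • ((φ x * |ρ x|) • G ξ (σ x))) +
        ∫ x, ψ' (x j / x i) • ((φ x * |ρ x|) • G ξ (σ x)) := by
    rw [← integral_finsetSum _ fun b _ => iA b ξ,
      ← integral_add (integrable_finsetSum _ fun b _ => iA b ξ) (iB ξ)]
    refine integral_congr_ae ?_
    filter_upwards [ae_coord_ne_zero i, ae_coord_ne_zero j] with x hi hj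
    have h1 := hsum (x i / x j) (div_ne_zero hi hj)
    rw [inv_div] at h1
    rw [← Finset.sum_smul, ← add_smul, h1, one_smul]
  rw [key, add_mul, Finset.sum_mul]
  exact (norm_add_le _ _).trans (add_le_add ((norm_sum_le _ _).trans
    (Finset.sum_le_sum fun b _ => hCA b ξ)) (hCB ξ))

theorem Red.bd {Q : ((Fin n → ℝ) → (Fin n → ℝ)) → ((Fin n → ℝ) → ℝ) → Prop}
    (hG : ∀ ξ, Continuous (G ξ)) (hQ : ∀ τ r, Good τ r → Q τ r → Bd G B τ r) {σ ρ}
    (h : Red Q σ ρ) (hg : Good σ ρ) : Bd G B σ ρ := by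
  induction h with
  | done τ r h => exact hQ _ _ hg h
  | step σ ρ S hS _ ih =>
    have ih' : ∀ p ∈ S, Bd G B (fun x => σ (p.1 x)) fun x => ρ (p.1 x) * p.2 x := fun p hp =>
      ih p hp (hg.comp (hS.good p hp).1)
    cases hS with
    | shear i θ hθ ha h0 hi => exact bd_shear hG hg hθ h0 hi (ih' (shearMap i θ, fun _ => 1) rfl)
    | pow i N hN hN2 =>
      exact bd_pow hN hN2 hG hg fun ε hε =>
        ih' (powMap i N ε, fun x => x i ^ (N - 1)) ⟨ε, hε, rfl⟩
    | blow i j hij =>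
      exact bd_blow hij hG hg (fun b => ih' (blowA i j b, fun x => x j) (Or.inl ⟨b, rfl⟩))
        (ih' (blowB i j, fun x => x i) (Or.inr rfl))

end Transfer

section Dilation

variable {n : ℕ}

/-- Exponents become distinct after pairing with a suitable positive weight. -/
theorem exists_separating_weight {ι : Type*} [Finite ι] {α : ι → Fin n → ℕ}
    (hα : Function.Injective α) :
    ∃ w : Fin n → ℝ, (∀ l, 0 < w l) ∧ Function.Injective fun i => ∑ l, w l * α i l := by
  classical
  have := Fintype.ofFinite ι
  set P : ι → ι → Polynomial ℝ := fun i j =>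
    ∑ l : Fin n, Polynomial.monomial l ((α i l : ℝ) - α j l) with hP
  have hP0 : ∀ i j, i ≠ j → P i j ≠ 0 := fun i j hij h0 => by
    refine hij (hα (funext fun l => ?_))
    have h1 := congrArg (fun p => Polynomial.coeff p (l : ℕ)) h0
    simp only [hP, Polynomial.finsetSum_coeff, Polynomial.coeff_monomial, Fin.val_inj,
      Finset.sum_ite_eq', Finset.mem_univ, if_true, Polynomial.coeff_zero, sub_eq_zero,
      Nat.cast_inj] at h1
    exact h1
  have hfin : (⋃ p ∈ {p : ι × ι | p.1 ≠ p.2}, {x : ℝ | (P p.1 p.2).IsRoot x}).Finite :=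
    (Set.toFinite _).biUnion fun p hp => Polynomial.finite_setOfPred_isRoot (hP0 _ _ hp)
  obtain ⟨x, hx, hx'⟩ := (Set.Ioi_infinite (0 : ℝ)).exists_notMem_finite hfin
  refine ⟨fun l => x ^ (l : ℕ), fun l => pow_pos hx _, fun i j hij => ?_⟩
  by_contra hne
  refine hx' (Set.mem_biUnion (x := (i, j)) hne ?_)
  simp only [hP, Set.mem_ofPred_eq, Polynomial.IsRoot, Polynomial.eval_finsetSum,
    Polynomial.eval_monomial]
  simp only at hij
  rw [← sub_eq_zero, ← Finset.sum_sub_distrib] at hij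
  rw [← hij]
  exact Finset.sum_congr rfl fun l _ => by ring

/-- A quantitative form of the invertibility of a Vandermonde matrix. -/
theorem exists_vandermonde_lower_bound {m : ℕ} {κ b : Fin (m + 1) → ℝ} (hκ : Function.Injective κ)
    (hκ0 : ∀ i, κ i ≠ 0) (hb : ∀ i, b i ≠ 0) :
    ∃ c > 0, ∀ y : Fin (m + 1) → ℝ, ∃ j : Fin (m + 1),
      c * ‖y‖ ≤ |∑ i, y i * (κ i ^ ((j : ℕ) + 1) * b i)| := by
  set L : (Fin (m + 1) → ℝ) →ₗ[ℝ] (Fin (m + 1) → ℝ) :=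
    (Matrix.of fun j i : Fin (m + 1) => κ i ^ ((j : ℕ) + 1) * b i).mulVecLin with hL
  have hLa : ∀ y j, L y j = ∑ i, y i * (κ i ^ ((j : ℕ) + 1) * b i) := fun y j => by
    simp [hL, Matrix.mulVec, dotProduct, mul_comm]
  have hker : L.ker = ⊥ := by
    rw [LinearMap.ker_eq_bot']
    intro y hy
    have h1 : (fun i => y i * (κ i * b i)) = 0 := by
      refine Matrix.eq_zero_of_forall_pow_sum_mul_pow_eq_zero hκ fun j => ?_
      have h2 := congrFun hy j
      rw [hLa] at h2
      rw [← Pi.zero_apply (M := fun _ => ℝ) j, ← h2]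
      exact Finset.sum_congr rfl fun i _ => by ring
    ext i
    have := congrFun h1 i
    simpa [hκ0, hb] using this
  obtain ⟨K, hK, hanti⟩ := L.exists_antilipschitzWith hker
  refine ⟨(K : ℝ)⁻¹, by positivity, fun y => ?_⟩
  by_contra! hlt
  have h1 : ‖L y‖ < (K : ℝ)⁻¹ * ‖y‖ := by
    rw [pi_norm_lt_iff ((abs_nonneg _).trans_lt (hlt 0))]
    intro j
    rw [hLa]
    exact hlt j
  have h2 := hanti.le_mul_dist y 0
  rw [map_zero, dist_zero_right, dist_zero_right] at h2
  have hK' : (0 : ℝ) < K := hK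
  rw [inv_mul_eq_div, lt_div_iff₀ hK'] at h1
  linarith

/-- The one-parameter group of weighted dilations. -/
noncomputable def dil (w : Fin n → ℝ) (s : ℝ) (u : Fin n → ℝ) : Fin n → ℝ :=
  fun l => Real.exp (w l * s) * u l

theorem monom_dil (α : Fin n → ℕ) (w : Fin n → ℝ) (s : ℝ) (u : Fin n → ℝ) :
    monom α (dil w s u) = Real.exp ((∑ l, w l * α l) * s) * monom α u := by
  simp only [monom, dil, mul_pow, Finset.prod_mul_distrib, ← Real.exp_nat_mul, ← Real.exp_sum]
  congr 2
  rw [Finset.sum_mul]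
  exact Finset.sum_congr rfl fun l _ => by ring

theorem continuous_dil (w : Fin n → ℝ) : Continuous fun p : ℝ × (Fin n → ℝ) => dil w p.1 p.2 := by
  unfold dil; fun_prop

theorem hasDerivAt_dil (w : Fin n → ℝ) (u : Fin n → ℝ) (s : ℝ) :
    HasDerivAt (fun s => dil w s u) (w * dil w s u) s := by
  rw [hasDerivAt_pi]
  intro l
  have h : HasDerivAt (fun s => w l * s) (w l) s := by simpa using (hasDerivAt_id s).const_mul (w l)
  refine (h.exp.mul_const (u l)).congr_deriv ?_
  simp only [Pi.mul_apply, dil]; ring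

/-- The infinitesimal generator of `s ↦ e ^ (κ s) F (dil w s u)`. -/
noncomputable def gen (w : Fin n → ℝ) (κ : ℝ) (F : (Fin n → ℝ) → ℝ) (x : Fin n → ℝ) : ℝ :=
  κ * F x + fderiv ℝ F x (w * x)

theorem hasDerivAt_gen {w : Fin n → ℝ} {κ : ℝ} {F : (Fin n → ℝ) → ℝ} {u : Fin n → ℝ} {s : ℝ}
    (hF : DifferentiableAt ℝ F (dil w s u)) :
    HasDerivAt (fun s => Real.exp (κ * s) * F (dil w s u))
      (Real.exp (κ * s) * gen w κ F (dil w s u)) s := by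
  have h : HasDerivAt (fun s => κ * s) κ s := by simpa using (hasDerivAt_id s).const_mul κ
  refine (h.exp.mul (hF.hasFDerivAt.comp_hasDerivAt s (hasDerivAt_dil w u s))).congr_deriv ?_
  simp only [gen, Function.comp]; ring

theorem continuousAt_gen {w : Fin n → ℝ} {κ : ℝ} {F : (Fin n → ℝ) → ℝ} {x : Fin n → ℝ}
    (hF : ContDiffAt ℝ 1 F x) : ContinuousAt (gen w κ F) x := by
  have h1 : ContinuousAt (fderiv ℝ F) x := hF.continuousAt_fderiv (by simp)
  have h2 : ContinuousAt (fun x => w * x) x := by fun_prop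
  exact (continuousAt_const.mul hF.continuousAt).add (h1.clm_apply h2)

theorem analyticOnNhd_gen {w : Fin n → ℝ} {κ : ℝ} {F : (Fin n → ℝ) → ℝ} {s : Set (Fin n → ℝ)}
    (hF : AnalyticOnNhd ℝ F s) : AnalyticOnNhd ℝ (gen w κ F) s := by
  intro x hx
  have h2 : AnalyticAt ℝ (fun x : Fin n → ℝ => w * x) x := by
    rw [analyticAt_pi_iff]
    exact fun l => analyticAt_const.mul (analyticAt_coord l x)
  exact (analyticAt_const.mul (hF x hx)).add (AnalyticAt.comp₂
    (h := fun p : ((Fin n → ℝ) →L[ℝ] ℝ) × (Fin n → ℝ) => p.1 p.2)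
    ((ContinuousLinearMap.id ℝ ((Fin n → ℝ) →L[ℝ] ℝ)).analyticAt_bilinear _) (hF x hx).fderiv h2)

theorem gen_iterate_zero {w : Fin n → ℝ} {κ : ℝ} {F : (Fin n → ℝ) → ℝ} (j : ℕ) :
    (gen w κ)^[j] F 0 = κ ^ j * F 0 := by
  induction j with
  | zero => simp
  | succ j ih => rw [Function.iterate_succ_apply', gen, ih]; simp; ring

theorem analyticOnNhd_gen_iterate {w : Fin n → ℝ} {κ : ℝ} {F : (Fin n → ℝ) → ℝ}
    {s : Set (Fin n → ℝ)} (hF : AnalyticOnNhd ℝ F s) (j : ℕ) :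
    AnalyticOnNhd ℝ ((gen w κ)^[j] F) s := by
  induction j with
  | zero => simpa using hF
  | succ j ih => rw [Function.iterate_succ_apply']; exact analyticOnNhd_gen ih

end Dilation

section RayBound

variable {n : ℕ}

theorem exists_uniform_bound {ι X : Type*} [Finite ι] [TopologicalSpace X] {K : Set X}
    (hK : IsCompact K) {F : ι → X → ℝ} (hF : ∀ i, ContinuousOn (F i) K) :
    ∃ M, 0 < M ∧ ∀ i, ∀ x ∈ K, |F i x| ≤ M := by
  have := Fintype.ofFinite ι
  choose M hM using fun i => hK.exists_bound_of_continuousOn (hF i)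
  refine ⟨∑ i, |M i| + 1, by positivity, fun i x hx => ?_⟩
  have h1 := (hM i x hx).trans (le_abs_self _)
  have h2 := Finset.single_le_sum (f := fun i => |M i|) (fun i _ => abs_nonneg _)
    (Finset.mem_univ i)
  rw [Real.norm_eq_abs] at h1
  linarith

/-- Oscillatory integrals along weighted dilations of a linear combination of monomials (times
units) with distinct exponents. -/
theorem exists_ray_bound {m : ℕ} {α : Fin (m + 1) → Fin n → ℕ} (hα : Function.Injective α)
    (hα0 : ∀ i, α i ≠ 0) {U : Fin (m + 1) → (Fin n → ℝ) → ℝ} (hU : ∀ i, AnalyticAt ℝ (U i) 0)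
    (hU0 : ∀ i, U i 0 ≠ 0) :
    ∃ w : Fin n → ℝ, (∀ l, 0 < w l) ∧ ∃ R > 0, ∀ R' < R, ∀ (κ' : ℝ) (Ψ : (Fin n → ℝ) → ℝ),
      (∀ x ∈ Metric.closedBall 0 R', ContDiffAt ℝ 1 Ψ x) →
      ∃ C, 0 ≤ C ∧ ∀ (u : Fin n → ℝ) (c : Fin (m + 1) → ℝ),
        (∀ s ∈ Set.Icc (0 : ℝ) 1, dil w s u ∈ Metric.closedBall 0 R') →
        ‖∫ s in (0 : ℝ)..1, ((Real.exp (κ' * s) * Ψ (dil w s u) : ℝ) : ℂ) *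
            cexp (I * ((∑ i, c i * (monom (α i) (dil w s u) * U i (dil w s u)) : ℝ) : ℂ))‖ ≤
          C * (1 + ‖fun i => c i * monom (α i) u‖) ^ (-(1 : ℝ) / (m + 1)) := by
  obtain ⟨w, hw, hinj⟩ := exists_separating_weight hα
  set κ : Fin (m + 1) → ℝ := fun i => ∑ l, w l * α i l with hκ
  have hκ0 : ∀ i, 0 < κ i := fun i => by
    obtain ⟨l, hl⟩ := Function.ne_iff.1 (hα0 i)
    exact Finset.sum_pos' (fun l _ => mul_nonneg (hw l).le (Nat.cast_nonneg _))
      ⟨l, Finset.mem_univ _, mul_pos (hw l) (Nat.cast_pos.2 (Nat.pos_of_ne_zero hl))⟩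
  set V : Fin (m + 1) → ℕ → (Fin n → ℝ) → ℝ := fun i j => (gen w (κ i))^[j] (U i) with hV
  obtain ⟨R₁, hR₁, hUR⟩ : ∃ R > 0, ∀ x ∈ Metric.ball (0 : Fin n → ℝ) R, ∀ i,
      AnalyticAt ℝ (U i) x :=
    Metric.eventually_nhds_iff_ball.1 (eventually_all.2 fun i => (hU i).eventually_analyticAt)
  have hVa : ∀ i j, AnalyticOnNhd ℝ (V i j) (Metric.ball 0 R₁) := fun i j =>
    analyticOnNhd_gen_iterate (fun x hx => hUR x hx i) j
  obtain ⟨c₀, hc₀, hlow⟩ := exists_vandermonde_lower_bound hinj (fun i => (hκ0 i).ne') hU0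
  have hV0 : ∀ i j, κ i ^ j * U i 0 = V i j 0 := fun i j => (gen_iterate_zero j).symm
  obtain ⟨R₂, hR₂, hVR⟩ : ∃ R > 0, ∀ x ∈ Metric.ball (0 : Fin n → ℝ) R, ∀ i, ∀ j : Fin (m + 1),
      |V i (j + 1) x - V i (j + 1) 0| < c₀ / (2 * (m + 1)) := by
    refine Metric.eventually_nhds_iff_ball.1 (eventually_all.2 fun i => eventually_all.2 fun j => ?_)
    have := (hVa i (j + 1) 0 (Metric.mem_ball_self hR₁)).continuousAt
    exact Metric.continuousAt_iff'.1 this _ (by positivity)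
  refine ⟨w, hw, min R₁ R₂, lt_min hR₁ hR₂, fun R' hR' κ' Ψ hΨ => ?_⟩
  have hK : IsCompact (Metric.closedBall (0 : Fin n → ℝ) R') := isCompact_closedBall 0 R'
  have hsub : ∀ x ∈ Metric.closedBall (0 : Fin n → ℝ) R', x ∈ Metric.ball 0 R₁ ∧
      x ∈ Metric.ball 0 R₂ := fun x hx =>
    ⟨Metric.closedBall_subset_ball (hR'.trans_le (min_le_left _ _)) hx,
      Metric.closedBall_subset_ball (hR'.trans_le (min_le_right _ _)) hx⟩
  obtain ⟨M, hM, hMV⟩ := exists_uniform_bound hK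
    (F := fun p : Fin (m + 1) × Fin (m + 3) => V p.1 p.2) fun p x hx =>
      (hVa _ _ x (hsub x hx).1).continuousAt.continuousWithinAt
  obtain ⟨M₁, hM₁, hMΨ⟩ := exists_uniform_bound hK (F := fun _ : Unit => Ψ) fun _ x hx =>
    (hΨ x hx).continuousAt.continuousWithinAt
  obtain ⟨M₂, hM₂, hMX⟩ := exists_uniform_bound hK (F := fun _ : Unit => gen w κ' Ψ) fun _ x hx =>
    (continuousAt_gen (hΨ x hx)).continuousWithinAt
  set E : ℝ := ∑ i, Real.exp (κ i) with hE
  have hE0 : 0 < E := Finset.sum_pos (fun i _ => Real.exp_pos _) Finset.univ_nonempty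
  obtain ⟨C, hC, hosc⟩ := oscillatory_bound m (half_pos hc₀) (mul_pos hE0 hM)
  set K : ℝ := Real.exp |κ'| * (M₁ + M₂) with hKd
  refine ⟨C * K, by positivity, fun u c hu => ?_⟩
  set y : Fin (m + 1) → ℝ := fun i => c i * monom (α i) u with hy
  set q : ℕ → ℝ → ℝ := fun j s => ∑ i, y i * (Real.exp (κ i * s) * V i j (dil w s u)) with hq
  have hq0 : ∀ s, ∑ i, c i * (monom (α i) (dil w s u) * U i (dil w s u)) = q 0 s := fun s => by
    refine Finset.sum_congr rfl fun i _ => ?_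
    simp only [monom_dil, hy, hV, hκ, Function.iterate_zero, id]; ring
  simp only [hq0]
  have hexp : ∀ s ∈ Set.Icc (0 : ℝ) 1, |Real.exp (κ' * s)| ≤ Real.exp |κ'| := fun s hs => by
    rw [Real.abs_exp, Real.exp_le_exp]
    calc κ' * s ≤ |κ' * s| := le_abs_self _
      _ = |κ'| * s := by rw [abs_mul, abs_of_nonneg hs.1]
      _ ≤ |κ'| := mul_le_of_le_one_right (abs_nonneg _) hs.2
  refine hosc q _ (fun s => Real.exp (κ' * s) * gen w κ' Ψ (dil w s u)) ‖y‖ K (norm_nonneg _)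
    ?_ ?_ ?_ ?_ ?_ ?_ ?_
  · intro j s hs
    refine HasDerivAt.fun_sum fun i _ => ?_
    have h1 := hasDerivAt_gen (κ := κ i) (hVa i j _ (hsub _ (hu s hs)).1).differentiableAt
    have h2 : gen w (κ i) (V i j) = V i (j + 1) := (Function.iterate_succ_apply' _ _ _).symm
    rw [h2] at h1
    exact h1.const_mul (y i)
  · intro s hs
    set z : Fin (m + 1) → ℝ := fun i => y i * Real.exp (κ i * s) with hz
    have hyz : ‖y‖ ≤ ‖z‖ := by
      rw [pi_norm_le_iff_of_nonneg (norm_nonneg _)]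
      intro i
      refine le_trans ?_ (norm_le_pi_norm z i)
      have h5 : ‖z i‖ = ‖y i‖ * Real.exp (κ i * s) := by
        rw [show z i = y i * Real.exp (κ i * s) from rfl, norm_mul, Real.norm_eq_abs (Real.exp _),
          Real.abs_exp]
      rw [h5]
      exact le_mul_of_one_le_right (norm_nonneg _)
        (Real.one_le_exp (mul_nonneg (hκ0 i).le hs.1))
    obtain ⟨j, hj⟩ := hlow z
    refine ⟨j, by omega, ?_⟩
    have h1 : q (j + 1) s = ∑ i, z i * (κ i ^ ((j : ℕ) + 1) * U i 0) +
        ∑ i, z i * (V i (j + 1) (dil w s u) - V i (j + 1) 0) := by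
      rw [← Finset.sum_add_distrib]
      refine Finset.sum_congr rfl fun i _ => ?_
      rw [hV0]; simp only [hz]; ring
    have h2 : |∑ i, z i * (V i (j + 1) (dil w s u) - V i (j + 1) 0)| ≤ c₀ / 2 * ‖z‖ := by
      refine (Finset.abs_sum_le_sum_abs _ _).trans ?_
      calc ∑ i, |z i * (V i (j + 1) (dil w s u) - V i (j + 1) 0)|
          ≤ ∑ _i : Fin (m + 1), ‖z‖ * (c₀ / (2 * (m + 1))) := by
            refine Finset.sum_le_sum fun i _ => ?_
            rw [abs_mul]
            exact mul_le_mul (norm_le_pi_norm z i) (hVR _ (hsub _ (hu s hs)).2 i j).le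
              (abs_nonneg _) (norm_nonneg _)
        _ = c₀ / 2 * ‖z‖ := by
            rw [Finset.sum_const, Finset.card_univ, Fintype.card_fin, nsmul_eq_mul]
            push_cast; field_simp
    have h3 : c₀ / 2 * ‖y‖ ≤ c₀ / 2 * ‖z‖ := by gcongr
    rw [h1]
    have h4 := abs_sub_abs_le_abs_add (∑ i, z i * (κ i ^ ((j : ℕ) + 1) * U i 0))
      (∑ i, z i * (V i (j + 1) (dil w s u) - V i (j + 1) 0))
    linarith
  · intro j hj s hs
    refine (Finset.abs_sum_le_sum_abs _ _).trans ?_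
    rw [hE, Finset.sum_mul, Finset.sum_mul]
    refine Finset.sum_le_sum fun i _ => ?_
    rw [abs_mul (y i), abs_mul (Real.exp _), Real.abs_exp, mul_comm]
    refine mul_le_mul ?_ (norm_le_pi_norm y i) (abs_nonneg _) (by positivity)
    refine mul_le_mul (Real.exp_le_exp.2 (mul_le_of_le_one_right (hκ0 i).le hs.2)) ?_
      (abs_nonneg _) (Real.exp_nonneg _)
    exact hMV (i, ⟨j + 2, by omega⟩) _ (hu s hs)
  · exact fun s hs => hasDerivAt_gen ((hΨ _ (hu s hs)).differentiableAt (by simp))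
  · intro s hs
    have h1 : ContinuousAt (fun s => dil w s u) s := (hasDerivAt_dil w u s).continuousAt
    have h2 : ContinuousAt (fun s => gen w κ' Ψ (dil w s u)) s :=
      ContinuousAt.comp (f := fun s => dil w s u) (continuousAt_gen (hΨ _ (hu s hs))) h1
    have h3 : ContinuousAt (fun s => Real.exp (κ' * s)) s := by fun_prop
    exact (h3.mul h2).continuousWithinAt
  · intro s hs
    rw [abs_mul, hKd]
    exact mul_le_mul (hexp s hs) ((hMΨ () _ (hu s hs)).trans (by linarith)) (abs_nonneg _)
      (Real.exp_nonneg _)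
  · intro s hs
    rw [abs_mul, hKd]
    exact mul_le_mul (hexp s hs) ((hMX () _ (hu s hs)).trans (by linarith)) (abs_nonneg _)
      (Real.exp_nonneg _)

end RayBound

section Averaging

variable {n : ℕ}

theorem integral_comp_dil (w : Fin n → ℝ) (s : ℝ) {h : (Fin n → ℝ) → ℂ} (hh : Continuous h) :
    ∫ u, Real.exp ((∑ l, w l) * s) • h (dil w s u) = ∫ x, h x := by
  have hdet : Matrix.det (Matrix.diagonal fun l => Real.exp (w l * s)) =
      Real.exp ((∑ l, w l) * s) := by
    rw [Matrix.det_diagonal, ← Real.exp_sum, Finset.sum_mul]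
  have hlin : ⇑(Matrix.toLin' (Matrix.diagonal fun l => Real.exp (w l * s))) = dil w s := by
    ext u l
    simp [dil, Matrix.mulVec_diagonal]
  have hmap := Real.smul_map_diagonal_volume_pi (D := fun l => Real.exp (w l * s))
    (by rw [hdet]; exact (Real.exp_pos _).ne')
  rw [hdet, hlin] at hmap
  have hc : Continuous (dil w s) := (continuous_dil w).comp (Continuous.prodMk_right s)
  conv_rhs => rw [← hmap]
  rw [integral_smul_measure, integral_map hc.aemeasurable hh.aestronglyMeasurable, integral_smul,
    Real.abs_exp, ENNReal.toReal_ofReal (Real.exp_nonneg _)]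

theorem norm_le_norm_dil {w : Fin n → ℝ} (hw : ∀ l, 0 < w l) {s : ℝ} (hs : 0 ≤ s) (u : Fin n → ℝ) :
    ‖u‖ ≤ ‖dil w s u‖ := by
  rw [pi_norm_le_iff_of_nonneg (norm_nonneg _)]
  intro l
  refine le_trans ?_ (norm_le_pi_norm _ l)
  rw [dil, norm_mul, Real.norm_eq_abs (Real.exp _), Real.abs_exp]
  exact le_mul_of_one_le_left (norm_nonneg _) (Real.one_le_exp (mul_nonneg (hw l).le hs))

theorem norm_dil_le {w : Fin n → ℝ} (hw : ∀ l, 0 < w l) {s : ℝ} (hs : s ≤ 1) (u : Fin n → ℝ) :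
    ‖dil w s u‖ ≤ Real.exp (∑ l, w l) * ‖u‖ := by
  rw [pi_norm_le_iff_of_nonneg (by positivity)]
  intro l
  rw [dil, norm_mul, Real.norm_eq_abs (Real.exp _), Real.abs_exp]
  refine mul_le_mul (Real.exp_le_exp.2 ?_) (norm_le_pi_norm u l) (norm_nonneg _) (Real.exp_nonneg _)
  exact (mul_le_of_le_one_right (hw l).le hs).trans
    (Finset.single_le_sum (f := w) (fun l _ => (hw l).le) (Finset.mem_univ l))

theorem integral_eq_integral_dil {w : Fin n → ℝ} (hw : ∀ l, 0 < w l) {h : (Fin n → ℝ) → ℂ}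
    (hh : Continuous h) {δ : ℝ} (h0 : ∀ x, δ < ‖x‖ → h x = 0) :
    ∫ x, h x = ∫ u, ∫ s in (0 : ℝ)..1, Real.exp ((∑ l, w l) * s) • h (dil w s u) := by
  rw [← intervalIntegral_integral_swap]
  · simp only [integral_comp_dil w _ hh]
    simp
  · rw [← Measure.restrict_univ (μ := (volume : Measure (Fin n → ℝ))), Measure.prod_restrict]
    have hcont : Continuous (Function.uncurry fun (s : ℝ) (u : Fin n → ℝ) =>
        Real.exp ((∑ l, w l) * s) • h (dil w s u)) := by
      have h1 : Continuous fun p : ℝ × (Fin n → ℝ) => Real.exp ((∑ l, w l) * p.1) := by fun_prop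
      exact h1.smul (hh.comp (continuous_dil w))
    refine IntegrableOn.of_forall_sdiff_eq_zero (s := Set.Icc 0 1 ×ˢ Metric.closedBall 0 δ)
      (hcont.continuousOn.integrableOn_compact (isCompact_Icc.prod (isCompact_closedBall _ _)))
      (measurableSet_uIoc.prod MeasurableSet.univ) ?_
    rintro ⟨s, u⟩ ⟨⟨hs, -⟩, hn⟩
    rw [Set.uIoc_of_le zero_le_one] at hs
    have hu : δ < ‖u‖ := by
      by_contra! hle
      exact hn ⟨⟨hs.1.le, hs.2⟩, by simpa using hle⟩
    have := h0 _ (hu.trans_le (norm_le_norm_dil hw hs.1.le u))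
    simp only [Function.uncurry, this, smul_zero]

end Averaging

section Leaf

variable {n : ℕ}

theorem one_add_norm_rpow_le {ι : Type*} [Fintype ι] [Nonempty ι] {e : ℝ} (he : e ≤ 0)
    {c p b : ι → ℝ} {N D M : ℝ} (hD : 0 ≤ D) (hM : 0 ≤ M) (hN : 0 ≤ N) (hc : N ≤ D * ‖c‖)
    (hb : ∀ i, |b i| ≤ M * |p i|) :
    (1 + ‖fun i => c i * p i‖) ^ e ≤ (1 + D * M) ^ (-e) * ∑ i, (1 + N * |b i|) ^ e := by
  obtain ⟨i, hi⟩ := Finite.exists_max fun i => |c i|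
  have hci : ‖c‖ ≤ |c i| := (pi_norm_le_iff_of_nonneg (abs_nonneg _)).2 hi
  set y : ι → ℝ := fun i => c i * p i with hy
  have hyi : |c i| * |p i| ≤ ‖y‖ := by
    rw [← abs_mul]; exact norm_le_pi_norm y i
  have hL : 0 < 1 + D * M := by positivity
  have h1 : 1 + N * |b i| ≤ (1 + D * M) * (1 + ‖y‖) := by
    have h2 : N * |b i| ≤ D * |c i| * (M * |p i|) :=
      mul_le_mul (hc.trans (mul_le_mul_of_nonneg_left hci hD)) (hb i) (abs_nonneg _) (by positivity)
    have h3 : D * M * (|c i| * |p i|) ≤ D * M * ‖y‖ :=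
      mul_le_mul_of_nonneg_left hyi (by positivity)
    have h4 := norm_nonneg y
    have h5 : 0 ≤ D * M := by positivity
    nlinarith
  have h6 := Real.rpow_le_rpow_of_nonpos (by positivity) h1 he
  rw [Real.mul_rpow hL.le (by positivity)] at h6
  have h7 : (1 + N * |b i|) ^ e ≤ ∑ i, (1 + N * |b i|) ^ e :=
    Finset.single_le_sum (f := fun i => (1 + N * |b i|) ^ e) (fun i _ => by positivity)
      (Finset.mem_univ i)
  calc (1 + ‖y‖) ^ e = (1 + D * M) ^ (-e) * ((1 + D * M) ^ e * (1 + ‖y‖) ^ e) := by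
        rw [← mul_assoc, ← Real.rpow_add hL]; simp
    _ ≤ _ := mul_le_mul_of_nonneg_left (h6.trans h7) (by positivity)

theorem exists_coords {ι : Type*} [Fintype ι] {B : ι → ι → ℝ} (hB : LinearIndependent ℝ B)
    (v : ι → ℝ) : ∃ c : ι → ℝ, v = ∑ i, c i • B i := by
  classical
  rcases isEmpty_or_nonempty ι with h | h
  · exact ⟨0, Subsingleton.elim _ _⟩
  · let b := basisOfLinearIndependentOfCardEqFinrank hB (by simp)
    refine ⟨fun i => b.repr v i, ?_⟩
    conv_lhs => rw [← b.sum_repr v]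
    simp [b]

theorem lin_sum_smul {ι κ : Type*} [Fintype ι] [Fintype κ] (Φ : ι → (Fin n → ℝ) → ℝ)
    (c : κ → ℝ) (B : κ → ι → ℝ) (x : Fin n → ℝ) :
    lin Φ (∑ i, c i • B i) x = ∑ i, c i * lin Φ (B i) x := by
  simp only [lin, Finset.sum_apply, Pi.smul_apply, smul_eq_mul, Finset.sum_mul, Finset.mul_sum]
  rw [Finset.sum_comm]
  exact Finset.sum_congr rfl fun _ _ => Finset.sum_congr rfl fun _ _ => by ring

end Leaf

section LeafBound

variable {n m : ℕ}

theorem exists_leaf_pointwise {Φ : Fin (m + 1) → (Fin n → ℝ) → ℝ} {τ : (Fin n → ℝ) → (Fin n → ℝ)}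
    {r : (Fin n → ℝ) → ℝ} (hτ : Good τ r) (hr : Mono r) {B : Fin (m + 1) → Fin (m + 1) → ℝ}
    {α : Fin (m + 1) → Fin n → ℕ} {U : Fin (m + 1) → (Fin n → ℝ) → ℝ}
    (hB : LinearIndependent ℝ B) (hα : Function.Injective α) (hα0 : ∀ i, α i ≠ 0)
    (hU : ∀ i, AnalyticAt ℝ (U i) 0) (hU0 : ∀ i, U i 0 ≠ 0)
    (hBU : ∀ i, (fun x => lin Φ (B i) (τ x)) =ᶠ[𝓝 0] fun x => monom (α i) x * U i x)
    {W : Fin (m + 1) → Set (Fin n → ℝ)} (hW : ∀ i, W i ∈ 𝓝 0) :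
    ∃ w : Fin n → ℝ, (∀ l, 0 < w l) ∧ ∃ δ > 0, ∀ φ : (Fin n → ℝ) → ℝ, ContDiff ℝ 1 φ →
      (∀ x, δ < ‖x‖ → φ x = 0) → ∃ K : ℝ, 0 ≤ K ∧ ∀ (v : Fin (m + 1) → ℝ) (u : Fin n → ℝ),
        ‖∫ s in (0 : ℝ)..1, Real.exp ((∑ l, w l) * s) • ((φ (dil w s u) * |r (dil w s u)|) •
            cexp (I * (lin Φ v (τ (dil w s u)) : ℝ)))‖ ≤
          K * ((∑ i, (W i).indicator
            (fun x => (1 + ‖v‖ * |lin Φ (B i) x|) ^ (-(1 : ℝ) / (m + 1))) (τ u)) * |r u|) := by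
  obtain ⟨w, hw, R, hR, hray⟩ := exists_ray_bound hα hα0 hU hU0
  obtain ⟨β, V, hV, hV0, hrV⟩ := hr
  have hτ0 : Tendsto τ (𝓝 0) (𝓝 0) := by simpa [hτ.zero] using hτ.cont.tendsto 0
  have hev : ∀ᶠ x in 𝓝 (0 : Fin n → ℝ), (AnalyticAt ℝ V x ∧ |V 0| / 2 < |V x| ∧
      r x = monom β x * V x) ∧ ∀ i, lin Φ (B i) (τ x) = monom (α i) x * U i x ∧
      |U i x| < |U i 0| + 1 ∧ τ x ∈ W i := by
    refine (hV.eventually_analyticAt.and ((hV.continuousAt.abs.eventually_const_lt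
      (by linarith [abs_pos.2 hV0])).and hrV)).and (eventually_all.2 fun i => ?_)
    exact (hBU i).and (((hU i).continuousAt.abs.eventually_lt_const (by linarith)).and
      (hτ0 (hW i)))
  obtain ⟨R3, hR3, hball⟩ := Metric.eventually_nhds_iff_ball.1 hev
  set R' := min (R / 2) (R3 / 2) with hR'
  have hR'0 : 0 < R' := lt_min (by linarith) (by linarith)
  have hR'R : R' < R := (min_le_left _ _).trans_lt (by linarith)
  have hR'3 : Metric.closedBall (0 : Fin n → ℝ) R' ⊆ Metric.ball 0 R3 :=
    Metric.closedBall_subset_ball ((min_le_right _ _).trans_lt (by linarith))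
  refine ⟨w, hw, R' / Real.exp (∑ l, w l), by positivity, fun φ hφ hφ0 => ?_⟩
  set κ' := (∑ l, w l) + ∑ l, w l * β l with hκ'
  obtain ⟨C, hC, hray⟩ := hray R' hR'R κ' (fun x => φ x * |V x|) fun x hx => by
    have h := (hball x (hR'3 hx)).1
    have hVx : V x ≠ 0 := abs_pos.1 (lt_of_le_of_lt (by positivity) h.2.1)
    exact hφ.contDiffAt.mul (h.1.contDiffAt.abs hVx)
  set e : ℝ := -(1 : ℝ) / (m + 1) with he
  have he0 : e ≤ 0 := by rw [he]; exact div_nonpos_of_nonpos_of_nonneg (by norm_num) (by positivity)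
  set D := ∑ i, ‖B i‖ with hD
  set M := ∑ i, (|U i 0| + 1) with hM
  have hD0 : 0 ≤ D := by positivity
  have hM0 : 0 ≤ M := by positivity
  refine ⟨2 / |V 0| * (C * (1 + D * M) ^ (-e)), by positivity, fun v u => ?_⟩
  have hrhs : 0 ≤ (∑ i, (W i).indicator (fun x => (1 + ‖v‖ * |lin Φ (B i) x|) ^ e) (τ u)) *
      |r u| :=
    mul_nonneg (Finset.sum_nonneg fun i _ => Set.indicator_nonneg (fun x _ => by positivity) _)
      (abs_nonneg _)
  by_cases hu : R' / Real.exp (∑ l, w l) < ‖u‖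
  · have hz : ∀ s ∈ Set.uIcc (0 : ℝ) 1, Real.exp ((∑ l, w l) * s) • ((φ (dil w s u) *
        |r (dil w s u)|) • cexp (I * (lin Φ v (τ (dil w s u)) : ℝ))) = 0 := fun s hs => by
      rw [Set.uIcc_of_le zero_le_one] at hs
      rw [hφ0 _ (hu.trans_le (norm_le_norm_dil hw hs.1 u))]; simp
    rw [intervalIntegral.integral_congr hz]
    simp only [intervalIntegral.integral_zero, norm_zero]
    positivity
  push Not at hu
  have hdil : ∀ s ∈ Set.Icc (0 : ℝ) 1, dil w s u ∈ Metric.closedBall 0 R' := fun s hs => by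
    rw [mem_closedBall_zero_iff]
    refine (norm_dil_le hw hs.2 u).trans ?_
    calc _ ≤ Real.exp (∑ l, w l) * (R' / Real.exp (∑ l, w l)) := by gcongr
      _ = R' := by field_simp
  have huR : u ∈ Metric.closedBall (0 : Fin n → ℝ) R' := by
    rw [mem_closedBall_zero_iff]
    exact (norm_le_norm_dil hw zero_le_one u).trans
      (mem_closedBall_zero_iff.1 (hdil 1 (by simp)))
  obtain ⟨c, hc⟩ := exists_coords hB v
  have hcong : ∀ s ∈ Set.uIcc (0 : ℝ) 1, Real.exp ((∑ l, w l) * s) • ((φ (dil w s u) *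
      |r (dil w s u)|) • cexp (I * (lin Φ v (τ (dil w s u)) : ℝ))) = ((|monom β u| : ℝ) : ℂ) *
        (((Real.exp (κ' * s) * (φ (dil w s u) * |V (dil w s u)|) : ℝ) : ℂ) *
            cexp (I * ((∑ i, c i * (monom (α i) (dil w s u) * U i (dil w s u)) : ℝ) : ℂ))) := by
    intro s hs
    rw [Set.uIcc_of_le zero_le_one] at hs
    obtain ⟨⟨-, -, h1⟩, h2⟩ := hball _ (hR'3 (hdil s hs))
    have h3 : lin Φ v (τ (dil w s u)) =
        ∑ i, c i * (monom (α i) (dil w s u) * U i (dil w s u)) := by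
      rw [hc, lin_sum_smul]
      exact Finset.sum_congr rfl fun i _ => by rw [(h2 i).1]
    rw [← h3, h1, monom_dil, abs_mul, abs_mul, Real.abs_exp, hκ', add_mul, Real.exp_add]
    simp only [Complex.real_smul]
    push_cast
    ring
  rw [intervalIntegral.integral_congr hcong, intervalIntegral.integral_const_mul, norm_mul,
    Complex.norm_real, norm_abs_eq_norm, Real.norm_eq_abs]
  obtain ⟨⟨-, h1, h1'⟩, h2⟩ := hball u (hR'3 huR)
  have hind : ∑ i, (W i).indicator (fun x => (1 + ‖v‖ * |lin Φ (B i) x|) ^ e) (τ u) =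
      ∑ i, (1 + ‖v‖ * |lin Φ (B i) (τ u)|) ^ e :=
    Finset.sum_congr rfl fun i _ => Set.indicator_of_mem (h2 i).2.2 _
  have hpw := one_add_norm_rpow_le (c := c) (p := fun i => monom (α i) u)
    (b := fun i => lin Φ (B i) (τ u)) (N := ‖v‖) he0 hD0 hM0 (norm_nonneg _) (by
      rw [hc, hD, Finset.sum_mul]
      refine (norm_sum_le _ _).trans (Finset.sum_le_sum fun i _ => ?_)
      rw [norm_smul, mul_comm]
      exact mul_le_mul_of_nonneg_left (norm_le_pi_norm c i) (norm_nonneg _)) (fun i => by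
      rw [(h2 i).1, abs_mul, mul_comm]
      refine mul_le_mul_of_nonneg_right ((h2 i).2.1.le.trans ?_) (abs_nonneg _)
      exact Finset.single_le_sum (f := fun i => |U i 0| + 1) (fun i _ => by positivity)
        (Finset.mem_univ i))
  have hmon : |monom β u| ≤ 2 / |V 0| * |r u| := by
    have hV0' := abs_pos.2 hV0
    rw [h1', abs_mul, div_mul_eq_mul_div, le_div_iff₀ hV0']
    nlinarith [abs_nonneg (monom β u)]
  rw [hind]
  calc _ ≤ (2 / |V 0| * |r u|) * (C * ((1 + D * M) ^ (-e) *
        ∑ i, (1 + ‖v‖ * |lin Φ (B i) (τ u)|) ^ e)) := by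
        refine mul_le_mul hmon ((hray u c hdil).trans ?_) (norm_nonneg _) (by positivity)
        exact mul_le_mul_of_nonneg_left hpw hC
    _ = _ := by ring

end LeafBound

section LeafBd

variable {n m : ℕ} {Ξ : Type*}

theorem bd_of_leaf {Φ : Fin (m + 1) → (Fin n → ℝ) → ℝ} (hΦ : ∀ l, Continuous (Φ l))
    {v : Ξ → Fin (m + 1) → ℝ} {b : Ξ → ℝ} (hb : ∀ ξ, 0 ≤ b ξ)
    (hint : ∀ a : Fin (m + 1) → ℝ, a ≠ 0 → ∃ W ∈ 𝓝 (0 : Fin n → ℝ), ∃ C : ℝ, ∀ ξ,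
      ∫⁻ x in W, ENNReal.ofReal ((1 + ‖v ξ‖ * |lin Φ a x|) ^ (-(1 : ℝ) / (m + 1))) ≤
        ENNReal.ofReal (C * b ξ))
    {τ : (Fin n → ℝ) → (Fin n → ℝ)} {r : (Fin n → ℝ) → ℝ} (hτ : Good τ r) (hr : Mono r)
    (hd : Dom τ r) {B : Fin (m + 1) → Fin (m + 1) → ℝ}
    {α : Fin (m + 1) → Fin n → ℕ} {U : Fin (m + 1) → (Fin n → ℝ) → ℝ}
    (hB : LinearIndependent ℝ B) (hα : Function.Injective α) (hα0 : ∀ i, α i ≠ 0)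
    (hU : ∀ i, AnalyticAt ℝ (U i) 0) (hU0 : ∀ i, U i 0 ≠ 0)
    (hBU : ∀ i, (fun x => lin Φ (B i) (τ x)) =ᶠ[𝓝 0] fun x => monom (α i) x * U i x) :
    Bd (fun ξ x => cexp (I * (lin Φ (v ξ) x : ℝ))) b τ r := by
  choose W hW C hC using fun i => hint (B i) (hB.ne_zero i)
  have hW' : ∀ i, interior (W i) ∈ 𝓝 0 := fun i => interior_mem_nhds.2 (hW i)
  obtain ⟨w, hw, δ, hδ, H⟩ := exists_leaf_pointwise hτ hr hB hα hα0 hU hU0 hBU hW'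
  obtain ⟨Cd, hCd⟩ := hd
  have hlin : ∀ a, Continuous (lin Φ a) := fun a => by
    unfold lin; exact continuous_finsetSum _ fun l _ => continuous_const.mul (hΦ l)
  refine ⟨δ, hδ, fun φ hφ hφ0 => ?_⟩
  obtain ⟨K, hK, H⟩ := H φ hφ hφ0
  refine ⟨K * ∑ i, Cd * |C i|, fun ξ => ?_⟩
  set e : ℝ := -(1 : ℝ) / (m + 1) with he
  have hτc := hτ.cont
  have hrc := hτ.contw
  rw [integral_eq_integral_dil hw (h := fun u => (φ u * |r u|) • cexp (I * (lin Φ (v ξ) (τ u) : ℝ)))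
    ?_ (fun x hx => by rw [hφ0 x hx]; simp)]
  swap
  · have h1 : Continuous fun u => lin Φ (v ξ) (τ u) := (hlin _).comp hτc
    have h2 := hφ.continuous
    fun_prop
  set F : Fin (m + 1) → (Fin n → ℝ) → ℝ := fun i => (interior (W i)).indicator
    (fun x => (1 + ‖v ξ‖ * |lin Φ (B i) x|) ^ e) with hF
  have hF0 : ∀ i x, 0 ≤ F i x := fun i x => Set.indicator_nonneg (fun x _ => by positivity) _
  have hFm : ∀ i, Measurable (F i) := fun i => by
    refine Measurable.indicator ?_ isOpen_interior.measurableSet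
    have := (hlin (B i)).measurable
    fun_prop
  have hFint : ∀ i, ∫⁻ x, ENNReal.ofReal (F i x) ≤ ENNReal.ofReal (|C i| * b ξ) := fun i => by
    have h1 : ∀ x, ENNReal.ofReal (F i x) = (interior (W i)).indicator
        (fun x => ENNReal.ofReal ((1 + ‖v ξ‖ * |lin Φ (B i) x|) ^ e)) x := fun x => by
      simp only [hF, Set.indicator]; split_ifs <;> simp
    simp only [h1]
    rw [lintegral_indicator isOpen_interior.measurableSet]
    refine (lintegral_mono_set interior_subset).trans ((hC i ξ).trans ?_)
    exact ENNReal.ofReal_le_ofReal (mul_le_mul_of_nonneg_right (le_abs_self _) (hb ξ))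
  have hmain : ‖∫ u, ∫ s in (0 : ℝ)..1, Real.exp ((∑ l, w l) * s) • ((φ (dil w s u) *
      |r (dil w s u)|) • cexp (I * (lin Φ (v ξ) (τ (dil w s u)) : ℝ)))‖ₑ ≤
      ENNReal.ofReal (K * (∑ i, Cd * |C i|) * b ξ) := by
    refine (enorm_integral_le_lintegral_enorm _).trans ?_
    calc _ ≤ ∫⁻ u, ∑ i, ENNReal.ofReal K * (ENNReal.ofReal (F i (τ u)) * ‖r u‖ₑ) := by
          refine lintegral_mono fun u => ?_
          rw [← ofReal_norm]
          refine (ENNReal.ofReal_le_ofReal (H (v ξ) u)).trans ?_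
          rw [ENNReal.ofReal_mul hK, ENNReal.ofReal_mul (Finset.sum_nonneg fun i _ => hF0 i _),
            ENNReal.ofReal_sum_of_nonneg fun i _ => hF0 i _, Finset.sum_mul, Finset.mul_sum,
            ← Real.enorm_eq_ofReal_abs]
      _ = ∑ i, ENNReal.ofReal K * ∫⁻ u, ENNReal.ofReal (F i (τ u)) * ‖r u‖ₑ := by
          have hm : ∀ i, Measurable fun u => ENNReal.ofReal (F i (τ u)) * ‖r u‖ₑ := fun i =>
            ((hFm i).comp hτc.measurable).ennreal_ofReal.mul hrc.measurable.enorm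
          rw [lintegral_finsetSum _ fun i _ => (hm i).const_mul _]
          exact Finset.sum_congr rfl fun i _ => lintegral_const_mul _ (hm i)
      _ ≤ ∑ i, ENNReal.ofReal (K * (Cd * (|C i| * b ξ))) := by
          refine Finset.sum_le_sum fun i _ => ?_
          rw [ENNReal.ofReal_mul hK, ENNReal.ofReal_mul (p := (Cd : ℝ)) Cd.coe_nonneg, ENNReal.ofReal_coe_nnreal]
          gcongr
          exact (hCd _ (hFm i).ennreal_ofReal).trans (by gcongr; exact hFint i)
      _ = _ := by
          rw [← ENNReal.ofReal_sum_of_nonneg fun i _ => by have := hb ξ; positivity]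
          congr 1
          rw [Finset.mul_sum, Finset.sum_mul]
          exact Finset.sum_congr rfl fun i _ => by ring
  rw [← ofReal_norm] at hmain
  have h0 : 0 ≤ K * (∑ i, Cd * |C i|) * b ξ := by have := hb ξ; positivity
  exact (ENNReal.ofReal_le_ofReal_iff h0).1 hmain

/-- Decay of an oscillatory integral whose phase runs through the span of analytic functions
`Φ l`, given decay of the non-oscillatory majorants. -/
theorem bd_id {Φ : Fin (m + 1) → (Fin n → ℝ) → ℝ} (hΦ : ∀ l, Continuous (Φ l))
    (hΦa : ∀ l, AnalyticAt ℝ (Φ l) 0) (hΦ0 : ∀ l, Φ l 0 = 0)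
    (hind : ∀ a : Fin (m + 1) → ℝ, a ≠ 0 → ¬ lin Φ a =ᶠ[𝓝 0] 0)
    {v : Ξ → Fin (m + 1) → ℝ} {b : Ξ → ℝ} (hb : ∀ ξ, 0 ≤ b ξ)
    (hint : ∀ a : Fin (m + 1) → ℝ, a ≠ 0 → ∃ W ∈ 𝓝 (0 : Fin n → ℝ), ∃ C : ℝ, ∀ ξ,
      ∫⁻ x in W, ENNReal.ofReal ((1 + ‖v ξ‖ * |lin Φ a x|) ^ (-(1 : ℝ) / (m + 1))) ≤
        ENNReal.ofReal (C * b ξ)) :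
    Bd (fun ξ x => cexp (I * (lin Φ (v ξ) x : ℝ))) b (fun x : Fin n → ℝ => x) (fun _ => 1) := by
  refine Red.bd (fun ξ => ?_) ?_ ((red_basis hΦa hΦ0 hind).dom good_id dom_id) good_id
  · have : Continuous (lin Φ (v ξ)) := by
      unfold lin; exact continuous_finsetSum _ fun l _ => continuous_const.mul (hΦ l)
    fun_prop
  · rintro τ r hg ⟨hd, -, hm, B, α, U, hB, hα, hα0, h⟩
    exact bd_of_leaf hΦ hb hint hg hm hd hB hα hα0 (fun i => (h i).1) (fun i => (h i).2.1)
      fun i => (h i).2.2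

end LeafBd

section Distribution

variable {X : Type*} [MeasurableSpace X] {μ : Measure X}

theorem lintegral_one_add_rpow_le {t : X → ℝ} (ht : Measurable t) (ht0 : ∀ x, 0 ≤ t x)
    {D g e : ℝ} (hD : 0 ≤ D) (he : 0 ≤ e) (hge : g < e)
    (h : ∀ s, 1 ≤ s → μ {x | t x < s} ≤ ENNReal.ofReal (D * s ^ g)) :
    ∫⁻ x, ENNReal.ofReal ((1 + t x) ^ (-e)) ∂μ ≤
      ENNReal.ofReal (D * (2 ^ g * (1 - (2 : ℝ) ^ (g - e))⁻¹)) := by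
  have hm : ∀ j : ℕ, MeasurableSet {x | t x < (2 : ℝ) ^ (j + 1)} := fun j =>
    measurableSet_lt ht measurable_const
  have hp : ∀ x, ENNReal.ofReal ((1 + t x) ^ (-e)) ≤
      ∑' j : ℕ, {x | t x < (2 : ℝ) ^ (j + 1)}.indicator
        (fun _ => ENNReal.ofReal (((2 : ℝ) ^ j) ^ (-e))) x := fun x => by
    obtain ⟨j, hj1, hj2⟩ : ∃ j : ℕ, (2 : ℝ) ^ j ≤ 1 + t x ∧ t x < 2 ^ (j + 1) := by
      obtain ⟨j, hj1, hj2⟩ := exists_nat_pow_near (x := 1 + t x) (by linarith [ht0 x])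
        (one_lt_two (α := ℝ))
      exact ⟨j, hj1, by linarith⟩
    refine le_trans ?_ (ENNReal.le_tsum j)
    rw [Set.indicator_of_mem (by exact hj2)]
    exact ENNReal.ofReal_le_ofReal
      (Real.rpow_le_rpow_of_nonpos (by positivity) hj1 (neg_nonpos.2 he))
  have hq0 : 0 < (2 : ℝ) ^ (g - e) := by positivity
  have hq1 : (2 : ℝ) ^ (g - e) < 1 := Real.rpow_lt_one_of_one_lt_of_neg one_lt_two (by linarith)
  have hs := (hasSum_geometric_of_lt_one hq0.le hq1).mul_left (D * 2 ^ g)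
  calc _ ≤ ∫⁻ x, ∑' j : ℕ, {x | t x < (2 : ℝ) ^ (j + 1)}.indicator
        (fun _ => ENNReal.ofReal (((2 : ℝ) ^ j) ^ (-e))) x ∂μ := lintegral_mono hp
    _ = ∑' j : ℕ, ENNReal.ofReal (((2 : ℝ) ^ j) ^ (-e)) * μ {x | t x < (2 : ℝ) ^ (j + 1)} := by
        rw [lintegral_tsum fun j => (measurable_const.indicator (hm j)).aemeasurable]
        exact tsum_congr fun j => lintegral_indicator_const (hm j) _
    _ ≤ ∑' j : ℕ, ENNReal.ofReal (D * 2 ^ g * ((2 : ℝ) ^ (g - e)) ^ j) := by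
        refine ENNReal.tsum_le_tsum fun j => ?_
        refine (mul_le_mul_right (h _ (one_le_pow₀ one_le_two)) _).trans ?_
        rw [← ENNReal.ofReal_mul (by positivity)]
        refine ENNReal.ofReal_le_ofReal (le_of_eq ?_)
        simp only [← Real.rpow_natCast, ← Real.rpow_mul two_pos.le]
        rw [mul_left_comm, ← Real.rpow_add two_pos, mul_assoc, ← Real.rpow_add two_pos]
        congr 2
        push_cast
        ring
    _ = _ := by
        rw [← ENNReal.ofReal_tsum_of_nonneg (fun j => by positivity) hs.summable, hs.tsum_eq,
          mul_assoc]

theorem exists_lintegral_le_of_distribution [IsFiniteMeasure μ] {h : X → ℝ} (hh : Measurable h)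
    {g e : ℝ} {k : ℕ} (hg : 0 < g) (hge : g < e) {ε₀ C : ℝ} (hε₀ : 0 < ε₀) (hC : 0 ≤ C)
    (H : ∀ ε, 0 < ε → ε < ε₀ → μ {x | |h x| < ε} ≤
      ENNReal.ofReal (C * (ε ^ g * Real.log (1 / ε) ^ k))) {c : ℝ} (hc : 1 ≤ c) :
    ∃ C', ∀ lam N : ℝ, 2 < lam → lam ≤ c * N →
      ∫⁻ x, ENNReal.ofReal ((1 + N * |h x|) ^ (-e)) ∂μ ≤
        ENNReal.ofReal (C' * (lam ^ (-g) * Real.log lam ^ k)) := by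
  wlog hε1 : ε₀ ≤ 1 generalizing ε₀
  · exact this (ε₀ := min ε₀ 1) (by positivity) (fun ε h0 h1 => H ε h0 (h1.trans_le
      (min_le_left _ _))) (min_le_right _ _)
  have hl2 : 0 < Real.log 2 := Real.log_pos one_lt_two
  set M := μ.real Set.univ with hM
  set C1 := C + M * (ε₀ ^ g)⁻¹ * (Real.log 2 ^ k)⁻¹ with hC1
  have hC10 : 0 ≤ C1 := by positivity
  refine ⟨c ^ e * (C1 * (2 ^ g * (1 - (2 : ℝ) ^ (g - e))⁻¹)), fun lam N hlam hN => ?_⟩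
  have hlam0 : 0 < lam := by linarith
  have hlog : Real.log 2 ≤ Real.log lam := Real.log_le_log two_pos hlam.le
  set D := C1 * (lam ^ (-g) * Real.log lam ^ k) with hD
  have hlog0 : 0 < Real.log lam := hl2.trans_le hlog
  have hD0 : 0 ≤ D := by positivity
  have key : ∀ s, 1 ≤ s → μ {x | lam * |h x| < s} ≤ ENNReal.ofReal (D * s ^ g) := by
    intro s hs
    have hs0 : 0 < s := by linarith
    have hset : {x | lam * |h x| < s} = {x | |h x| < s / lam} := by
      ext x; simp only [Set.mem_ofPred_eq]; rw [lt_div_iff₀ hlam0, mul_comm]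
    have hpow : (s / lam) ^ g = s ^ g * lam ^ (-g) := by
      rw [Real.div_rpow hs0.le hlam0.le, Real.rpow_neg hlam0.le, div_eq_mul_inv]
    rw [hset]
    by_cases hsl : s / lam < ε₀
    · refine (H _ (by positivity) hsl).trans (ENNReal.ofReal_le_ofReal ?_)
      rw [hpow, hD]
      have h1 : Real.log (1 / (s / lam)) ≤ Real.log lam := by
        refine Real.log_le_log (by positivity) ?_
        rw [one_div_div]
        exact div_le_self hlam0.le hs
      have h2 : 0 ≤ Real.log (1 / (s / lam)) := by
        refine Real.log_nonneg ?_
        rw [one_div]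
        exact (one_le_inv₀ (by positivity)).2 (hsl.le.trans hε1)
      have h3 := pow_le_pow_left₀ h2 h1 k
      have h4 : C ≤ C1 := le_add_of_nonneg_right (by positivity)
      calc _ ≤ C1 * (s ^ g * lam ^ (-g) * Real.log lam ^ k) := by gcongr
        _ = _ := by ring
    · push Not at hsl
      refine (measure_mono (Set.subset_univ _)).trans ?_
      rw [← ENNReal.ofReal_toReal (measure_ne_top μ Set.univ)]
      refine ENNReal.ofReal_le_ofReal ?_
      have h1 : ε₀ ^ g ≤ s ^ g * lam ^ (-g) := by
        rw [← hpow]; exact Real.rpow_le_rpow hε₀.le hsl hg.le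
      have h2 : Real.log 2 ^ k ≤ Real.log lam ^ k := pow_le_pow_left₀ hl2.le hlog k
      have h3 : M * (ε₀ ^ g)⁻¹ * (Real.log 2 ^ k)⁻¹ ≤ C1 := le_add_of_nonneg_left hC
      calc M = M * (ε₀ ^ g)⁻¹ * (Real.log 2 ^ k)⁻¹ * (ε₀ ^ g * Real.log 2 ^ k) := by
            have := (Real.rpow_pos_of_pos hε₀ g).ne'
            field_simp
        _ ≤ C1 * (s ^ g * lam ^ (-g) * Real.log lam ^ k) := by gcongr
        _ = _ := by ring
  have hmeas : Measurable fun x => lam * |h x| := by fun_prop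
  have hfin := lintegral_one_add_rpow_le (e := e) hmeas (fun x => by positivity) hD0
    (hg.trans hge).le hge key
  have hc0 : 0 < c := by linarith
  have hN0 : 0 < N := by
    by_contra! hN'
    nlinarith
  have hpt : ∀ x, (1 + N * |h x|) ^ (-e) ≤ c ^ e * (1 + lam * |h x|) ^ (-e) := fun x => by
    have h1 : 1 + lam * |h x| ≤ c * (1 + N * |h x|) := by
      have := mul_le_mul_of_nonneg_right hN (abs_nonneg (h x))
      linarith
    have h2 := Real.rpow_le_rpow_of_nonpos (by positivity) h1 (z := -e) (by linarith)
    rw [Real.mul_rpow hc0.le (by positivity)] at h2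
    calc _ = c ^ e * (c ^ (-e) * (1 + N * |h x|) ^ (-e)) := by
          rw [← mul_assoc, ← Real.rpow_add hc0]; simp
      _ ≤ _ := by gcongr
  calc _ ≤ ∫⁻ x, ENNReal.ofReal (c ^ e) * ENNReal.ofReal ((1 + lam * |h x|) ^ (-e)) ∂μ := by
        refine lintegral_mono fun x => ?_
        rw [← ENNReal.ofReal_mul (by positivity)]
        exact ENNReal.ofReal_le_ofReal (hpt x)
    _ = ENNReal.ofReal (c ^ e) * ∫⁻ x, ENNReal.ofReal ((1 + lam * |h x|) ^ (-e)) ∂μ :=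
        lintegral_const_mul' _ _ ENNReal.ofReal_ne_top
    _ ≤ _ := by
        refine (mul_le_mul_right hfin _).trans ?_
        rw [← ENNReal.ofReal_mul (by positivity), hD]
        refine ENNReal.ofReal_le_ofReal (le_of_eq ?_)
        ring

end Distribution

section Gradient

variable {n : ℕ}

theorem exists_volume_sublevel_le {b : (Fin n → ℝ) → ℝ} (hb : Continuous b)
    {L : (Fin n → ℝ) →L[ℝ] ℝ} (hbL : HasStrictFDerivAt b L 0) (hL : L ≠ 0) :
    ∃ ρ > 0, ∃ C : ℝ, 0 ≤ C ∧ ∀ ε : ℝ, 0 < ε →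
      volume.restrict (Metric.closedBall (0 : Fin n → ℝ) ρ) {x | |b x| < ε} ≤
        ENNReal.ofReal (C * ε) := by
  obtain ⟨i, hi⟩ : ∃ i, L (Pi.single i 1) ≠ 0 := by
    by_contra! h
    refine hL (ContinuousLinearMap.coe_injective (LinearMap.pi_ext' fun i => ?_))
    ext
    simpa using h i
  set d := |L (Pi.single i 1)| with hd
  have hd0 : 0 < d := abs_pos.2 hi
  have hev := hbL.isLittleO.def (half_pos hd0)
  obtain ⟨ρ, hρ, hball⟩ := Metric.nhds_basis_closedBall.eventually_iff.1 hev
  have hρ' : 0 < ρ := hρ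
  have hsub : ∀ x, ∀ s t : ℝ, Function.update x i s ∈ Metric.closedBall (0 : Fin n → ℝ) ρ →
      Function.update x i t ∈ Metric.closedBall (0 : Fin n → ℝ) ρ →
      d / 2 * |s - t| ≤ |b (Function.update x i s) - b (Function.update x i t)| := by
    intro x s t hs ht
    have h1 := @hball (Function.update x i s, Function.update x i t) (by
      rw [← closedBall_prod_same]; exact ⟨hs, ht⟩)
    have h2 : Function.update x i s - Function.update x i t = (s - t) • Pi.single i (1 : ℝ) := by
      ext l
      by_cases hl : l = i
      · subst hl; simp
      · simp [hl]
    simp only [h2, map_smul, norm_smul, Pi.norm_single, norm_one, mul_one, smul_eq_mul,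
      Real.norm_eq_abs] at h1
    have h3 : |(s - t) * L (Pi.single i 1)| = |s - t| * d := abs_mul _ _
    have h4 := abs_sub_abs_le_abs_sub ((s - t) * L (Pi.single i 1))
      (b (Function.update x i s) - b (Function.update x i t))
    rw [abs_sub_comm ((s - t) * L (Pi.single i 1)), h3] at h4
    linarith
  refine ⟨ρ, hρ, 4 / d * (2 * ρ)⁻¹ * (volume (Metric.closedBall (0 : Fin n → ℝ) ρ)).toReal,
    by positivity, fun ε hε => ?_⟩
  set K := Metric.closedBall (0 : Fin n → ℝ) ρ with hK
  have hKm : MeasurableSet K := Metric.isClosed_closedBall.measurableSet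
  have hsm : MeasurableSet {x | |b x| < ε} := measurableSet_lt hb.abs.measurable measurable_const
  have hF : MeasurableSet ({x | |b x| < ε} ∩ K) := hsm.inter hKm
  have hup : ∀ x : Fin n → ℝ, Measurable fun t => Function.update x i t := fun x =>
    measurable_update x
  have hmain := lintegral_le_of_update (F := ({x | |b x| < ε} ∩ K).indicator 1)
    (G := K.indicator fun _ => ENNReal.ofReal (4 / d * ε * (2 * ρ)⁻¹))
    (measurable_one.indicator hF) (measurable_const.indicator hKm) i fun x => by
    by_cases hx : ∃ t₀, Function.update x i t₀ ∈ K
    · obtain ⟨t₀, ht₀⟩ := hx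
      have hmem : ∀ t, Function.update x i t ∈ K ↔ t ∈ Set.Icc (-ρ) ρ := fun t => by
        rw [hK, mem_closedBall_zero_iff, pi_norm_le_iff_of_nonneg hρ'.le] at ht₀ ⊢
        rw [Set.mem_Icc, ← abs_le]
        refine ⟨fun h => by simpa using h i, fun h l => ?_⟩
        by_cases hl : l = i
        · subst hl; simpa using h
        · simpa [hl] using ht₀ l
      have hr : ∫⁻ t, K.indicator (fun _ => ENNReal.ofReal (4 / d * ε * (2 * ρ)⁻¹))
          (Function.update x i t) = ENNReal.ofReal (4 / d * ε) := by
        have : (fun t => K.indicator (fun _ => ENNReal.ofReal (4 / d * ε * (2 * ρ)⁻¹))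
            (Function.update x i t)) =
            (Set.Icc (-ρ) ρ).indicator fun _ => ENNReal.ofReal (4 / d * ε * (2 * ρ)⁻¹) := by
          ext t
          simp only [Set.indicator, hmem]
        rw [this, lintegral_indicator_const measurableSet_Icc, Real.volume_Icc,
          ← ENNReal.ofReal_mul (by positivity)]
        congr 1
        field_simp
        ring
      have hl : ∫⁻ t, ({x | |b x| < ε} ∩ K).indicator (1 : (Fin n → ℝ) → ENNReal)
          (Function.update x i t) =
          volume ((fun t => Function.update x i t) ⁻¹' ({x | |b x| < ε} ∩ K)) := by
        rw [← lintegral_indicator_one (hup x hF)]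
        rfl
      rw [hr, hl]
      refine (Real.volume_le_diam _).trans (Metric.ediam_le fun s hs t ht => ?_)
      rw [edist_dist]
      refine ENNReal.ofReal_le_ofReal ?_
      have h1 := hsub x s t hs.2 ht.2
      have h2 : |b (Function.update x i s)| < ε := hs.1
      have h3 : |b (Function.update x i t)| < ε := ht.1
      have h4 := abs_sub_le (b (Function.update x i s)) 0 (b (Function.update x i t))
      rw [sub_zero, zero_sub, abs_neg] at h4
      rw [Real.dist_eq, div_mul_eq_mul_div, le_div_iff₀ hd0]
      linarith
    · push Not at hx
      refine le_of_eq_of_le ?_ zero_le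
      simp [Set.indicator, hx]
  rw [lintegral_indicator_one hF, lintegral_indicator_const hKm] at hmain
  rw [Measure.restrict_apply hsm]
  refine hmain.trans (le_of_eq ?_)
  have hfin : volume K ≠ ⊤ := measure_closedBall_lt_top.ne
  conv_lhs => rw [← ENNReal.ofReal_toReal hfin, ← ENNReal.ofReal_mul (by positivity)]
  congr 1
  ring

end Gradient

section Model

variable {n : ℕ}

theorem EuclideanSpace.norm_le_card_mul {ι : Type*} [Fintype ι] [Nonempty ι]
    (x : EuclideanSpace ℝ ι) :
    ‖x‖ ≤ Fintype.card ι * ‖WithLp.ofLp x‖ := by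
  have hc : (1 : ℝ) ≤ Fintype.card ι := by exact_mod_cast Fintype.card_pos
  rw [EuclideanSpace.norm_eq, Real.sqrt_le_iff]
  refine ⟨by positivity, ?_⟩
  calc ∑ i, ‖x i‖ ^ 2 ≤ ∑ _i : ι, ‖WithLp.ofLp x‖ ^ 2 := by
        gcongr with i
        exact norm_le_pi_norm (WithLp.ofLp x) i
    _ = Fintype.card ι * ‖WithLp.ofLp x‖ ^ 2 := by simp
    _ ≤ (Fintype.card ι * Fintype.card ι) * ‖WithLp.ofLp x‖ ^ 2 := by
        gcongr
        nlinarith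
    _ = _ := by ring

/-- The coordinate functions together with `F`. -/
def coordsSnoc (F : (Fin n → ℝ) → ℝ) : Fin (n + 1) → (Fin n → ℝ) → ℝ :=
  Fin.snoc (α := fun _ => (Fin n → ℝ) → ℝ) (fun i x => x i) F

theorem lin_coordsSnoc (F : (Fin n → ℝ) → ℝ) (a : Fin (n + 1) → ℝ) (x : Fin n → ℝ) :
    lin (coordsSnoc F) a x = (∑ i : Fin n, a i.castSucc * x i) + a (Fin.last n) * F x := by
  simp [lin, coordsSnoc, Fin.sum_univ_castSucc]

theorem hasStrictFDerivAt_lin_coordsSnoc {F : (Fin n → ℝ) → ℝ} (hF : AnalyticAt ℝ F 0)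
    (hdF : fderiv ℝ F 0 = 0) (a : Fin (n + 1) → ℝ) :
    HasStrictFDerivAt (lin (coordsSnoc F) a)
      (∑ i : Fin n, a i.castSucc • ContinuousLinearMap.proj (R := ℝ) (φ := fun _ : Fin n => ℝ) i)
      0 := by
  have h1 := hF.hasStrictFDerivAt
  rw [hdF] at h1
  have h2 := ((∑ i : Fin n, a i.castSucc • ContinuousLinearMap.proj (R := ℝ)
    (φ := fun _ : Fin n => ℝ) i).hasStrictFDerivAt (x := 0)).add (h1.const_mul (a (Fin.last n)))
  rw [smul_zero, add_zero] at h2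
  convert! h2 using 1
  ext x
  simp [lin_coordsSnoc]

theorem sum_smul_proj_ne_zero {a : Fin (n + 1) → ℝ} {i : Fin n} (hi : a i.castSucc ≠ 0) :
    (∑ i : Fin n, a i.castSucc • ContinuousLinearMap.proj (R := ℝ) (φ := fun _ : Fin n => ℝ) i) ≠
      0 := fun h => hi (by
  classical
  have := DFunLike.congr_fun h (Pi.single i 1)
  simpa [Pi.single_apply] using this)

theorem lin_coordsSnoc_of_castSucc_eq_zero (F : (Fin n → ℝ) → ℝ) {a : Fin (n + 1) → ℝ}
    (h : ∀ i : Fin n, a i.castSucc = 0) (x : Fin n → ℝ) :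
    lin (coordsSnoc F) a x = a (Fin.last n) * F x := by
  simp [lin_coordsSnoc, h]

theorem last_ne_zero {a : Fin (n + 1) → ℝ} (ha : a ≠ 0) (h : ∀ i : Fin n, a i.castSucc = 0) :
    a (Fin.last n) ≠ 0 := fun h0 => ha (funext fun i => Fin.lastCases h0 h i)

theorem exists_decay {F : (Fin n → ℝ) → ℝ} (hFc : Continuous F) (hFa : AnalyticAt ℝ F 0)
    (hF0 : F 0 = 0) (hdF : fderiv ℝ F 0 = 0) (hne : ¬ F =ᶠ[𝓝 0] 0) {g : ℝ} {k : ℕ} (hg : 0 < g)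
    (hgn : g < 1 / (n + 1)) {W : Set (Fin n → ℝ)} (hW : W ∈ 𝓝 0) (hWfin : volume W ≠ ⊤)
    {C ε₀ : ℝ} (hC : 0 ≤ C) (hε₀ : 0 < ε₀) (H : ∀ ε, 0 < ε → ε < ε₀ →
      volume.restrict W {x | |F x| < ε} ≤ ENNReal.ofReal (C * (ε ^ g * Real.log (1 / ε) ^ k))) :
    ∃ δ > 0, ∀ φ : (Fin n → ℝ) → ℝ, ContDiff ℝ 1 φ → (∀ x, δ < ‖x‖ → φ x = 0) →
      ∃ C : ℝ, ∀ ξ : EuclideanSpace ℝ (Fin (n + 1)), 2 < ‖ξ‖ →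
        ‖∫ x, φ x • cexp (I * (lin (coordsSnoc F) (-WithLp.ofLp ξ) x : ℝ))‖ ≤
          C * (‖ξ‖ ^ (-g) * Real.log ‖ξ‖ ^ k) := by
  have hcont : ∀ l, Continuous (coordsSnoc F l) := fun l => by
    refine Fin.lastCases ?_ (fun i => ?_) l
    · simpa [coordsSnoc] using hFc
    · simpa [coordsSnoc] using continuous_apply i
  have hana : ∀ l, AnalyticAt ℝ (coordsSnoc F l) 0 := fun l => by
    refine Fin.lastCases ?_ (fun i => ?_) l
    · simpa [coordsSnoc] using hFa
    · simpa [coordsSnoc] using analyticAt_coord i 0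
  have hzero : ∀ l, coordsSnoc F l 0 = 0 := fun l => by
    refine Fin.lastCases ?_ (fun i => ?_) l
    · simpa [coordsSnoc] using hF0
    · simp [coordsSnoc]
  have hind : ∀ a : Fin (n + 1) → ℝ, a ≠ 0 → ¬ lin (coordsSnoc F) a =ᶠ[𝓝 0] 0 := by
    intro a ha h0
    by_cases h : ∀ i : Fin n, a i.castSucc = 0
    · refine hne (h0.mono fun x hx => ?_)
      rw [lin_coordsSnoc_of_castSucc_eq_zero F h] at hx
      exact (mul_eq_zero.1 hx).resolve_left (last_ne_zero ha h)
    · push Not at h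
      obtain ⟨i, hi⟩ := h
      refine sum_smul_proj_ne_zero hi ?_
      rw [← (hasStrictFDerivAt_lin_coordsSnoc hFa hdF a).hasFDerivAt.fderiv, h0.fderiv_eq]
      exact fderiv_const_apply 0
  have hgn' : g < 1 := hgn.trans_le (by rw [div_le_one (by positivity)]; linarith [n.cast_nonneg (α := ℝ)])
  have hcard : ∀ ξ : EuclideanSpace ℝ (Fin (n + 1)), ‖ξ‖ ≤ (n + 1) * ‖-WithLp.ofLp ξ‖ := fun ξ => by
    simpa using EuclideanSpace.norm_le_card_mul ξ
  have hexp : ∀ t : ℝ, t ^ (-(1 : ℝ) / (n + 1)) = t ^ (-(1 / ((n : ℝ) + 1))) := fun t => by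
    rw [neg_div]
  have hlog0 : ∀ ξ : {ξ : EuclideanSpace ℝ (Fin (n + 1)) // 2 < ‖ξ‖},
      0 ≤ ‖ξ.1‖ ^ (-g) * Real.log ‖ξ.1‖ ^ k := fun ξ => by
    have := Real.log_nonneg (one_le_two.trans ξ.2.le)
    positivity
  obtain ⟨δ, hδ, hbd⟩ := bd_id (Ξ := {ξ : EuclideanSpace ℝ (Fin (n + 1)) // 2 < ‖ξ‖})
    (v := fun ξ => -WithLp.ofLp ξ.1) hcont hana hzero hind hlog0 (by
      intro a ha
      by_cases h : ∀ i : Fin n, a i.castSucc = 0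
      · have hl := abs_pos.2 (last_ne_zero ha h)
        have := Fact.mk (lt_top_iff_ne_top.2 hWfin)
        obtain ⟨C', hC'⟩ := exists_lintegral_le_of_distribution hFc.measurable hg hgn hε₀ hC H
          (le_max_right (((n : ℝ) + 1) / |a (Fin.last n)|) 1)
        refine ⟨W, hW, C', fun ξ => ?_⟩
        simp only [lin_coordsSnoc_of_castSucc_eq_zero F h, abs_mul, hexp]
        have h1 := hC' ‖ξ.1‖ (‖-WithLp.ofLp ξ.1‖ * |a (Fin.last n)|) ξ.2 ((hcard ξ.1).trans ?_)
        · simpa only [mul_assoc] using h1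
        calc _ = ((n : ℝ) + 1) / |a (Fin.last n)| * (‖-WithLp.ofLp ξ.1‖ * |a (Fin.last n)|) := by
              field_simp
          _ ≤ _ := by gcongr; exact le_max_left _ _
      · push Not at h
        obtain ⟨i, hi⟩ := h
        have hlc : Continuous (lin (coordsSnoc F) a) := by
          unfold lin; exact continuous_finsetSum _ fun l _ => continuous_const.mul (hcont l)
        obtain ⟨ρ, hρ, C₁, hC₁, H₁⟩ := exists_volume_sublevel_le hlc
          (hasStrictFDerivAt_lin_coordsSnoc hFa hdF a) (sum_smul_proj_ne_zero hi)
        have := Fact.mk (measure_closedBall_lt_top (μ := volume) (x := (0 : Fin n → ℝ)) (r := ρ))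
        obtain ⟨C', hC'⟩ := exists_lintegral_le_of_distribution (k := k) hlc.measurable hg hgn
          (Real.exp_pos (-1)) hC₁ (fun ε h0 h1 => (H₁ ε h0).trans (ENNReal.ofReal_le_ofReal (by
            gcongr
            have h2 : 1 ≤ Real.log (1 / ε) := by
              rw [one_div, Real.log_inv, le_neg]
              exact (Real.log_le_iff_le_exp h0).2 h1.le
            have h3 : ε ≤ 1 := h1.le.trans (Real.exp_le_one_iff.2 (by norm_num))
            calc ε = ε ^ (1 : ℝ) * 1 := by simp
              _ ≤ ε ^ g * Real.log (1 / ε) ^ k :=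
                mul_le_mul (Real.rpow_le_rpow_of_exponent_ge h0 h3 hgn'.le) (one_le_pow₀ h2)
                  zero_le_one (by positivity))))
          (c := (n : ℝ) + 1) (by linarith [n.cast_nonneg (α := ℝ)])
        refine ⟨_, Metric.closedBall_mem_nhds _ hρ, C', fun ξ => ?_⟩
        simp only [hexp]
        exact hC' ‖ξ.1‖ _ ξ.2 (hcard ξ.1))
  refine ⟨δ, hδ, fun φ hφ hφ0 => ?_⟩
  obtain ⟨C', hC'⟩ := hbd φ hφ hφ0
  exact ⟨C', fun ξ hξ => by simpa using hC' ⟨ξ, hξ⟩⟩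

end Model

theorem tendsto_rpow_mul_log_pow {g : ℝ} (hg : 0 < g) (k : ℕ) :
    Tendsto (fun ε : ℝ => ε ^ g * Real.log (1 / ε) ^ k) (𝓝[>] 0) (𝓝 0) := by
  refine (isLittleO_abs_log_rpow_rpow_nhdsGT_zero (s := -g) k
    (by linarith)).tendsto_div_nhds_zero.congr' ?_
  filter_upwards [Ioo_mem_nhdsGT one_pos] with ε hε
  rw [Real.rpow_neg hε.1.le, div_inv_eq_mul, Real.rpow_natCast,
    abs_of_nonpos (Real.log_nonpos hε.1.le hε.2.le), one_div, Real.log_inv, mul_comm]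

theorem not_eventuallyEq_zero_of_asymp {n : ℕ} {f : EuclideanSpace ℝ (Fin n) → ℝ} {g : ℝ}
    (hg : 0 < g) {k : ℕ} {r₀ : ℝ} (hr₀ : 0 < r₀)
    (hasymp : ∀ r : ℝ, 0 < r → r < r₀ → ∃ c : ℝ, 0 < c ∧
      (fun ε : ℝ =>
          (volume {x : EuclideanSpace ℝ (Fin n) | ‖x‖ < r ∧ |f x| < ε}).toReal
            - c * ε ^ g * (Real.log (1 / ε)) ^ k)
        =o[𝓝[>] (0 : ℝ)] fun ε : ℝ => ε ^ g * (Real.log (1 / ε)) ^ k) :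
    ¬ f =ᶠ[𝓝 0] 0 := fun h => by
  obtain ⟨ρ, hρ, hball⟩ := Metric.eventually_nhds_iff_ball.1 h
  set r := min ρ (r₀ / 2) with hr
  have hr0 : 0 < r := lt_min hρ (by linarith)
  obtain ⟨c, -, hc⟩ := hasymp r hr0 ((min_le_right _ _).trans_lt (by linarith))
  have ht := tendsto_rpow_mul_log_pow hg k
  have h1 := hc.trans_tendsto ht
  have h2 := h1.add (ht.const_mul c)
  have h3 : Tendsto (fun _ : ℝ => (volume (Metric.ball (0 : EuclideanSpace ℝ (Fin n)) r)).toReal)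
      (𝓝[>] 0) (𝓝 (0 + c * 0)) := by
    refine h2.congr' ?_
    filter_upwards [self_mem_nhdsWithin] with ε hε
    have : {x : EuclideanSpace ℝ (Fin n) | ‖x‖ < r ∧ |f x| < ε} = Metric.ball 0 r := by
      ext x
      rw [mem_ball_zero_iff]
      refine ⟨fun h => h.1, fun hx => ⟨hx, ?_⟩⟩
      have h0 : f x = 0 := hball x (mem_ball_zero_iff.2 (hx.trans_le (min_le_left _ _)))
      rw [h0, abs_zero]
      exact hε
    rw [this]
    ring
  have h4 := tendsto_nhds_unique tendsto_const_nhds h3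
  rw [mul_zero, zero_add] at h4
  exact (ENNReal.toReal_pos (Metric.measure_ball_pos volume _ hr0).ne'
    measure_ball_lt_top.ne).ne' h4

theorem exists_distribution_bound {n : ℕ} {f : EuclideanSpace ℝ (Fin n) → ℝ} {g : ℝ} {k : ℕ}
    {r c : ℝ}
    (h : (fun ε : ℝ =>
          (volume {x : EuclideanSpace ℝ (Fin n) | ‖x‖ < r ∧ |f x| < ε}).toReal
            - c * ε ^ g * (Real.log (1 / ε)) ^ k)
        =o[𝓝[>] (0 : ℝ)] fun ε : ℝ => ε ^ g * (Real.log (1 / ε)) ^ k) :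
    ∃ ε₀ > 0, ∀ ε, 0 < ε → ε < ε₀ →
      volume {x : EuclideanSpace ℝ (Fin n) | ‖x‖ < r ∧ |f x| < ε} ≤
        ENNReal.ofReal ((c + 1) * (ε ^ g * Real.log (1 / ε) ^ k)) := by
  obtain ⟨ε₁, hε₁, hb⟩ := (mem_nhdsGT_iff_exists_Ioo_subset).1 (h.def one_pos)
  have hε₁' : 0 < ε₁ := hε₁
  refine ⟨min ε₁ 1, by positivity, fun ε h0 h1 => ?_⟩
  have h2 := hb ⟨h0, h1.trans_le (min_le_left _ _)⟩
  have hlog : 0 ≤ Real.log (1 / ε) := Real.log_nonneg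
    (by rw [one_div]; exact (one_le_inv₀ h0).2 (h1.le.trans (min_le_right _ _)))
  have h3 : 0 ≤ ε ^ g * Real.log (1 / ε) ^ k := by positivity
  have hfin : volume {x : EuclideanSpace ℝ (Fin n) | ‖x‖ < r ∧ |f x| < ε} ≠ ⊤ :=
    ((measure_mono fun x hx => mem_ball_zero_iff.2 hx.1).trans_lt
      (measure_ball_lt_top (x := (0 : EuclideanSpace ℝ (Fin n))) (r := r))).ne
  rw [← ENNReal.ofReal_toReal hfin]
  refine ENNReal.ofReal_le_ofReal ?_
  simp only [Set.mem_ofPred_eq, Real.norm_eq_abs, one_mul, abs_of_nonneg h3] at h2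
  linarith [le_abs_self ((volume {x : EuclideanSpace ℝ (Fin n) | ‖x‖ < r ∧ |f x| < ε}).toReal
            - c * ε ^ g * (Real.log (1 / ε)) ^ k)]

theorem continuous_mul_of_tsupport_subset {X : Type*} [TopologicalSpace X] {η f : X → ℝ}
    (hη : Continuous η) (hf : ∀ x ∈ tsupport η, ContinuousAt f x) :
    Continuous fun x => η x * f x := by
  refine continuous_iff_continuousAt.2 fun x => ?_
  by_cases hx : x ∈ tsupport η
  · exact hη.continuousAt.mul (hf x hx)
  · refine (continuousAt_const (y := (0 : ℝ))).congr ?_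
    filter_upwards [notMem_tsupport_iff_eventuallyEq.1 hx] with y hy
    simp [hy]

/-- Fourier transform decay of a hypersurface measure; case `g < 1/(n+1)`. -/
theorem stmt0
    (n : ℕ) (hn : 1 ≤ n)
    (f : EuclideanSpace ℝ (Fin n) → ℝ)
    (U : Set (EuclideanSpace ℝ (Fin n))) (hU : U ∈ 𝓝 (0 : EuclideanSpace ℝ (Fin n)))
    (hfa : AnalyticOnNhd ℝ f U) (hf0 : f 0 = 0) (hdf : fderiv ℝ f 0 = 0)
    (g : ℝ) (hg0 : 0 < g) (hg : g < 1 / (n + 1))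
    (k : ℕ) (hk : k ≤ n - 1)
    (r₀ : ℝ) (hr₀ : 0 < r₀)
    (hasymp : ∀ r : ℝ, 0 < r → r < r₀ → ∃ c : ℝ, 0 < c ∧
      (fun ε : ℝ =>
          (volume {x : EuclideanSpace ℝ (Fin n) | ‖x‖ < r ∧ |f x| < ε}).toReal
            - c * ε ^ g * (Real.log (1 / ε)) ^ k)
        =o[𝓝[>] (0 : ℝ)] fun ε : ℝ => ε ^ g * (Real.log (1 / ε)) ^ k) :
    ∃ N : Set (EuclideanSpace ℝ (Fin n)), N ∈ 𝓝 (0 : EuclideanSpace ℝ (Fin n)) ∧ N ⊆ U ∧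
      ∀ φ : EuclideanSpace ℝ (Fin n) → ℝ,
        ContDiff ℝ (⊤ : ℕ∞) φ → HasCompactSupport φ → tsupport φ ⊆ N →
        ∃ C : ℝ, 0 < C ∧
          ∀ ξ : EuclideanSpace ℝ (Fin (n + 1)), 2 < ‖ξ‖ →
            ‖∫ x : EuclideanSpace ℝ (Fin n),
                (φ x : ℂ) * Complex.exp (-(Complex.I) *
                  ((ξ (Fin.last n) * f x + ∑ i : Fin n, ξ i.castSucc * x i : ℝ) : ℂ))‖
              ≤ C * ‖ξ‖ ^ (-g) * (Real.log ‖ξ‖) ^ k := by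
  have hne := not_eventuallyEq_zero_of_asymp hg0 hr₀ hasymp
  obtain ⟨c, hc, hcε⟩ := hasymp (r₀ / 2) (by linarith) (by linarith)
  obtain ⟨ε₀, hε₀, hdist⟩ := exists_distribution_bound hcε
  let e : (Fin n → ℝ) ≃L[ℝ] EuclideanSpace ℝ (Fin n) :=
    (PiLp.continuousLinearEquiv 2 ℝ fun _ : Fin n => ℝ).symm
  have he0 : Tendsto e (𝓝 0) (𝓝 0) := by simpa using e.continuous.tendsto 0
  have hes0 : Tendsto e.symm (𝓝 0) (𝓝 0) := by simpa using e.symm.continuous.tendsto 0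
  have hvol : MeasurePreserving (MeasurableEquiv.toLp 2 (Fin n → ℝ)) :=
    (EuclideanSpace.volume_preserving_symm_measurableEquiv_toLp (Fin n)).symm
  obtain ⟨η, hη, hηs, -, hη1⟩ := exists_cutoff (he0 hU)
  set F : (Fin n → ℝ) → ℝ := fun x => η x * f (e x) with hF
  have hFf : F =ᶠ[𝓝 0] fun x => f (e x) := hη1.mono fun x hx => by simp [hF, hx]
  have hfa0 : AnalyticAt ℝ f (e 0) := by rw [map_zero]; exact hfa 0 (mem_of_mem_nhds hU)
  have hFa : AnalyticAt ℝ F 0 :=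
    (hfa0.comp (e.analyticAt 0)).congr hFf.symm
  have hFc : Continuous F := continuous_mul_of_tsupport_subset hη.continuous fun x hx =>
    ContinuousAt.comp (f := e) (hfa _ (hηs hx)).continuousAt e.continuous.continuousAt
  have hdF : fderiv ℝ F 0 = 0 := by
    rw [Filter.EventuallyEq.fderiv_eq hFf]
    have h1 : HasFDerivAt f (0 : EuclideanSpace ℝ (Fin n) →L[ℝ] ℝ) (e 0) := by
      have h2 := hfa0.differentiableAt.hasFDerivAt
      rw [map_zero] at h2 ⊢
      rwa [hdf] at h2
    have h3 := h1.comp (0 : Fin n → ℝ) e.hasFDerivAt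
    rw [ContinuousLinearMap.zero_comp] at h3
    exact h3.fderiv
  have hneF : ¬ F =ᶠ[𝓝 0] 0 := fun h => hne (by
    filter_upwards [hes0.eventually (h.and hFf)] with x hx
    have := hx.2.symm.trans hx.1
    simpa using this)
  set W : Set (Fin n → ℝ) := {x | ‖e x‖ < r₀ / 2 ∧ η x = 1} with hW
  have hWn : W ∈ 𝓝 0 := by
    have h1 : ∀ᶠ x in 𝓝 (0 : Fin n → ℝ), ‖e x‖ < r₀ / 2 := by
      have h2 := he0.norm
      rw [norm_zero] at h2
      exact h2.eventually_lt_const (by linarith)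
    exact h1.and hη1
  have hWfin : volume W ≠ ⊤ := by
    refine ((measure_mono (t := MeasurableEquiv.toLp 2 (Fin n → ℝ) ⁻¹' Metric.ball 0 (r₀ / 2))
      fun x hx => ?_).trans_lt ?_).ne
    · exact mem_ball_zero_iff.2 hx.1
    · rw [hvol.measure_preimage_equiv]
      exact measure_ball_lt_top
  obtain ⟨δ, hδ, hdecay⟩ := exists_decay hFc hFa (by simp [hF, hf0]) hdF hneF (k := k) hg0 hg hWn
    hWfin (C := c + 1) (by linarith) hε₀ fun ε h0 h1 => by
      refine le_trans ?_ (hdist ε h0 h1)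
      rw [Measure.restrict_apply (measurableSet_lt hFc.abs.measurable measurable_const),
        ← hvol.measure_preimage_equiv]
      refine measure_mono fun x hx => ⟨hx.2.1, ?_⟩
      have h2 : |F x| < ε := hx.1
      rw [hF] at h2
      simp only [hx.2.2, one_mul] at h2
      exact h2
  refine ⟨{x | x ∈ U ∧ ‖e.symm x‖ ≤ δ ∧ η (e.symm x) = 1}, ?_, fun x hx => hx.1,
    fun φ hφ _ hφN => ?_⟩
  · have h1 : ∀ᶠ x in 𝓝 (0 : EuclideanSpace ℝ (Fin n)), ‖e.symm x‖ ≤ δ := by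
      have h2 := hes0.norm
      rw [norm_zero] at h2
      exact h2.eventually_le_const hδ
    exact Filter.inter_mem hU (h1.and (hes0.eventually hη1))
  have hφN' : ∀ x, φ (e x) ≠ 0 → ‖x‖ ≤ δ ∧ η x = 1 := fun x hx => by
    simpa using (hφN (subset_tsupport φ hx)).2
  obtain ⟨C, hC⟩ := hdecay (fun x => φ (e x))
    ((hφ.of_le (by exact_mod_cast le_top)).comp e.contDiff) fun x hx => by
      by_contra h
      exact absurd (hφN' x h).1 (not_le.2 hx)
  refine ⟨max C 1, by positivity, fun ξ hξ => ?_⟩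
  have hlog : 0 ≤ Real.log ‖ξ‖ := Real.log_nonneg (by linarith)
  rw [mul_assoc]
  refine le_trans (le_of_eq ?_) ((hC ξ hξ).trans
    (mul_le_mul_of_nonneg_right (le_max_left _ _) (by positivity)))
  rw [← hvol.integral_comp']
  congr 1
  refine integral_congr_ae (Eventually.of_forall fun x => ?_)
  change (φ (e x) : ℂ) * cexp (-I *
    ((ξ (Fin.last n) * f (e x) + ∑ i : Fin n, ξ i.castSucc * x i : ℝ) : ℂ)) =
      φ (e x) • cexp (I * (lin (coordsSnoc F) (-WithLp.ofLp ξ) x : ℝ))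
  by_cases hx : φ (e x) = 0
  · simp [hx]
  · rw [Complex.real_smul, lin_coordsSnoc]
    simp only [hF, (hφN' x hx).2, one_mul, Pi.neg_apply, neg_mul, Finset.sum_neg_distrib]
    congr 2
    push_cast
    ring
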